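/- Assume conditions (★). Let r_1,…,r_n be positive reals satisfying Σ_{k∈X̄(j)} r_j r_k/(1 + r_j r_k) = d_j for each 1 ≤ j ≤ n, and set λ_{jk} = r_j r_k/(1 + r_j r_k). Let F(θ) = ( ∏_{jk∈X̄} (1 + λ_{jk}(e^{i(θ_j+θ_k)} − 1)) ) · exp(−i Σ_{j=1}^n d_j θ_j) and ℛ = { θ ∈ ℝ^n : |θ_j| ≤ n^{−1/2+ε} for 1 ≤ j ≤ n }. Then there is a region S with ℛ ⊆ S ⊆ 4ℛ such that ∫_S F(θ) dθ = 2^{−1/2} (π/(An))^{n/2} · exp( −(1−20A)/(24A) + λX/((1−λ)n) + R₂/(16A²n²) + O(n^{−b}) ) as n → ∞. -/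

import Mathlib

open Filter Finset Asymptotics MeasureTheory
open scoped Classical Topology

noncomputable section

/-- The number of simple graphs on `Fin n` with degree sequence `d` having
no edge in common with the graph `X`. -/
def gCount {n : ℕ} (d : Fin n → ℕ) (X : SimpleGraph (Fin n)) : ℕ :=
  Nat.card {H : SimpleGraph (Fin n) //
    (∀ v, Nat.card (H.neighborSet v) = d v) ∧ Disjoint H.edgeSet X.edgeSet}

/-- The degree `x_j` of vertex `j` in the graph `X`. -/
def xDeg {n : ℕ} (X : SimpleGraph (Fin n)) (j : Fin n) : ℕ :=
  Nat.card (X.neighborSet j)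

/-- The number of edges of `X`. -/
def xEdges {n : ℕ} (X : SimpleGraph (Fin n)) : ℕ := Nat.card X.edgeSet

/-- The average degree `d̄ = 2E/n`. -/
def dBar {n : ℕ} (d : Fin n → ℕ) : ℝ := (∑ j, (d j : ℝ)) / n

/-- The density `λ = d̄/(n-1)`. -/
def lamb {n : ℕ} (d : Fin n → ℕ) : ℝ := dBar d / ((n : ℝ) - 1)

/-- `A = λ(1-λ)/2`. -/
def aPar {n : ℕ} (d : Fin n → ℕ) : ℝ := lamb d * (1 - lamb d) / 2

/-- `δ_j = d_j - d̄ + λ x_j`. -/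
def deltaPar {n : ℕ} (d : Fin n → ℕ) (X : SimpleGraph (Fin n)) (j : Fin n) : ℝ :=
  (d j : ℝ) - dBar d + lamb d * (xDeg X j : ℝ)

/-- The sum over unordered pairs `{j,k}` with `X.Adj j k` of `f j * f k`. -/
def pairSum {n : ℕ} (X : SimpleGraph (Fin n)) (f : Fin n → ℝ) : ℝ :=
  (∑ j, ∑ k, if X.Adj j k then f j * f k else 0) / 2

/-- `R = Σ_j (d_j - d̄)²`. -/
def rPar {n : ℕ} (d : Fin n → ℕ) : ℝ := ∑ j, ((d j : ℝ) - dBar d)^2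

/-- The naive estimate `Ĝ(d,X)`. -/
def gHat {n : ℕ} (d : Fin n → ℕ) (X : SimpleGraph (Fin n)) : ℝ :=
  (1 - lamb d) ^ (-(xEdges X : ℝ)) *
  (lamb d ^ lamb d * (1 - lamb d) ^ (1 - lamb d)) ^ n.choose 2 *
  ∏ j, ((n - 1 - xDeg X j).choose (d j) : ℝ)

/-- The entropy-maximising edge probabilities `λ_{jk} = r_j r_k/(1 + r_j r_k)`. -/
def lamJK {n : ℕ} (r : Fin n → ℝ) (j k : Fin n) : ℝ := r j * r k / (1 + r j * r k)

/-- The integrand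
`F(θ) = ∏_{jk∈X̄}(1 + λ_{jk}(e^{i(θ_j+θ_k)} - 1)) · exp(-i Σ_j d_j θ_j)`. -/
def fInt {n : ℕ} (d : Fin n → ℕ) (X : SimpleGraph (Fin n)) (r : Fin n → ℝ)
    (θ : Fin n → ℝ) : ℂ :=
  (∏ j : Fin n, ∏ k : Fin n,
    if j < k ∧ ¬ X.Adj j k then
      1 + (lamJK r j k : ℂ) * (Complex.exp (Complex.I * ((θ j : ℂ) + (θ k : ℂ))) - 1)
    else 1)
  * Complex.exp (-Complex.I * ((∑ j, (d j : ℝ) * θ j : ℝ) : ℂ))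

/-- The dilated box `tℛ = {θ : |θ_j| ≤ t n^{-1/2+ε} for all j}`. -/
def box (n : ℕ) (t ε : ℝ) : Set (Fin n → ℝ) :=
  {θ | ∀ j, |θ j| ≤ t * (n : ℝ) ^ (-(1:ℝ)/2 + ε)}

section

open ProbabilityTheory

/-- The standard normal law on the line. -/
abbrev stdG : Measure ℝ := gaussianReal 0 1

/-- The standard normal law on `Fin n → ℝ`. -/
abbrev stdPi (n : ℕ) : Measure (Fin n → ℝ) := Measure.pi fun _ => stdG

lemma integrable_pow_stdG (k : ℕ) : Integrable (fun y : ℝ => y ^ k) stdG := by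
  have h := (memLp_id_gaussianReal (μ := 0) (v := 1) (k : NNReal))
  have h2 := h.integrable_norm_pow'
  simp only [id] at h2
  refine h2.mono' (by fun_prop) (ae_of_all _ fun y => ?_)
  simp

lemma integral_pow_add_two_stdG (k : ℕ) :
    ∫ y, y ^ (k + 2) ∂stdG = (k + 1) * ∫ y, y ^ k ∂stdG := by
  have hInt : ∀ k : ℕ, Integrable (fun y : ℝ => y ^ k * gaussianPDFReal 0 1 y) := by
    intro k
    have := integrable_pow_stdG k
    rw [stdG, gaussianReal_of_var_ne_zero _ one_ne_zero,
      integrable_withDensity_iff (measurable_gaussianPDF 0 1)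
        (ae_of_all _ fun _ => gaussianPDF_lt_top)] at this
    simpa [toReal_gaussianPDF] using this
  have hd : ∀ x : ℝ, HasDerivAt (gaussianPDFReal 0 1) (-(x * gaussianPDFReal 0 1 x)) x := by
    intro x
    have h1 : HasDerivAt (fun x : ℝ => (√(2 * Real.pi * 1))⁻¹ * Real.exp (-(x - 0) ^ 2 / (2 * 1)))
        ((√(2 * Real.pi * 1))⁻¹ * (Real.exp (-(x - 0) ^ 2 / (2 * 1)) * (-x))) x := by
      refine (HasDerivAt.exp ?_).const_mul _
      have := (((hasDerivAt_id x).sub_const 0).pow 2).neg.div_const (2 * 1 : ℝ)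
      refine this.congr_deriv ?_
      simp
      ring
    have : gaussianPDFReal 0 1 =
        fun x : ℝ => (√(2 * Real.pi * 1))⁻¹ * Real.exp (-(x - 0) ^ 2 / (2 * 1)) := by
      ext x; simp [gaussianPDFReal]
    rw [this]
    convert h1 using 1
    ring
  have key := integral_mul_deriv_eq_deriv_mul_of_integrable
    (u := fun y : ℝ => y ^ (k + 1)) (v := gaussianPDFReal 0 1)
    (u' := fun y => ((k + 1 : ℕ) : ℝ) * y ^ k)
    (v' := fun y => -(y * gaussianPDFReal 0 1 y))
    (fun x _ => by simpa using hasDerivAt_pow (k + 1) x) (fun x _ => hd x)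
    (by
      have := (hInt (k + 2)).neg
      refine this.congr (ae_of_all _ fun y => ?_)
      simp; ring)
    (by
      have := (hInt k).const_mul ((k + 1 : ℕ) : ℝ)
      refine this.congr (ae_of_all _ fun y => ?_)
      simp; ring)
    (hInt (k + 1))
  rw [integral_gaussianReal_eq_integral_smul one_ne_zero,
    integral_gaussianReal_eq_integral_smul one_ne_zero]
  simp only [smul_eq_mul]
  have e1 : ∫ x, x ^ (k + 1) * -(x * gaussianPDFReal 0 1 x)
      = - ∫ x, gaussianPDFReal 0 1 x * x ^ (k + 2) := by
    rw [← integral_neg]; congr 1; ext x; ring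
  have e2 : ∫ x, ((k + 1 : ℕ) : ℝ) * x ^ k * gaussianPDFReal 0 1 x
      = (k + 1) * ∫ x, gaussianPDFReal 0 1 x * x ^ k := by
    rw [← integral_const_mul]; congr 1; ext x; push_cast; ring
  rw [e1, e2] at key
  linarith

lemma integral_pow_zero_stdG : ∫ y, y ^ 0 ∂stdG = (1 : ℝ) := by simp

lemma integral_pow_one_stdG : ∫ y, y ^ 1 ∂stdG = (0 : ℝ) := by
  simp [integral_id_gaussianReal]

lemma integral_pow_two_stdG : ∫ y, y ^ 2 ∂stdG = (1 : ℝ) := by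
  have := integral_pow_add_two_stdG 0
  rw [integral_pow_zero_stdG] at this; simpa using this

lemma integral_pow_three_stdG : ∫ y, y ^ 3 ∂stdG = (0 : ℝ) := by
  have := integral_pow_add_two_stdG 1
  rw [integral_pow_one_stdG] at this; simpa using this

lemma integral_pow_four_stdG : ∫ y, y ^ 4 ∂stdG = (3 : ℝ) := by
  have := integral_pow_add_two_stdG 2
  rw [integral_pow_two_stdG] at this; norm_num at this ⊢; exact this

lemma integral_pow_six_stdG : ∫ y, y ^ 6 ∂stdG = (15 : ℝ) := by
  have := integral_pow_add_two_stdG 4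
  rw [integral_pow_four_stdG] at this; norm_num at this ⊢; exact this

lemma integral_pow_eight_stdG : ∫ y, y ^ 8 ∂stdG = (105 : ℝ) := by
  have := integral_pow_add_two_stdG 6
  rw [integral_pow_six_stdG] at this; norm_num at this ⊢; exact this

open Polynomial in
lemma integrable_eval_stdG (p : ℝ[X]) : Integrable (fun y => p.eval y) stdG := by
  simp only [eval_eq_sum_range]
  exact integrable_finsetSum _ fun k _ => (integrable_pow_stdG k).const_mul _

open Polynomial in
lemma integrable_prod_eval {n : ℕ} (P : Fin n → ℝ[X]) :
    Integrable (fun y : Fin n → ℝ => ∏ i, (P i).eval (y i)) (stdPi n) :=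
  Integrable.fintype_prod fun i => integrable_eval_stdG (P i)

open Polynomial in
lemma integral_prod_eval {n : ℕ} (P : Fin n → ℝ[X]) :
    ∫ y, ∏ i, (P i).eval (y i) ∂(stdPi n) = ∏ i, ∫ t, (P i).eval t ∂stdG :=
  integral_fintype_prod_eq_prod (fun i t => (P i).eval t)

lemma integral_abs_le_sqrt {Ω : Type*} [MeasurableSpace Ω] (μ : Measure Ω) [IsProbabilityMeasure μ]
    {S : Ω → ℝ} (h1 : Integrable S μ) (h2 : Integrable (fun ω => S ω ^ 2) μ) :
    ∫ ω, |S ω| ∂μ ≤ √(∫ ω, S ω ^ 2 ∂μ) := by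
  apply Real.le_sqrt_of_sq_le
  set m := ∫ ω, |S ω| ∂μ with hm
  have h : 0 ≤ ∫ ω, (|S ω| - m) ^ 2 ∂μ := integral_nonneg fun _ => sq_nonneg _
  have e : ∫ ω, (|S ω| - m) ^ 2 ∂μ = ∫ ω, S ω ^ 2 ∂μ - 2 * m * m + m ^ 2 := by
    have : ∀ ω, (|S ω| - m) ^ 2 = S ω ^ 2 - 2 * m * |S ω| + m ^ 2 := fun ω => by
      rw [sub_sq, sq_abs]; ring
    have i : Integrable (fun ω => S ω ^ 2 - 2 * m * |S ω|) μ := h2.sub (h1.abs.const_mul _)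
    simp_rw [this]
    rw [integral_add i (integrable_const _), integral_sub h2 (h1.abs.const_mul _),
      integral_const_mul]
    simp [hm]
  nlinarith

open Polynomial in
lemma integral_abs_sum_orthogonal_le {n : ℕ} {α : Type*} [Fintype α] (P : α → Fin n → ℝ[X])
    (c : α → ℝ) (V : ℝ)
    (hV : ∀ a, c a ≠ 0 → ∏ i, ∫ t, (P a i * P a i).eval t ∂stdG = V)
    (ho : ∀ a b, a ≠ b → c a ≠ 0 → c b ≠ 0 → ∃ i, ∫ t, (P a i * P b i).eval t ∂stdG = 0) :
    ∫ y, |∑ a, c a * ∏ i, (P a i).eval (y i)| ∂(stdPi n) ≤ √(V * ∑ a, c a ^ 2) := by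
  have hsq : ∀ y : Fin n → ℝ, (∑ a, c a * ∏ i, (P a i).eval (y i)) ^ 2
      = ∑ a, ∑ b, c a * c b * ∏ i, (P a i * P b i).eval (y i) := fun y => by
    rw [sq, Finset.sum_mul_sum]
    refine Finset.sum_congr rfl fun a _ => Finset.sum_congr rfl fun b _ => ?_
    simp only [eval_mul, Finset.prod_mul_distrib]; ring
  have hInt : Integrable (fun y : Fin n → ℝ => (∑ a, c a * ∏ i, (P a i).eval (y i)) ^ 2)
      (stdPi n) := by
    simp_rw [hsq]
    exact integrable_finsetSum _ fun a _ => integrable_finsetSum _ fun b _ =>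
      (integrable_prod_eval _).const_mul _
  refine (integral_abs_le_sqrt _ (integrable_finsetSum _ fun a _ =>
    (integrable_prod_eval _).const_mul _) hInt).trans (Real.sqrt_le_sqrt (le_of_eq ?_))
  simp_rw [hsq]
  rw [integral_finsetSum _ fun a _ => integrable_finsetSum _ fun b _ =>
      (integrable_prod_eval _).const_mul _, Finset.mul_sum]
  refine Finset.sum_congr rfl fun a _ => ?_
  rw [integral_finsetSum _ fun b _ => (integrable_prod_eval _).const_mul _]
  rw [Finset.sum_eq_single a]
  · rw [integral_const_mul, integral_prod_eval]
    by_cases hc : c a = 0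
    · simp [hc]
    · rw [hV a hc]; ring
  · intro b _ hb
    rw [integral_const_mul, integral_prod_eval]
    by_cases hc : c a = 0
    · simp [hc]
    by_cases hc' : c b = 0
    · simp [hc']
    obtain ⟨i, hi⟩ := ho a b hb.symm hc hc'
    rw [Finset.prod_eq_zero (Finset.mem_univ i) hi, mul_zero]
  · simp

open Polynomial in
lemma integral_abs_sum_single_le {n : ℕ} (g : ℝ[X]) (c : Fin n → ℝ) (V : ℝ)
    (h0 : ∫ t, g.eval t ∂stdG = 0) (h2 : ∫ t, (g * g).eval t ∂stdG = V) :
    ∫ y, |∑ j, c j * g.eval (y j)| ∂(stdPi n) ≤ √(V * ∑ j, c j ^ 2) := by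
  have := integral_abs_sum_orthogonal_le (n := n) (fun j i => if i = j then g else 1) c V
    (fun a _ => by
      rw [Finset.prod_eq_single a]
      · simpa using h2
      · intro b _ hb; simp [hb]
      · simp)
    (fun a b hab _ _ => ⟨a, by simpa [hab] using h0⟩)
  convert this using 6 with y j
  rw [Finset.prod_eq_single j] <;> simp +contextual

open Polynomial in
lemma integral_abs_sum_pair_le {n : ℕ} (g h : ℝ[X]) (M : Fin n → Fin n → ℝ) (V W : ℝ)
    (hM : ∀ j, M j j = 0)
    (g0 : ∫ t, g.eval t ∂stdG = 0) (h0 : ∫ t, h.eval t ∂stdG = 0)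
    (gh : ∫ t, (g * h).eval t ∂stdG = 0)
    (g2 : ∫ t, (g * g).eval t ∂stdG = V) (h2 : ∫ t, (h * h).eval t ∂stdG = W) :
    ∫ y, |∑ j, ∑ k, M j k * (g.eval (y j) * h.eval (y k))| ∂(stdPi n)
      ≤ √(V * W * ∑ j, ∑ k, M j k ^ 2) := by
  have := integral_abs_sum_orthogonal_le (n := n) (α := Fin n × Fin n)
    (fun a i => (if i = a.1 then g else 1) * (if i = a.2 then h else 1)) (fun a => M a.1 a.2)
    (V * W)
    (fun a ha => by
      have hne : a.1 ≠ a.2 := fun e => ha (by rw [e]; exact hM _)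
      rw [Finset.prod_eq_mul a.1 a.2 hne]
      · simp only [if_true, if_neg hne, if_neg hne.symm, mul_one, one_mul, g2, h2]
      · intro b _ hb; simp [hb.1, hb.2]
      · simp
      · simp)
    (fun a b hab ha hb => by
      have ha' : a.1 ≠ a.2 := fun e => ha (by rw [e]; exact hM _)
      have hb' : b.1 ≠ b.2 := fun e => hb (by rw [e]; exact hM _)
      by_cases h1 : a.1 = b.1
      · have h3 : a.2 ≠ b.2 := fun e => hab (Prod.ext h1 e)
        refine ⟨a.2, ?_⟩
        simp only [if_neg ha'.symm, if_neg h3, if_neg (h1 ▸ ha'.symm : ¬ a.2 = b.1)]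
        simpa using h0
      by_cases h2 : a.1 = b.2
      · refine ⟨a.1, ?_⟩
        simp only [if_neg ha', if_neg h1, if_pos h2]
        simpa using gh
      · refine ⟨a.1, ?_⟩
        simp only [if_neg ha', if_neg h1, if_neg h2]
        simpa using g0)
  simp_rw [Fintype.sum_prod_type] at this
  convert this using 8 with y j _ k
  simp only [eval_mul, Finset.prod_mul_distrib]
  rw [Finset.prod_eq_single j, Finset.prod_eq_single k] <;> simp +contextual

open Polynomial in
lemma integral_abs_cubic_sub_le {n : ℕ} (P : Fin n → ℝ) (M : Fin n → Fin n → ℝ) (τ : ℝ)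
    (hM : ∀ j, M j j = 0) :
    ∫ y, |(∑ j, P j * y j ^ 3 + 3 * ∑ j, ∑ k, M j k * (y j ^ 2 * y k))
        - τ * ∑ j, (y j ^ 3 + 3 * y j)| ∂(stdPi n)
      ≤ √(15 * ∑ j, (P j - τ) ^ 2) + 3 * √(∑ k, (∑ j, M j k - τ) ^ 2)
        + 3 * √(2 * ∑ j, ∑ k, M j k ^ 2) := by
  have h3 := integral_abs_sum_single_le (n := n) (X ^ 3) (fun j => P j - τ) 15
    (by simpa using integral_pow_three_stdG)
    (by simp only [← pow_add, eval_pow, eval_X]; exact integral_pow_six_stdG)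
  have h1 := integral_abs_sum_single_le (n := n) X (fun k => ∑ j, M j k - τ) 1
    (by simp)
    (by simpa [← sq] using integral_pow_two_stdG)
  have hp := integral_abs_sum_pair_le (n := n) (X ^ 2 - 1) X M 2 1 hM
    (by
      simp only [eval_sub, eval_pow, eval_X, eval_one]
      rw [integral_sub (integrable_pow_stdG 2) (integrable_const _), integral_pow_two_stdG]; simp)
    (by simp)
    (by
      have : ∀ t : ℝ, ((X ^ 2 - 1) * X : ℝ[X]).eval t = t ^ 3 - t ^ 1 := fun t => by simp; ring
      simp_rw [this]
      rw [integral_sub (integrable_pow_stdG 3) (integrable_pow_stdG 1), integral_pow_three_stdG,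
        integral_pow_one_stdG]; simp)
    (by
      have : ∀ t : ℝ, ((X ^ 2 - 1) * (X ^ 2 - 1) : ℝ[X]).eval t = t ^ 4 - 2 * t ^ 2 + 1 :=
        fun t => by simp; ring
      have i : Integrable (fun t : ℝ => t ^ 4 - 2 * t ^ 2) stdG :=
        (integrable_pow_stdG 4).sub ((integrable_pow_stdG 2).const_mul 2)
      simp_rw [this]
      rw [integral_add i (integrable_const _), integral_sub (integrable_pow_stdG 4)
        ((integrable_pow_stdG 2).const_mul 2), integral_const_mul, integral_pow_four_stdG,
        integral_pow_two_stdG]; norm_num)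
    (by simpa [← sq] using integral_pow_two_stdG)
  simp only [eval_pow, eval_X, eval_sub, eval_one, one_mul, mul_one] at h3 h1 hp
  have hi : ∀ (j : Fin n) (k : ℕ), Integrable (fun y : Fin n → ℝ => y j ^ k) (stdPi n) :=
    fun j k => by
      have := integrable_prod_eval (n := n) (fun i => if i = j then X ^ k else 1)
      refine this.congr (ae_of_all _ fun y => ?_)
      beta_reduce
      rw [Finset.prod_eq_single j] <;> simp +contextual
  have hi2 : ∀ j k : Fin n, Integrable (fun y : Fin n → ℝ => y j ^ 2 * y k) (stdPi n) :=
    fun j k => by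
      have := integrable_prod_eval (n := n)
        (fun i => (if i = j then X ^ 2 else 1) * (if i = k then X else 1))
      refine this.congr (ae_of_all _ fun y => ?_)
      simp only [eval_mul, Finset.prod_mul_distrib]
      rw [Finset.prod_eq_single j, Finset.prod_eq_single k] <;> simp +contextual
  have hi1 : ∀ j : Fin n, Integrable (fun y : Fin n → ℝ => y j) (stdPi n) := fun j => by
    simpa using hi j 1
  have i3 : Integrable (fun y : Fin n → ℝ => |∑ j, (P j - τ) * y j ^ 3|) (stdPi n) :=
    (integrable_finsetSum _ fun j _ => (hi j 3).const_mul _).abs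
  have i1 : Integrable (fun y : Fin n → ℝ => |∑ k, (∑ j, M j k - τ) * y k|) (stdPi n) :=
    (integrable_finsetSum _ fun j _ => (hi1 j).const_mul _).abs
  have ip : Integrable (fun y : Fin n → ℝ => |∑ j, ∑ k, M j k * ((y j ^ 2 - 1) * y k)|)
      (stdPi n) := by
    refine (integrable_finsetSum _ fun j _ => integrable_finsetSum _ fun k _ =>
      Integrable.const_mul ?_ _).abs
    simp only [sub_mul, one_mul]
    exact (hi2 j k).sub (hi1 k)
  calc _ ≤ ∫ y, (|∑ j, (P j - τ) * y j ^ 3| + 3 * |∑ k, (∑ j, M j k - τ) * y k|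
          + 3 * |∑ j, ∑ k, M j k * ((y j ^ 2 - 1) * y k)|) ∂(stdPi n) := by
        refine integral_mono_of_nonneg (ae_of_all _ fun y => abs_nonneg _)
          ((i3.add (i1.const_mul 3)).add (ip.const_mul 3)) (ae_of_all _ fun y => ?_)
        have e : (∑ j, P j * y j ^ 3 + 3 * ∑ j, ∑ k, M j k * (y j ^ 2 * y k))
            - τ * ∑ j, (y j ^ 3 + 3 * y j)
            = (∑ j, (P j - τ) * y j ^ 3) + 3 * (∑ k, (∑ j, M j k - τ) * y k)
              + 3 * (∑ j, ∑ k, M j k * ((y j ^ 2 - 1) * y k)) := by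
          simp only [sub_mul, one_mul, mul_sub, Finset.sum_sub_distrib, Finset.sum_add_distrib,
            Finset.mul_sum, Finset.sum_mul, mul_add]
          rw [Finset.sum_comm (f := fun k j => 3 * (M j k * y k))]
          simp only [mul_left_comm τ 3]
          ring
        simp only [e]
        refine (abs_add_three _ _ _).trans (le_of_eq ?_)
        simp [abs_mul]
    _ ≤ _ := by
        have i : Integrable (fun y : Fin n → ℝ => |∑ j, (P j - τ) * y j ^ 3|
            + 3 * |∑ k, (∑ j, M j k - τ) * y k|) (stdPi n) := i3.add (i1.const_mul 3)
        rw [integral_add i (ip.const_mul 3), integral_add i3 (i1.const_mul 3), integral_const_mul,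
          integral_const_mul]
        linarith

lemma integrable_exp_mul_sq_stdG {c : ℝ} (hc : c < 1 / 2) :
    Integrable (fun t => Real.exp (c * t ^ 2)) stdG := by
  rw [stdG, gaussianReal_of_var_ne_zero _ one_ne_zero,
    integrable_withDensity_iff (measurable_gaussianPDF 0 1)
      (ae_of_all _ fun _ => gaussianPDF_lt_top)]
  refine ((integrable_exp_neg_mul_sq (b := 1 / 2 - c) (by linarith)).const_mul
    (√(2 * Real.pi))⁻¹).congr (ae_of_all _ fun t => ?_)
  simp only [toReal_gaussianPDF, gaussianPDFReal, NNReal.coe_one, mul_one, sub_zero]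
  rw [mul_left_comm, ← Real.exp_add]
  congr 2; ring

lemma integral_exp_mul_sq_stdG {c : ℝ} (hc : c < 1 / 2) :
    ∫ t, Real.exp (c * t ^ 2) ∂stdG = (√(1 - 2 * c))⁻¹ := by
  rw [integral_gaussianReal_eq_integral_smul one_ne_zero]
  have e : ∀ t : ℝ, gaussianPDFReal 0 1 t • Real.exp (c * t ^ 2)
      = (√(2 * Real.pi))⁻¹ * Real.exp (-(1 / 2 - c) * t ^ 2) := fun t => by
    simp only [gaussianPDFReal, NNReal.coe_one, mul_one, sub_zero, smul_eq_mul]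
    rw [mul_assoc, ← Real.exp_add]
    congr 2; ring
  simp_rw [e]
  rw [integral_const_mul, integral_gaussian, ← Real.sqrt_inv, ← Real.sqrt_inv,
    ← Real.sqrt_mul (by positivity)]
  congr 1
  have : (1 - 2 * c) ≠ 0 := by linarith
  have : (1 / 2 - c) ≠ 0 := by linarith
  field_simp

lemma integral_exp_mul_sq_stdG_le {c : ℝ} (hc : |c| ≤ 1 / 4) :
    ∫ t, Real.exp (c * t ^ 2) ∂stdG ≤ Real.exp (c + 2 * c ^ 2) := by
  obtain ⟨h1, h2⟩ := abs_le.1 hc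
  rw [integral_exp_mul_sq_stdG (by linarith), ← Real.sqrt_inv]
  apply Real.sqrt_le_iff.2
  refine ⟨(Real.exp_pos _).le, ?_⟩
  rw [← Real.exp_nat_mul, inv_le_comm₀ (by linarith) (Real.exp_pos _), ← Real.exp_neg]
  rcases le_or_gt 0 c with h | h
  · have := Real.one_sub_le_exp_neg (2 * c)
    have hq := Real.quadratic_le_exp_of_nonneg (x := 2 * c + 4 * c ^ 2) (by positivity)
    have e : -(((2 : ℕ) : ℝ) * (c + 2 * c ^ 2)) = -(2 * c + 4 * c ^ 2) := by push_cast; ring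
    rw [e, Real.exp_neg]
    rw [inv_le_comm₀ (Real.exp_pos _) (by linarith)]
    refine le_trans ?_ hq
    rw [inv_le_iff_one_le_mul₀ (by linarith)]
    nlinarith [pow_nonneg h 2, pow_nonneg h 3, pow_nonneg h 4]
  · have e : -(((2 : ℕ) : ℝ) * (c + 2 * c ^ 2)) = 2 * (-c) - 4 * c ^ 2 := by push_cast; ring
    rw [e]
    set s := -c with hs
    have hs0 : 0 < s := by linarith
    have hs1 : s ≤ 1 / 4 := by linarith
    have : c ^ 2 = s ^ 2 := by rw [hs]; ring
    have hc' : 1 - 2 * c = 1 + 2 * s := by rw [hs]; ring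
    rw [this, hc']
    have := Real.abs_exp_sub_one_sub_id_le (x := 2 * s - 4 * s ^ 2)
      (by rw [abs_le]; constructor <;> nlinarith)
    have := (abs_le.1 this).2
    nlinarith [pow_pos hs0 2, pow_pos hs0 3, pow_pos hs0 4]

open Matrix in
lemma integrable_exp_quadratic_and_le {n : ℕ} (W : Fin n → Fin n → ℝ)
    (hs : ∀ j k, W j k = W k j) (hW : 16 * ∑ j, ∑ k, W j k ^ 2 ≤ 1) :
    Integrable (fun y : Fin n → ℝ => Real.exp (∑ j, ∑ k, W j k * (y j * y k))) (stdPi n) ∧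
    ∫ y, Real.exp (∑ j, ∑ k, W j k * (y j * y k)) ∂(stdPi n)
      ≤ Real.exp (∑ j, W j j + 2 * ∑ j, ∑ k, W j k ^ 2) := by
  have hA : (Matrix.of W).IsHermitian := by
    ext j k; simp [hs k j]
  set U : Matrix (Fin n) (Fin n) ℝ := ↑hA.eigenvectorUnitary with hU
  set μ := hA.eigenvalues
  have hD : star U * Matrix.of W * U = diagonal μ := by
    have := hA.conjStarAlgAut_star_eigenvectorUnitary
    rw [Unitary.conjStarAlgAut_star_apply] at this
    simpa using this
  have hUU : U * star U = 1 := Unitary.coe_mul_star_self hA.eigenvectorUnitary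
  have htr : ∑ j, W j j = ∑ i, μ i := by
    simpa [Matrix.trace] using hA.trace_eq_sum_eigenvalues
  have hsq : ∑ j, ∑ k, W j k ^ 2 = ∑ i, μ i ^ 2 := by
    have h1 : (Matrix.of W * Matrix.of W).trace = ∑ j, ∑ k, W j k ^ 2 := by
      simp only [Matrix.trace, Matrix.diag, Matrix.mul_apply, Matrix.of_apply]
      refine Finset.sum_congr rfl fun j _ => Finset.sum_congr rfl fun k _ => ?_
      rw [hs k j, sq]
    have h2 : (diagonal μ * diagonal μ).trace = ∑ i, μ i ^ 2 := by
      simp [diagonal_mul_diagonal, trace_diagonal, sq]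
    rw [← h1, ← h2, ← hD]
    have : star U * Matrix.of W * U * (star U * Matrix.of W * U)
        = star U * (Matrix.of W * Matrix.of W * U) := by
      calc _ = star U * Matrix.of W * (U * star U) * (Matrix.of W * U) := by
            simp only [Matrix.mul_assoc]
        _ = _ := by rw [hUU]; simp only [Matrix.mul_assoc, Matrix.one_mul]
    rw [this, Matrix.trace_mul_comm (star U), Matrix.mul_assoc _ U, hUU, Matrix.mul_one]
  have hμ : ∀ i, |μ i| ≤ 1 / 4 := fun i => by
    apply abs_le_of_sq_le_sq _ (by norm_num)
    have := Finset.single_le_sum (f := fun i => μ i ^ 2) (fun i _ => sq_nonneg _)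
      (Finset.mem_univ i)
    nlinarith
  have hmap : (stdPi n).map (fun x => U *ᵥ x) = stdPi n := by
    have h := map_pi_eq_stdGaussian (ι := Fin n)
    rw [stdGaussian_eq_map_pi_orthonormalBasis hA.eigenvectorBasis] at h
    have h' := congrArg (fun m => m.map (WithLp.ofLp (p := 2) (V := Fin n → ℝ))) h
    beta_reduce at h'
    rw [Measure.map_map (by fun_prop) (by fun_prop),
      Measure.map_map (by fun_prop) (by fun_prop)] at h'
    have e1 : (WithLp.ofLp (p := 2) (V := Fin n → ℝ)) ∘ (WithLp.toLp 2) = id := rfl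
    rw [e1, Measure.map_id] at h'
    refine Eq.trans ?_ h'.symm
    congr 1
    ext x j
    simp [U, Matrix.mulVec, dotProduct, mul_comm]
  have hq : ∀ x : Fin n → ℝ, ∑ j, ∑ k, W j k * ((U *ᵥ x) j * (U *ᵥ x) k) = ∑ i, μ i * x i ^ 2 := by
    intro x
    have h1 : ∑ j, ∑ k, W j k * ((U *ᵥ x) j * (U *ᵥ x) k)
        = (U *ᵥ x) ⬝ᵥ (Matrix.of W *ᵥ (U *ᵥ x)) := by
      simp only [dotProduct, Matrix.mulVec, Matrix.of_apply, Finset.mul_sum]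
      exact Finset.sum_congr rfl fun j _ => Finset.sum_congr rfl fun k _ =>
        Finset.sum_congr rfl fun l _ => by ring
    have h2 : (U *ᵥ x) ⬝ᵥ (Matrix.of W *ᵥ (U *ᵥ x)) = x ⬝ᵥ (diagonal μ *ᵥ x) := by
      rw [← hD]
      simp only [star_eq_conjTranspose, conjTranspose_eq_transpose_of_trivial]
      rw [← vecMul_transpose U x, ← dotProduct_mulVec, vecMul_transpose, mulVec_mulVec,
        mulVec_mulVec]
    rw [h1, h2]
    simp only [dotProduct, mulVec_diagonal]
    exact Finset.sum_congr rfl fun i _ => by ring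
  have hmp : MeasurePreserving (fun x : Fin n → ℝ => U *ᵥ x) (stdPi n) (stdPi n) :=
    ⟨by fun_prop, hmap⟩
  have hexp : ∀ x : Fin n → ℝ, Real.exp (∑ j, ∑ k, W j k * ((U *ᵥ x) j * (U *ᵥ x) k))
      = ∏ i, Real.exp (μ i * x i ^ 2) := fun x => by rw [hq, Real.exp_sum]
  have hmeas : AEStronglyMeasurable
      (fun y : Fin n → ℝ => Real.exp (∑ j, ∑ k, W j k * (y j * y k)))
      ((stdPi n).map (fun x => U *ᵥ x)) := by fun_prop
  constructor
  · rw [← hmap, integrable_map_measure hmeas (by fun_prop)]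
    refine Integrable.congr (f := fun x : Fin n → ℝ => ∏ i, Real.exp (μ i * x i ^ 2)) ?_
      (ae_of_all _ fun x => (hexp x).symm)
    exact Integrable.fintype_prod fun i =>
      integrable_exp_mul_sq_stdG (lt_of_le_of_lt (abs_le.1 (hμ i)).2 (by norm_num))
  · rw [← hmap, integral_map (by fun_prop) hmeas]
    simp_rw [hexp]
    rw [integral_fintype_prod_eq_prod (fun i t => Real.exp (μ i * t ^ 2)), htr, hsq,
      Finset.mul_sum, ← Finset.sum_add_distrib, Real.exp_sum]
    exact Finset.prod_le_prod (fun i _ => integral_nonneg fun _ => (Real.exp_pos _).le)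
      fun i _ => integral_exp_mul_sq_stdG_le (hμ i)

lemma exp_le_one_add_add_sq {u : ℝ} (hu : u ≤ 1) : Real.exp u ≤ 1 + u + u ^ 2 := by
  rcases le_or_gt (-1) u with h | h
  · have := (abs_le.1 (Real.abs_exp_sub_one_sub_id_le (abs_le.2 ⟨h, hu⟩))).2
    linarith
  · have := Real.exp_le_one_iff.2 (by linarith : u ≤ 0)
    nlinarith

lemma abs_exp_sub_one_le_of_two_le {N : ℝ} (hN : 2 ≤ N) (x : ℝ) :
    |Real.exp x - 1| ≤ 2 / N * (Real.exp (N * x) + Real.exp (-N * x)) := by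
  have h1 : |Real.exp x - 1| ≤ |x| * Real.exp |x| := by
    rcases le_or_gt 0 x with h | h
    · rw [abs_of_nonneg h, abs_of_nonneg (by linarith [Real.one_le_exp h])]
      have := Real.one_sub_le_exp_neg x
      have h2 : Real.exp (-x) * Real.exp x = 1 := by rw [← Real.exp_add]; simp
      nlinarith [Real.exp_pos x]
    · rw [abs_of_neg h, abs_of_nonpos (by linarith [Real.exp_le_one_iff.2 h.le])]
      have := Real.add_one_le_exp x
      have := Real.one_le_exp (by linarith : 0 ≤ -x)
      nlinarith
  have h2 : |x| ≤ 2 / N * Real.exp ((N - 1) * |x|) := by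
    have := Real.add_one_le_exp ((N - 1) * |x|)
    have h3 : N / 2 * |x| ≤ Real.exp ((N - 1) * |x|) := by nlinarith [abs_nonneg x]
    calc |x| = 2 / N * (N / 2 * |x|) := by field_simp
      _ ≤ _ := by gcongr
  have h3 : Real.exp (N * |x|) ≤ Real.exp (N * x) + Real.exp (-N * x) := by
    rcases abs_cases x with ⟨h, _⟩ | ⟨h, _⟩ <;> rw [h]
    · linarith [Real.exp_pos (-N * x)]
    · have e : N * -x = -N * x := by ring
      rw [e]; linarith [Real.exp_pos (N * x)]
  calc _ ≤ |x| * Real.exp |x| := h1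
    _ ≤ 2 / N * Real.exp ((N - 1) * |x|) * Real.exp |x| := by gcongr
    _ = 2 / N * Real.exp (N * |x|) := by rw [mul_assoc, ← Real.exp_add]; congr 2; ring
    _ ≤ _ := by gcongr

lemma exp_mul_abs_le (u x : ℝ) : Real.exp (u * |x|) ≤ Real.exp (u * x) + Real.exp (-u * x) := by
  rcases abs_cases x with ⟨h, _⟩ | ⟨h, _⟩ <;> rw [h]
  · linarith [Real.exp_pos (-u * x)]
  · rw [mul_neg, ← neg_mul]; linarith [Real.exp_pos (u * x)]

lemma exp_add_four_le (a b c d : ℝ) : Real.exp (a + b + c + d) ≤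
    1 / 4 * (Real.exp (4 * a) + Real.exp (4 * b) + Real.exp (4 * c) + Real.exp (4 * d)) := by
  have h := convexOn_exp.map_sum_le (t := Finset.univ) (w := fun _ : Fin 4 => 1 / 4)
    (p := ![4 * a, 4 * b, 4 * c, 4 * d]) (by simp) (by simp) (by simp)
  simp [Fin.sum_univ_four] at h
  linarith

lemma integrable_exp_sum_and_eq {n : ℕ} (u : ℝ) :
    Integrable (fun y : Fin n → ℝ => Real.exp (u * ∑ j, y j)) (stdPi n) ∧
    ∫ y, Real.exp (u * ∑ j, y j) ∂(stdPi n) = Real.exp (n * (u ^ 2 / 2)) := by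
  have e : ∀ y : Fin n → ℝ, Real.exp (u * ∑ j, y j) = ∏ j, Real.exp (u * y j) := fun y => by
    rw [Finset.mul_sum, Real.exp_sum]
  simp_rw [e]
  refine ⟨Integrable.fintype_prod fun _ => integrable_exp_mul_gaussianReal u, ?_⟩
  rw [integral_fintype_prod_eq_prod (fun _ t => Real.exp (u * t))]
  have : ∫ t, Real.exp (u * t) ∂stdG = Real.exp (u ^ 2 / 2) := by
    have := congrFun (mgf_id_gaussianReal (μ := 0) (v := 1)) u
    simpa [mgf] using this
  simp [this, ← Real.exp_nat_mul]

lemma integrable_exp_sum_sq_sub_and_le {n : ℕ} (u : ℝ) (hu : 16 * (n * u ^ 2) ≤ 1) :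
    Integrable (fun y : Fin n → ℝ => Real.exp (u * (∑ j, y j ^ 2 - n))) (stdPi n) ∧
    ∫ y, Real.exp (u * (∑ j, y j ^ 2 - n)) ∂(stdPi n) ≤ Real.exp (2 * (n * u ^ 2)) := by
  have h := integrable_exp_quadratic_and_le (n := n) (fun j k => if j = k then u else 0)
    (fun j k => by simp [eq_comm]) (by simpa using hu)
  have e : ∀ y : Fin n → ℝ, Real.exp (u * (∑ j, y j ^ 2 - n)) =
      Real.exp (-(u * n)) *
      Real.exp (∑ j, ∑ k, (if j = k then u else 0) * (y j * y k)) := fun y => by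
    rw [← Real.exp_add]
    congr 1
    simp only [ite_mul, zero_mul, Finset.sum_ite_eq, Finset.mem_univ, if_true, ← sq,
      ← Finset.mul_sum]
    ring
  simp_rw [e]
  refine ⟨h.1.const_mul _, ?_⟩
  rw [integral_const_mul]
  calc _ ≤ Real.exp (-(u * n)) * Real.exp _ := by gcongr; exact h.2
    _ = _ := by rw [← Real.exp_add]; congr 1; simp; ring

open Polynomial in
lemma integrable_quartic_majorant_and_le {n : ℕ} (t : ℝ) :
    Integrable (fun y : Fin n → ℝ => ∏ j, (1 + t * (y j ^ 4 - 3) + (t * (y j ^ 4 - 3)) ^ 2))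
      (stdPi n) ∧
    ∫ y, ∏ j, (1 + t * (y j ^ 4 - 3) + (t * (y j ^ 4 - 3)) ^ 2) ∂(stdPi n)
      ≤ Real.exp (96 * (n * t ^ 2)) := by
  set p : ℝ[X] := 1 + C t * (X ^ 4 - C 3) + (C t * (X ^ 4 - C 3)) ^ 2 with hp
  have e : ∀ s : ℝ, 1 + t * (s ^ 4 - 3) + (t * (s ^ 4 - 3)) ^ 2 = p.eval s := fun s => by
    simp [hp]
  have h1 : ∫ s, p.eval s ∂stdG = 1 + 96 * t ^ 2 := by
    have e' : ∀ s : ℝ, p.eval s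
        = t ^ 2 * s ^ 8 + (t - 6 * t ^ 2) * s ^ 4 + (1 - 3 * t + 9 * t ^ 2) := fun s => by
      rw [← e]; ring
    have i8 := (integrable_pow_stdG 8).const_mul (t ^ 2)
    have i4 := (integrable_pow_stdG 4).const_mul (t - 6 * t ^ 2)
    have i84 : Integrable (fun s : ℝ => t ^ 2 * s ^ 8 + (t - 6 * t ^ 2) * s ^ 4) stdG := i8.add i4
    simp_rw [e']
    rw [integral_add i84 (integrable_const _), integral_add i8 i4, integral_const_mul,
      integral_const_mul, integral_pow_eight_stdG, integral_pow_four_stdG]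
    simp; ring
  simp_rw [e]
  refine ⟨integrable_prod_eval fun _ => p, ?_⟩
  rw [integral_prod_eval fun _ => p, h1, Finset.prod_const, Finset.card_univ, Fintype.card_fin]
  calc (1 + 96 * t ^ 2) ^ n ≤ Real.exp (96 * t ^ 2) ^ n := by
        gcongr; linarith [Real.add_one_le_exp (96 * t ^ 2)]
    _ = _ := by rw [← Real.exp_nat_mul]; congr 1; ring

set_option maxHeartbeats 1000000 in
lemma exists_exp_majorant_on_box {n : ℕ} (W : Fin n → Fin n → ℝ) (hs : ∀ j k, W j k = W k j)
    (htr : ∑ j, W j j = -1) (L ω N : ℝ) (hL : 2 ≤ L) (hn : 0 < n)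
    (hW : 64 * N ^ 2 * ∑ j, ∑ k, W j k ^ 2 ≤ 1) (hω : (100 * N * ω * L ^ 8) ^ 2 ≤ n) :
    ∃ G : (Fin n → ℝ) → ℝ, Integrable G (stdPi n) ∧ ∫ y, G y ∂(stdPi n) ≤ 5 ∧ (∀ y, 0 ≤ G y) ∧
      ∀ y : Fin n → ℝ, (∀ j, |y j| ≤ L ^ 2) →
        Real.exp (N * ((-(1 / 2) * ∑ j, ∑ k, W j k * (y j * y k) - 1 / 2)
          + ω * ((∑ j, y j ^ 4) / n + 4 * (∑ j, y j) * (∑ j, y j ^ 3) / n ^ 2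
            + 3 * (∑ j, y j ^ 2) ^ 2 / n ^ 2 - 6))) ≤ G y := by
  have hn' : (0 : ℝ) < n := by exact_mod_cast hn
  have hn1 : (1 : ℝ) ≤ n := by exact_mod_cast hn
  have hL1 : (1 : ℝ) ≤ L := by linarith
  set t := 4 * N * ω / n with ht
  set u := 16 * |N * ω| * L ^ 6 / n with hu
  set v := 24 * |N * ω| * L ^ 4 / n with hv
  have hu0 : 0 ≤ u := by positivity
  have hv0 : 0 ≤ v := by positivity
  have hNω : (N * ω) ^ 2 * (10000 * L ^ 16) ≤ n := by nlinarith
  have hp : ∀ k : ℕ, k ≤ 16 → (N * ω) ^ 2 * (10000 * L ^ k) ≤ n := fun k hk => by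
    refine le_trans ?_ hNω
    gcongr
  have hnt : 96 * (n * t ^ 2) ≤ 1 := by
    have : 96 * (n * t ^ 2) = 1536 * (N * ω) ^ 2 / n := by rw [ht]; field_simp; ring
    rw [this, div_le_one hn']
    have := hp 0 (by norm_num)
    nlinarith [sq_nonneg (N * ω)]
  have hnu : n * (u ^ 2 / 2) ≤ 1 := by
    have : n * (u ^ 2 / 2) = 128 * (N * ω) ^ 2 * L ^ 12 / n := by
      rw [hu, div_pow, mul_pow, mul_pow, sq_abs]; field_simp; ring
    rw [this, div_le_one hn']
    have := hp 12 (by norm_num)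
    have : 0 ≤ (N * ω) ^ 2 * L ^ 12 := by positivity
    nlinarith
  have hnv : 16 * (n * v ^ 2) ≤ 1 := by
    have : 16 * (n * v ^ 2) = 9216 * (N * ω) ^ 2 * L ^ 8 / n := by
      rw [hv, div_pow, mul_pow, mul_pow, sq_abs]; field_simp; ring
    rw [this, div_le_one hn']
    have := hp 8 (by norm_num)
    have : 0 ≤ (N * ω) ^ 2 * L ^ 8 := by positivity
    nlinarith
  have htL : |t| * L ^ 8 ≤ 1 := by
    apply le_of_sq_le_sq _ (by norm_num)
    have : (|t| * L ^ 8) ^ 2 = 16 * (N * ω) ^ 2 * L ^ 16 / n ^ 2 := by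
      rw [mul_pow, sq_abs, ht]; field_simp; ring
    rw [this, div_le_iff₀ (by positivity)]
    have : 0 ≤ (N * ω) ^ 2 * L ^ 16 := by positivity
    nlinarith
  set Q : (Fin n → ℝ) → ℝ := fun y => Real.exp (-(2 * N)) *
    Real.exp (∑ j, ∑ k, (-2 * N * W j k) * (y j * y k)) with hQ
  set Q4 : (Fin n → ℝ) → ℝ :=
    fun y => ∏ j, (1 + t * (y j ^ 4 - 3) + (t * (y j ^ 4 - 3)) ^ 2) with hQ4
  set Q1 : (Fin n → ℝ) → ℝ :=
    fun y => Real.exp (u * ∑ j, y j) + Real.exp (-u * ∑ j, y j) with hQ1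
  set Q2 : (Fin n → ℝ) → ℝ := fun y => Real.exp (v * (∑ j, y j ^ 2 - n))
    + Real.exp (-v * (∑ j, y j ^ 2 - n)) with hQ2
  have hWs : 16 * ∑ j, ∑ k, (-2 * N * W j k) ^ 2 = 64 * N ^ 2 * ∑ j, ∑ k, W j k ^ 2 := by
    simp only [Finset.mul_sum]
    exact Finset.sum_congr rfl fun j _ => Finset.sum_congr rfl fun k _ => by ring
  obtain ⟨iq, bq⟩ := integrable_exp_quadratic_and_le (fun j k => -2 * N * W j k)
    (fun j k => by rw [hs]) (by rw [hWs]; exact hW)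
  have iQ : Integrable Q (stdPi n) := iq.const_mul _
  have bQ : ∫ y, Q y ∂(stdPi n) ≤ Real.exp (1 / 8) := by
    rw [hQ, integral_const_mul]
    calc _ ≤ Real.exp (-(2 * N)) * Real.exp _ := by gcongr
      _ ≤ _ := by
        rw [← Real.exp_add, Real.exp_le_exp, ← Finset.mul_sum, htr]
        linarith
  obtain ⟨i4, b4⟩ := integrable_quartic_majorant_and_le (n := n) t
  obtain ⟨i1, b1⟩ := integrable_exp_sum_and_eq (n := n) u
  obtain ⟨i1', b1'⟩ := integrable_exp_sum_and_eq (n := n) (-u)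
  obtain ⟨i2, b2⟩ := integrable_exp_sum_sq_sub_and_le (n := n) v hnv
  obtain ⟨i2', b2'⟩ := integrable_exp_sum_sq_sub_and_le (n := n) (-v) (by rw [neg_sq]; exact hnv)
  have iQ1 : Integrable Q1 (stdPi n) := i1.add i1'
  have iQ2 : Integrable Q2 (stdPi n) := i2.add i2'
  have iA : Integrable (fun y => Q y + Q4 y) (stdPi n) := iQ.add i4
  have iB : Integrable (fun y => Q y + Q4 y + Q1 y) (stdPi n) := iA.add iQ1
  have iC : Integrable (fun y => Q y + Q4 y + Q1 y + Q2 y) (stdPi n) := iB.add iQ2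
  have pos4 : ∀ y, 0 ≤ Q4 y := fun y => Finset.prod_nonneg fun j _ => by
    nlinarith [sq_nonneg (t * (y j ^ 4 - 3) + 1 / 2)]
  refine ⟨fun y => 1 / 4 * (Q y + Q4 y + Q1 y + Q2 y), iC.const_mul _, ?_, ?_, ?_⟩
  · rw [integral_const_mul, integral_add iB iQ2, integral_add iA iQ1, integral_add iQ i4,
      integral_add i1 i1', integral_add i2 i2', b1, b1']
    have e1 := Real.exp_one_lt_d9
    have l : ∀ x : ℝ, x ≤ 1 → Real.exp x ≤ 2.7182818286 := fun x hx =>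
      (Real.exp_le_exp.2 hx).trans e1.le
    have := l _ hnu
    have := l _ hnt
    have := l (1 / 8) (by norm_num)
    have := l (n * ((-u) ^ 2 / 2)) (by rw [neg_sq]; exact hnu)
    have := l (2 * (n * v ^ 2)) (by linarith)
    have := l (2 * (n * (-v) ^ 2)) (by rw [neg_sq]; linarith)
    linarith
  · intro y
    have := pos4 y
    positivity
  · intro y hy
    have hS3 : |∑ j, y j ^ 3| ≤ n * L ^ 6 := by
      refine (Finset.abs_sum_le_sum_abs _ _).trans ?_
      calc _ ≤ ∑ _j : Fin n, (L ^ 2) ^ 3 := Finset.sum_le_sum fun j _ => by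
            rw [abs_pow]; gcongr; exact hy j
        _ = _ := by rw [Finset.sum_const, Finset.card_univ, Fintype.card_fin, nsmul_eq_mul]; ring
    have hS2 : ∑ j, y j ^ 2 ≤ n * L ^ 4 := by
      calc _ ≤ ∑ _j : Fin n, (L ^ 2) ^ 2 := Finset.sum_le_sum fun j _ => by
            rw [← sq_abs]; gcongr; exact hy j
        _ = _ := by rw [Finset.sum_const, Finset.card_univ, Fintype.card_fin, nsmul_eq_mul]; ring
    have hS20 : 0 ≤ ∑ j, y j ^ 2 := Finset.sum_nonneg fun j _ => sq_nonneg _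
    have heq : N * ((-(1 / 2) * ∑ j, ∑ k, W j k * (y j * y k) - 1 / 2)
          + ω * ((∑ j, y j ^ 4) / n + 4 * (∑ j, y j) * (∑ j, y j ^ 3) / n ^ 2
            + 3 * (∑ j, y j ^ 2) ^ 2 / n ^ 2 - 6))
        = N * (-(1 / 2) * ∑ j, ∑ k, W j k * (y j * y k) - 1 / 2)
          + N * ω / n * (∑ j, y j ^ 4 - 3 * n)
          + N * ω * (4 * (∑ j, y j) * (∑ j, y j ^ 3) / n ^ 2)
          + N * ω * (3 * (∑ j, y j ^ 2) ^ 2 / n ^ 2 - 3) := by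
      field_simp; ring
    rw [heq]
    refine (exp_add_four_le _ _ _ _).trans ?_
    have g0 : Real.exp (4 * (N * (-(1 / 2) * ∑ j, ∑ k, W j k * (y j * y k) - 1 / 2))) = Q y := by
      rw [hQ]
      simp only
      rw [← Real.exp_add]
      congr 1
      have : ∑ j, ∑ k, (-2 * N * W j k) * (y j * y k)
          = -2 * N * ∑ j, ∑ k, W j k * (y j * y k) := by
        simp only [Finset.mul_sum, mul_assoc]
      rw [this]; ring
    have g4 : Real.exp (4 * (N * ω / n * (∑ j, y j ^ 4 - 3 * n))) ≤ Q4 y := by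
      have : 4 * (N * ω / n * (∑ j, y j ^ 4 - 3 * n)) = ∑ j, t * (y j ^ 4 - 3) := by
        rw [← Finset.mul_sum, Finset.sum_sub_distrib, ht]; simp; ring
      rw [this, Real.exp_sum]
      refine Finset.prod_le_prod (fun j _ => (Real.exp_pos _).le) fun j _ =>
        exp_le_one_add_add_sq ?_
      refine (le_abs_self _).trans (le_trans ?_ htL)
      rw [abs_mul]
      gcongr
      have h4 : y j ^ 4 ≤ L ^ 8 := by
        calc y j ^ 4 = |y j| ^ 4 := by rw [Even.pow_abs (by decide)]
          _ ≤ (L ^ 2) ^ 4 := by gcongr; exact hy j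
          _ = _ := by ring
      have h40 : 0 ≤ y j ^ 4 := by positivity
      have hL8 : (2 : ℝ) ^ 8 ≤ L ^ 8 := by gcongr
      rw [abs_le]; constructor <;> linarith
    have g1 : Real.exp (4 * (N * ω * (4 * (∑ j, y j) * (∑ j, y j ^ 3) / n ^ 2))) ≤ Q1 y := by
      refine le_trans ?_ (exp_mul_abs_le u (∑ j, y j))
      rw [Real.exp_le_exp]
      refine (le_abs_self _).trans ?_
      calc _ = 16 * |N * ω| * |∑ j, y j| * |∑ j, y j ^ 3| / n ^ 2 := by
            simp only [abs_mul, abs_div, abs_pow, Nat.abs_cast]; norm_num; ring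
        _ ≤ 16 * |N * ω| * |∑ j, y j| * (n * L ^ 6) / n ^ 2 := by gcongr
        _ = _ := by rw [hu]; field_simp
    have g2 : Real.exp (4 * (N * ω * (3 * (∑ j, y j ^ 2) ^ 2 / n ^ 2 - 3))) ≤ Q2 y := by
      refine le_trans ?_ (exp_mul_abs_le v (∑ j, y j ^ 2 - n))
      rw [Real.exp_le_exp]
      refine (le_abs_self _).trans ?_
      have e : 4 * (N * ω * (3 * (∑ j, y j ^ 2) ^ 2 / n ^ 2 - 3))
          = 12 * (N * ω) * (∑ j, y j ^ 2 - n) * (∑ j, y j ^ 2 + n) / n ^ 2 := by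
        field_simp; ring
      rw [e]
      calc _ = 12 * |N * ω| * |∑ j, y j ^ 2 - n| * (∑ j, y j ^ 2 + n) / n ^ 2 := by
            rw [abs_div, abs_mul, abs_mul, abs_mul (12 : ℝ), abs_of_nonneg (by positivity :
              0 ≤ ∑ j, y j ^ 2 + (n : ℝ)), abs_of_nonneg (by positivity : (0 : ℝ) ≤ (n : ℝ) ^ 2)]
            norm_num
        _ ≤ 12 * |N * ω| * |∑ j, y j ^ 2 - n| * (2 * (n * L ^ 4)) / n ^ 2 := by
            gcongr
            have : (1 : ℝ) ≤ L ^ 4 := one_le_pow₀ hL1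
            nlinarith
        _ = _ := by rw [hv]; field_simp; ring
    rw [g0]
    linarith

lemma norm_exp_mul_I_sub_quadratic_le (x : ℝ) :
    ‖Complex.exp (x * Complex.I) - (1 + x * Complex.I - x ^ 2 / 2)‖ ≤ 4 * |x| ^ 3 := by
  rcases le_or_gt |x| 1 with h | h
  · have hx : ‖(x : ℂ) * Complex.I‖ = |x| := by simp
    have := Complex.exp_bound (x := x * Complex.I) (by rw [hx]; exact h) (n := 3) (by norm_num)
    rw [hx] at this
    have e : ∑ m ∈ range 3, ((x : ℂ) * Complex.I) ^ m / m.factorial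
        = 1 + x * Complex.I - x ^ 2 / 2 := by
      simp [Finset.sum_range_succ, mul_pow, Nat.factorial]; ring
    rw [e] at this
    refine this.trans ?_
    norm_num [Nat.factorial]
    nlinarith [pow_nonneg (abs_nonneg x) 3]
  · have h1 : ‖Complex.exp (x * Complex.I)‖ = 1 := Complex.norm_exp_ofReal_mul_I x
    have h2 : ‖(1 + x * Complex.I - x ^ 2 / 2 : ℂ)‖ ≤ 1 + |x| + |x| ^ 2 / 2 := by
      refine (norm_sub_le _ _).trans (add_le_add ((norm_add_le _ _).trans ?_) ?_) <;> simp
    refine (norm_sub_le _ _).trans ?_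
    nlinarith [sq_nonneg (|x| - 1), mul_pos (sub_pos.2 h) (sub_pos.2 h)]

lemma norm_pow_sub_pow_le_of_norm_le_one {z w : ℂ} (hz : ‖z‖ ≤ 1) (hw : ‖w‖ ≤ 1) (n : ℕ) :
    ‖z ^ n - w ^ n‖ ≤ n * ‖z - w‖ := by
  induction n with
  | zero => simp
  | succ n ih =>
    have e : z ^ (n + 1) - w ^ (n + 1) = z ^ n * (z - w) + (z ^ n - w ^ n) * w := by ring
    rw [e]
    refine (norm_add_le _ _).trans ?_
    rw [norm_mul, norm_mul, norm_pow]
    have h1 : ‖z‖ ^ n ≤ 1 := pow_le_one₀ (norm_nonneg _) hz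
    have h2 : ‖z ^ n - w ^ n‖ * ‖w‖ ≤ ‖z ^ n - w ^ n‖ * 1 := by gcongr
    have h3 : ‖z‖ ^ n * ‖z - w‖ ≤ 1 * ‖z - w‖ := by gcongr
    push_cast
    linarith

lemma abs_exp_neg_sub_one_add_le {v : ℝ} (hv : 0 ≤ v) : |Real.exp (-v) - 1 + v| ≤ v ^ 2 := by
  have h1 := Real.one_sub_le_exp_neg v
  rw [abs_of_nonneg (by linarith)]
  rcases le_or_gt v 1 with h | h
  · have := exp_le_one_add_add_sq (u := -v) (by linarith)
    linarith [neg_sq v]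
  · have := Real.exp_le_one_iff.2 (by linarith : -v ≤ 0)
    nlinarith

lemma integral_exp_I_mul_stdG (s : ℝ) :
    ∫ ξ, Complex.exp ((ξ * s : ℝ) * Complex.I) ∂stdG = Real.exp (-s ^ 2 / 2) := by
  have h := charFun_gaussianReal (μ := 0) (v := 1) s
  rw [charFun_apply_real] at h
  rw [Complex.ofReal_exp]
  convert h using 2
  · ext ξ; push_cast; ring_nf
  · push_cast; simp; ring

lemma integral_linear_add_cubic_stdG (ξ κ : ℝ) :
    ∫ y, (ξ * y - κ * (y ^ 3 + 3 * y)) ∂stdG = 0 := by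
  have e : ∀ y : ℝ, ξ * y - κ * (y ^ 3 + 3 * y) = (ξ - 3 * κ) * y ^ 1 - κ * y ^ 3 := fun y => by
    ring
  simp_rw [e]
  rw [integral_sub ((integrable_pow_stdG 1).const_mul _) ((integrable_pow_stdG 3).const_mul _),
    integral_const_mul, integral_const_mul, integral_pow_one_stdG, integral_pow_three_stdG]
  simp

lemma integral_linear_add_cubic_sq_stdG (ξ κ : ℝ) :
    ∫ y, (ξ * y - κ * (y ^ 3 + 3 * y)) ^ 2 ∂stdG = ξ ^ 2 - 12 * ξ * κ + 42 * κ ^ 2 := by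
  have e : ∀ y : ℝ, (ξ * y - κ * (y ^ 3 + 3 * y)) ^ 2
      = (ξ - 3 * κ) ^ 2 * y ^ 2 - 2 * (ξ - 3 * κ) * κ * y ^ 4 + κ ^ 2 * y ^ 6 := fun y => by ring
  have i2 := (integrable_pow_stdG 2).const_mul ((ξ - 3 * κ) ^ 2)
  have i4 := (integrable_pow_stdG 4).const_mul (2 * (ξ - 3 * κ) * κ)
  have i6 := (integrable_pow_stdG 6).const_mul (κ ^ 2)
  have i24 : Integrable (fun y : ℝ =>
    (ξ - 3 * κ) ^ 2 * y ^ 2 - 2 * (ξ - 3 * κ) * κ * y ^ 4) stdG := i2.sub i4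
  simp_rw [e]
  rw [integral_add i24 i6, integral_sub i2 i4, integral_const_mul, integral_const_mul,
    integral_const_mul, integral_pow_two_stdG, integral_pow_four_stdG, integral_pow_six_stdG]
  ring

lemma integrable_linear_add_cubic_pow (ξ κ : ℝ) (k : ℕ) :
    Integrable (fun y => (ξ * y - κ * (y ^ 3 + 3 * y)) ^ k) stdG := by
  have := integrable_eval_stdG ((Polynomial.C ξ * Polynomial.X
    - Polynomial.C κ * (Polynomial.X ^ 3 + 3 * Polynomial.X)) ^ k)
  simpa using this

lemma integral_linear_add_cubic_four_stdG_le (ξ κ : ℝ) :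
    ∫ y, (ξ * y - κ * (y ^ 3 + 3 * y)) ^ 4 ∂stdG
      ≤ 24 * ξ ^ 4 + 8 * (∫ y, (y ^ 3 + 3 * y) ^ 4 ∂stdG) * κ ^ 4 := by
  have i1 : Integrable (fun y : ℝ => 8 * ξ ^ 4 * y ^ 4) stdG := (integrable_pow_stdG 4).const_mul _
  have i2 : Integrable (fun y : ℝ => 8 * κ ^ 4 * (y ^ 3 + 3 * y) ^ 4) stdG := by
    have := (integrable_linear_add_cubic_pow 0 (-1) 4).const_mul (8 * κ ^ 4)
    simpa using this
  calc _ ≤ ∫ y, (8 * ξ ^ 4 * y ^ 4 + 8 * κ ^ 4 * (y ^ 3 + 3 * y) ^ 4) ∂stdG := by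
        refine integral_mono (integrable_linear_add_cubic_pow ξ κ 4) (i1.add i2) fun y => ?_
        have h : ∀ a b : ℝ, (a - b) ^ 4 ≤ 8 * a ^ 4 + 8 * b ^ 4 := fun a b => by
          have h1 : (a - b) ^ 2 ≤ 2 * (a ^ 2 + b ^ 2) := by nlinarith [sq_nonneg (a + b)]
          have h2 : ((a - b) ^ 2) ^ 2 ≤ (2 * (a ^ 2 + b ^ 2)) ^ 2 := by gcongr
          nlinarith [sq_nonneg (a ^ 2 - b ^ 2)]
        refine (h _ _).trans (le_of_eq ?_)
        ring
    _ = _ := by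
        rw [integral_add i1 i2, integral_const_mul, integral_const_mul, integral_pow_four_stdG]
        ring

lemma norm_integral_exp_cubic_sub_le (ξ κ M : ℝ) (hM : 1 ≤ M) :
    ‖(∫ y, Complex.exp (((ξ * y - κ * (y ^ 3 + 3 * y)) / M : ℝ) * Complex.I) ∂stdG)
      - Real.exp (-(ξ ^ 2 - 12 * ξ * κ + 42 * κ ^ 2) / (2 * M ^ 2))‖
      ≤ (4 + 100 * ξ ^ 4 + 32 * (∫ y, (y ^ 3 + 3 * y) ^ 4 ∂stdG) * κ ^ 4 + 12168 * κ ^ 4)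
        / M ^ 3 := by
  have hM0 : 0 < M := by linarith
  set Y : ℝ → ℝ := fun y => ξ * y - κ * (y ^ 3 + 3 * y) with hY
  set v := ξ ^ 2 - 12 * ξ * κ + 42 * κ ^ 2 with hv
  have hv0 : 0 ≤ v := by rw [hv]; nlinarith [sq_nonneg (ξ - 6 * κ), sq_nonneg κ]
  have hv2 : v ^ 2 ≤ 8 * ξ ^ 4 + 12168 * κ ^ 4 := by
    have : v ≤ 2 * ξ ^ 2 + 78 * κ ^ 2 := by rw [hv]; nlinarith [sq_nonneg (ξ + 6 * κ)]
    have : v ^ 2 ≤ (2 * ξ ^ 2 + 78 * κ ^ 2) ^ 2 := by gcongr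
    nlinarith [sq_nonneg (2 * ξ ^ 2 - 78 * κ ^ 2)]
  have iY : ∀ k, Integrable (fun y => Y y ^ k) stdG := integrable_linear_add_cubic_pow ξ κ
  have iY1 : Integrable Y stdG := by simpa using iY 1
  have iE : Integrable (fun y => Complex.exp ((Y y / M : ℝ) * Complex.I)) stdG := by
    refine Integrable.of_bound (C := 1) (by fun_prop) (ae_of_all _ fun y => ?_)
    rw [Complex.norm_exp_ofReal_mul_I]
  have hq : ∫ y, (1 + ((Y y / M : ℝ) : ℂ) * Complex.I - ((Y y / M : ℝ) : ℂ) ^ 2 / 2) ∂stdG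
      = ((1 - v / (2 * M ^ 2) : ℝ) : ℂ) := by
    have j1 : Integrable (fun y => ((Y y / M : ℝ) : ℂ) * Complex.I) stdG :=
      ((iY1.div_const M).ofReal).mul_const _
    have j2 : Integrable (fun y => ((Y y / M : ℝ) : ℂ) ^ 2 / 2) stdG := by
      have := (((iY 2).div_const (M ^ 2)).ofReal (𝕜 := ℂ)).div_const 2
      refine this.congr (ae_of_all _ fun y => ?_)
      simp [div_pow]
    have j0 : Integrable (fun y => 1 + ((Y y / M : ℝ) : ℂ) * Complex.I) stdG :=
      (integrable_const _).add j1
    rw [integral_sub j0 j2, integral_add (integrable_const _) j1, integral_mul_const,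
      integral_complex_ofReal, integral_div, hY, integral_linear_add_cubic_stdG, integral_div]
    have : ∀ y, ((Y y / M : ℝ) : ℂ) ^ 2 = ((Y y ^ 2 / M ^ 2 : ℝ) : ℂ) := fun y => by
      push_cast; rw [div_pow]
    simp only [hY] at this
    simp_rw [this]
    rw [integral_complex_ofReal, integral_div, integral_linear_add_cubic_sq_stdG]
    rw [← hv]
    simp
    field_simp
  have h1 : ‖(∫ y, Complex.exp ((Y y / M : ℝ) * Complex.I) ∂stdG) - (1 - v / (2 * M ^ 2) : ℝ)‖
      ≤ (4 + 96 * ξ ^ 4 + 32 * (∫ y, (y ^ 3 + 3 * y) ^ 4 ∂stdG) * κ ^ 4) / M ^ 3 := by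
    have iq : Integrable (fun y => (1 + ((Y y / M : ℝ) : ℂ) * Complex.I
        - ((Y y / M : ℝ) : ℂ) ^ 2 / 2)) stdG := by
      have j1 : Integrable (fun y => ((Y y / M : ℝ) : ℂ) * Complex.I) stdG :=
        ((iY1.div_const M).ofReal).mul_const _
      have j2 : Integrable (fun y => ((Y y / M : ℝ) : ℂ) ^ 2 / 2) stdG := by
        have := (((iY 2).div_const (M ^ 2)).ofReal (𝕜 := ℂ)).div_const 2
        refine this.congr (ae_of_all _ fun y => ?_)
        simp [div_pow]
      exact ((integrable_const _).add j1).sub j2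
    rw [← hq, ← integral_sub iE iq]
    have ib : Integrable (fun y => 4 / M ^ 3 * (1 + Y y ^ 4)) stdG :=
      ((integrable_const _).add (iY 4)).const_mul _
    refine (norm_integral_le_of_norm_le ib (ae_of_all _ fun y => ?_)).trans ?_
    · refine (norm_exp_mul_I_sub_quadratic_le (Y y / M)).trans ?_
      rw [abs_div, abs_of_pos hM0, div_pow]
      have : |Y y| ^ 3 ≤ 1 + Y y ^ 4 := by
        have e4 : Y y ^ 4 = |Y y| ^ 4 := by rw [Even.pow_abs (by decide)]
        rw [e4]
        nlinarith [sq_nonneg (|Y y| ^ 2 - |Y y|), sq_nonneg (|Y y| - 1), sq_nonneg (|Y y| ^ 2 - 1),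
          abs_nonneg (Y y)]
      calc _ ≤ 4 * ((1 + Y y ^ 4) / M ^ 3) := by gcongr
        _ = _ := by ring
    · rw [integral_const_mul, integral_add (integrable_const _) (iY 4)]
      have := integral_linear_add_cubic_four_stdG_le ξ κ
      simp only [integral_const, probReal_univ, one_smul]
      rw [div_mul_eq_mul_div]
      gcongr
      linarith
  have h2 : ‖((1 - v / (2 * M ^ 2) : ℝ) : ℂ) - Real.exp (-v / (2 * M ^ 2))‖
      ≤ (8 * ξ ^ 4 + 12168 * κ ^ 4) / 4 / M ^ 3 := by
    rw [← Complex.ofReal_sub, Complex.norm_real, Real.norm_eq_abs, abs_sub_comm, neg_div]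
    have := abs_exp_neg_sub_one_add_le (v := v / (2 * M ^ 2)) (by positivity)
    have e : Real.exp (-(v / (2 * M ^ 2))) - (1 - v / (2 * M ^ 2))
        = Real.exp (-(v / (2 * M ^ 2))) - 1 + v / (2 * M ^ 2) := by ring
    rw [e]
    refine this.trans ?_
    have e2 : (v / (2 * M ^ 2)) ^ 2 = v ^ 2 / 4 / M ^ 4 := by field_simp; norm_num
    rw [e2]
    have : M ^ 3 ≤ M ^ 4 := pow_le_pow_right₀ hM (by norm_num)
    gcongr
  refine (norm_sub_le_norm_sub_add_norm_sub _ ((1 - v / (2 * M ^ 2) : ℝ) : ℂ) _).trans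
    ((add_le_add h1 h2).trans ?_)
  rw [← add_div]
  have : 0 ≤ κ ^ 4 := by positivity
  have : 0 ≤ ξ ^ 4 := by positivity
  refine div_le_div_of_nonneg_right ?_ (by positivity)
  linarith

lemma integral_exp_neg_variance_stdG (κ : ℝ) :
    ∫ ξ, Real.exp (-(ξ ^ 2 - 12 * ξ * κ + 42 * κ ^ 2) / 2) ∂stdG
      = (√2)⁻¹ * Real.exp (-12 * κ ^ 2) := by
  rw [integral_gaussianReal_eq_integral_smul one_ne_zero]
  have e : ∀ ξ : ℝ, gaussianPDFReal 0 1 ξ • Real.exp (-(ξ ^ 2 - 12 * ξ * κ + 42 * κ ^ 2) / 2)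
      = (√(2 * Real.pi))⁻¹ * Real.exp (-12 * κ ^ 2) * Real.exp (-1 * (ξ - 3 * κ) ^ 2) := fun ξ => by
    simp only [gaussianPDFReal, NNReal.coe_one, mul_one, sub_zero, smul_eq_mul]
    rw [mul_assoc, mul_assoc _ (Real.exp (-12 * κ ^ 2)), ← Real.exp_add, ← Real.exp_add]
    congr 2; ring
  simp_rw [e]
  rw [integral_const_mul, integral_sub_right_eq_self (fun x => Real.exp (-1 * x ^ 2)),
    integral_gaussian, Real.sqrt_mul (by norm_num)]
  have : √Real.pi ≠ 0 := by positivity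
  simp
  field_simp

lemma integral_exp_hubbard_stratonovich {n : ℕ} (κ M : ℝ) (hM : 0 < M) (hn : M ^ 2 = n) :
    ∫ y : Fin n → ℝ, ((Real.exp (-(∑ j, y j) ^ 2 / (2 * n)) : ℝ) : ℂ) *
        Complex.exp (-(κ / M * ∑ j, (y j ^ 3 + 3 * y j) : ℝ) * Complex.I) ∂(stdPi n)
      = ∫ ξ, (∫ y, Complex.exp (((ξ * y - κ * (y ^ 3 + 3 * y)) / M : ℝ) * Complex.I) ∂stdG) ^ n
          ∂stdG := by
  have h1 : ∀ y : Fin n → ℝ, ((Real.exp (-(∑ j, y j) ^ 2 / (2 * n)) : ℝ) : ℂ) *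
        Complex.exp (-(κ / M * ∑ j, (y j ^ 3 + 3 * y j) : ℝ) * Complex.I)
      = ∫ ξ, ∏ j, Complex.exp (((ξ * y j - κ * (y j ^ 3 + 3 * y j)) / M : ℝ) * Complex.I)
          ∂stdG := fun y => by
    have e : -(∑ j, y j) ^ 2 / (2 * n) = -((∑ j, y j) / M) ^ 2 / 2 := by
      rw [← hn]; field_simp
    rw [e, ← integral_exp_I_mul_stdG, ← integral_mul_const]
    congr 1
    ext ξ
    rw [← Complex.exp_add, ← Complex.exp_sum, ← Finset.sum_mul, ← add_mul]
    congr 2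
    norm_cast
    rw [← Finset.sum_div, Finset.sum_sub_distrib, ← Finset.mul_sum, ← Finset.mul_sum]
    ring
  simp_rw [h1]
  rw [integral_integral_swap]
  · congr 1
    ext ξ
    rw [integral_fintype_prod_eq_prod (fun (_ : Fin n) (t : ℝ) =>
      Complex.exp (((ξ * t - κ * (t ^ 3 + 3 * t)) / M : ℝ) * Complex.I))]
    simp
  · refine Integrable.of_bound (C := 1) ?_ (ae_of_all _ fun p => ?_)
    · apply Measurable.aestronglyMeasurable
      simp only [Function.uncurry_def]
      fun_prop
    · simp only [Function.uncurry_def, norm_prod, Complex.norm_exp_ofReal_mul_I]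
      simp

lemma exists_norm_integral_gaussian_cubic_sub_le :
    ∃ C : ℝ, 0 < C ∧ ∀ (n : ℕ) (κ M : ℝ), 1 ≤ M → M ^ 2 = n →
      ‖(∫ y : Fin n → ℝ, ((Real.exp (-(∑ j, y j) ^ 2 / (2 * n)) : ℝ) : ℂ) *
        Complex.exp (-(κ / M * ∑ j, (y j ^ 3 + 3 * y j) : ℝ) * Complex.I) ∂(stdPi n))
        - ((√2)⁻¹ * Real.exp (-12 * κ ^ 2) : ℝ)‖ ≤ C * (1 + κ ^ 4) / M := by
  set B := 32 * (∫ y : ℝ, (y ^ 3 + 3 * y) ^ 4 ∂stdG) + 12168 with hB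
  have hB0 : 0 < B := by
    have : 0 ≤ ∫ y : ℝ, (y ^ 3 + 3 * y) ^ 4 ∂stdG := integral_nonneg fun y => by positivity
    linarith
  refine ⟨304 + B, by linarith, fun n κ M hM hn => ?_⟩
  have hM0 : 0 < M := by linarith
  set φ : ℝ → ℂ := fun ξ =>
    ∫ y, Complex.exp (((ξ * y - κ * (y ^ 3 + 3 * y)) / M : ℝ) * Complex.I) ∂stdG with hφ
  have hφ1 : ∀ ξ, ‖φ ξ‖ ≤ 1 := fun ξ => by
    refine (norm_integral_le_integral_norm _).trans ?_
    simp only [Complex.norm_exp_ofReal_mul_I]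
    simp
  have hφm : AEStronglyMeasurable φ stdG := by
    apply StronglyMeasurable.aestronglyMeasurable
    refine StronglyMeasurable.integral_prod_right' (f := fun p : ℝ × ℝ =>
      Complex.exp (((p.1 * p.2 - κ * (p.2 ^ 3 + 3 * p.2)) / M : ℝ) * Complex.I)) ?_
    apply Measurable.stronglyMeasurable
    fun_prop
  set v : ℝ → ℝ := fun ξ => ξ ^ 2 - 12 * ξ * κ + 42 * κ ^ 2 with hv
  have hv0 : ∀ ξ, 0 ≤ v ξ := fun ξ => by
    simp only [hv]; nlinarith [sq_nonneg (ξ - 6 * κ), sq_nonneg κ]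
  rw [integral_exp_hubbard_stratonovich κ M hM0 hn, ← integral_exp_neg_variance_stdG,
    ← integral_complex_ofReal]
  have i1 : Integrable (fun ξ => φ ξ ^ n) stdG := by
    refine Integrable.of_bound (C := 1) (hφm.pow n) (ae_of_all _ fun ξ => ?_)
    rw [norm_pow]
    exact pow_le_one₀ (norm_nonneg _) (hφ1 ξ)
  have i2 : Integrable (fun ξ => ((Real.exp (-v ξ / 2) : ℝ) : ℂ)) stdG := by
    refine Integrable.of_bound (C := 1) (by fun_prop) (ae_of_all _ fun ξ => ?_)
    rw [Complex.norm_real, Real.norm_eq_abs, Real.abs_exp, Real.exp_le_one_iff]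
    linarith [hv0 ξ]
  rw [← integral_sub i1 i2]
  have ib : Integrable (fun ξ : ℝ => (4 + 100 * ξ ^ 4 + B * κ ^ 4) / M) stdG :=
    (((integrable_const _).add ((integrable_pow_stdG 4).const_mul _)).add
      (integrable_const _)).div_const _
  refine (norm_integral_le_of_norm_le ib (ae_of_all _ fun ξ => ?_)).trans ?_
  · have e : ((Real.exp (-v ξ / 2) : ℝ) : ℂ) = ((Real.exp (-v ξ / (2 * M ^ 2)) : ℝ) : ℂ) ^ n := by
      rw [← Complex.ofReal_pow, ← Real.exp_nat_mul, ← hn]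
      congr 2; field_simp
    rw [e]
    refine (norm_pow_sub_pow_le_of_norm_le_one (hφ1 ξ) ?_ n).trans ?_
    · rw [Complex.norm_real, Real.norm_eq_abs, Real.abs_exp, Real.exp_le_one_iff, neg_div]
      have := hv0 ξ
      have : 0 ≤ v ξ / (2 * M ^ 2) := by positivity
      linarith
    · have := norm_integral_exp_cubic_sub_le ξ κ M hM
      calc _ ≤ (n : ℝ) * ((4 + 100 * ξ ^ 4 + 32 * (∫ y, (y ^ 3 + 3 * y) ^ 4 ∂stdG) * κ ^ 4
            + 12168 * κ ^ 4) / M ^ 3) := by gcongr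
        _ = _ := by rw [← hn, hB]; field_simp; ring
  · have ia : Integrable (fun ξ : ℝ => 4 + 100 * ξ ^ 4) stdG :=
      (integrable_const _).add ((integrable_pow_stdG 4).const_mul _)
    rw [integral_div, integral_add ia (integrable_const _),
      integral_add (integrable_const _) ((integrable_pow_stdG 4).const_mul _), integral_const_mul,
      integral_pow_four_stdG]
    simp only [integral_const, probReal_univ, one_smul]
    gcongr
    have : 0 ≤ κ ^ 4 := by positivity
    nlinarith

lemma norm_exp_add_mul_sub_le {x f f' η : ℝ} {h : ℂ} (hη : ‖h‖ ≤ η) (hη1 : η ≤ 1) :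
    ‖Complex.exp (x - f * Complex.I + h) - Complex.exp (-f' * Complex.I)‖
      ≤ 3 * |Real.exp x - 1| + 2 * η + |f - f'| := by
  have e1 : Complex.exp (x - f * Complex.I + h) - Complex.exp (-f' * Complex.I)
      = Complex.exp (-f * Complex.I) * (Complex.exp x * (Complex.exp h - 1)
        + (Complex.exp x - 1))
        + Complex.exp (-f' * Complex.I) * (Complex.exp (Complex.I * (f' - f : ℝ)) - 1) := by
    have a1 : Complex.exp (x - f * Complex.I + h)
        = Complex.exp (-f * Complex.I) * (Complex.exp x * Complex.exp h) := by
      rw [← Complex.exp_add, ← Complex.exp_add]; congr 1; ring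
    have a2 : Complex.exp (-f * Complex.I)
        = Complex.exp (-f' * Complex.I) * Complex.exp (Complex.I * (f' - f : ℝ)) := by
      rw [← Complex.exp_add]; congr 1; push_cast; ring
    rw [a1, mul_sub, mul_one, mul_add, mul_sub, mul_sub, mul_sub, mul_one, mul_one, ← a2]
    ring
  have u : ∀ t : ℝ, ‖Complex.exp (-t * Complex.I)‖ = 1 := fun t => by
    rw [← Complex.ofReal_neg]; exact Complex.norm_exp_ofReal_mul_I _
  have hh : ‖Complex.exp h - 1‖ ≤ 2 * η :=
    (Complex.norm_exp_sub_one_le (hη.trans hη1)).trans (by gcongr)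
  have hη0 : 0 ≤ η := (norm_nonneg _).trans hη
  have hx : ‖Complex.exp x - 1‖ = |Real.exp x - 1| := by
    rw [← Complex.ofReal_exp, ← Complex.ofReal_one, ← Complex.ofReal_sub, Complex.norm_real,
      Real.norm_eq_abs]
  have hx2 : ‖Complex.exp x‖ ≤ 1 + |Real.exp x - 1| := by
    rw [Complex.norm_exp_ofReal]
    linarith [le_abs_self (Real.exp x - 1)]
  have hf : ‖Complex.exp (Complex.I * (f' - f : ℝ)) - 1‖ ≤ |f - f'| := by
    rw [abs_sub_comm]
    exact Real.norm_exp_I_mul_ofReal_sub_one_le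
  rw [e1]
  refine (norm_add_le _ _).trans ?_
  rw [norm_mul, norm_mul, u, u, one_mul, one_mul]
  refine add_le_add ((norm_add_le _ _).trans ?_) hf
  rw [norm_mul, hx]
  have := mul_le_mul hx2 hh (norm_nonneg _) (by positivity)
  nlinarith [abs_nonneg (Real.exp x - 1)]

lemma indicator_compl_box_le {n : ℕ} {ℓ : Fin n → ℝ} {L : ℝ} (hL : 0 ≤ L) (hℓ : ∀ j, L ≤ ℓ j)
    (y : Fin n → ℝ) (hy : ¬ ∀ j, |y j| ≤ ℓ j) :
    1 ≤ ∑ j, Real.exp (-L ^ 2 / 4) * Real.exp (1 / 4 * y j ^ 2) := by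
  push Not at hy
  obtain ⟨j, hj⟩ := hy
  have h1 : L ^ 2 ≤ y j ^ 2 := by
    rw [← sq_abs (y j)]
    have := hℓ j
    gcongr
    linarith
  refine le_trans ?_ (Finset.single_le_sum
    (f := fun j => Real.exp (-L ^ 2 / 4) * Real.exp (1 / 4 * y j ^ 2))
    (fun i _ => by positivity) (Finset.mem_univ j))
  rw [← Real.exp_add]
  exact Real.one_le_exp (by linarith)

lemma exists_norm_setIntegral_exp_sub_le :
    ∃ C : ℝ, 0 < C ∧ ∀ (n : ℕ) (W : Fin n → Fin n → ℝ) (ℓ : Fin n → ℝ) (L M N ω κ η η₃ : ℝ)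
      (f₃ : (Fin n → ℝ) → ℝ) (Φ h : (Fin n → ℝ) → ℂ),
      (∀ j k, W j k = W k j) → (∑ j, W j j = -1) → 2 ≤ L → 1 ≤ M → M ^ 2 = n → 2 ≤ N →
      64 * N ^ 2 * ∑ j, ∑ k, W j k ^ 2 ≤ 1 → (100 * N * ω * L ^ 8) ^ 2 ≤ n →
      (∀ j, L ≤ ℓ j) → (∀ j, ℓ j ≤ L ^ 2) →
      Integrable (fun y => |f₃ y - κ / M * ∑ j, (y j ^ 3 + 3 * y j)|) (stdPi n) →
      ∫ y, |f₃ y - κ / M * ∑ j, (y j ^ 3 + 3 * y j)| ∂(stdPi n) ≤ η₃ →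
      η ≤ 1 → Measurable Φ →
      (∀ y, (∀ j, |y j| ≤ ℓ j) → ‖h y‖ ≤ η ∧ Φ y = Complex.exp (
        ((-(1 / 2) * ∑ j, ∑ k, W j k * (y j * y k) - (∑ j, y j) ^ 2 / (2 * n)
          + ω * ((∑ j, y j ^ 4) / n + 4 * (∑ j, y j) * (∑ j, y j ^ 3) / n ^ 2
            + 3 * (∑ j, y j ^ 2) ^ 2 / n ^ 2) : ℝ) : ℂ) - f₃ y * Complex.I + h y)) →
      ‖(∫ y in {y | ∀ j, |y j| ≤ ℓ j}, Φ y ∂(stdPi n))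
        - (Real.exp (1 / 2 + 6 * ω) * ((√2)⁻¹ * Real.exp (-12 * κ ^ 2)) : ℝ)‖
      ≤ Real.exp (1 / 2 + 6 * ω) * (C * (1 + κ ^ 4) / M + 60 / N + 2 * η + η₃
        + 2 * n * Real.exp (-L ^ 2 / 4)) := by
  obtain ⟨C, hC, hG4⟩ := exists_norm_integral_gaussian_cubic_sub_le
  refine ⟨C, hC, ?_⟩
  intro n W ℓ L M N ω κ η η₃ f₃ Φ h hs htr hL hM hMn hN hW hω hℓ hℓ2 if3 hf3 hη hΦm hΦ
  have hn : 0 < n := by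
    rcases Nat.eq_zero_or_pos n with h0 | h0
    · rw [h0] at hMn; norm_num at hMn; linarith
    · exact h0
  set K : Set (Fin n → ℝ) := {y | ∀ j, |y j| ≤ ℓ j} with hK
  have hKm : MeasurableSet K := by
    have : K = ⋂ j, {y | |y j| ≤ ℓ j} := by ext; simp [hK]
    rw [this]
    exact MeasurableSet.iInter fun j => measurableSet_le (by fun_prop) measurable_const
  obtain ⟨G, iG, hG5, hG0, hG⟩ := exists_exp_majorant_on_box W hs htr L ω N hL hn hW hω
  obtain ⟨G', iG', hG5', hG0', hG'⟩ := exists_exp_majorant_on_box W hs htr L ω (-N) hL hn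
    (by simpa using hW) (by simpa using hω)
  set g : (Fin n → ℝ) → ℂ := fun y => ((Real.exp (-(∑ j, y j) ^ 2 / (2 * n)) : ℝ) : ℂ) *
        Complex.exp (-(κ / M * ∑ j, (y j ^ 3 + 3 * y j) : ℝ) * Complex.I) with hg
  set E := Real.exp (1 / 2 + 6 * ω) with hE
  have hE0 : 0 < E := Real.exp_pos _
  have hg1 : ∀ y, ‖g y‖ ≤ 1 := fun y => by
    rw [hg]
    simp only
    rw [norm_mul, ← Complex.ofReal_neg, Complex.norm_exp_ofReal_mul_I, mul_one, Complex.norm_real,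
      Real.norm_eq_abs, abs_of_pos (Real.exp_pos _), Real.exp_le_one_iff, neg_div]
    exact neg_nonpos.2 (by positivity)
  have ig : Integrable g (stdPi n) := by
    refine Integrable.of_bound (C := 1) ?_ (ae_of_all _ hg1)
    apply Measurable.aestronglyMeasurable
    fun_prop
  set B : (Fin n → ℝ) → ℝ := fun y => (6 / N * (G y + G' y) + 2 * η
      + |f₃ y - κ / M * ∑ j, (y j ^ 3 + 3 * y j)|)
      + ∑ j, Real.exp (-L ^ 2 / 4) * Real.exp (1 / 4 * y j ^ 2) with hB
  have hη0 : 0 ≤ η := (norm_nonneg _).trans (hΦ 0 (fun j => by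
    simpa using (by linarith [hℓ j] : 0 ≤ ℓ j))).1
  have hpt : ∀ y, ‖K.indicator Φ y - E * g y‖ ≤ E * B y := fun y => by
    by_cases hy : y ∈ K
    · obtain ⟨hh, hΦy⟩ := hΦ y hy
      rw [Set.indicator_of_mem hy, hΦy]
      set x := (-(1 / 2) * ∑ j, ∑ k, W j k * (y j * y k) - 1 / 2)
        + ω * ((∑ j, y j ^ 4) / n + 4 * (∑ j, y j) * (∑ j, y j ^ 3) / n ^ 2
            + 3 * (∑ j, y j ^ 2) ^ 2 / n ^ 2 - 6) with hx
      have e1 : Complex.exp (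
        ((-(1 / 2) * ∑ j, ∑ k, W j k * (y j * y k) - (∑ j, y j) ^ 2 / (2 * n)
          + ω * ((∑ j, y j ^ 4) / n + 4 * (∑ j, y j) * (∑ j, y j ^ 3) / n ^ 2
            + 3 * (∑ j, y j ^ 2) ^ 2 / n ^ 2) : ℝ) : ℂ) - f₃ y * Complex.I + h y)
          = ((E * Real.exp (-(∑ j, y j) ^ 2 / (2 * n)) : ℝ) : ℂ)
            * Complex.exp (x - f₃ y * Complex.I + h y) := by
        rw [hE, ← Real.exp_add, Complex.ofReal_exp, ← Complex.exp_add]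
        congr 1
        rw [hx]
        push_cast
        ring
      have e2 : (E : ℂ) * g y = ((E * Real.exp (-(∑ j, y j) ^ 2 / (2 * n)) : ℝ) : ℂ)
            * Complex.exp (-(κ / M * ∑ j, (y j ^ 3 + 3 * y j) : ℝ) * Complex.I) := by
        rw [hg, Complex.ofReal_mul]; ring
      rw [e1, e2, ← mul_sub, norm_mul, Complex.norm_real, Real.norm_eq_abs,
        abs_of_pos (by positivity), mul_assoc]
      refine mul_le_mul_of_nonneg_left ?_ hE0.le
      have hle : Real.exp (-(∑ j, y j) ^ 2 / (2 * n)) ≤ 1 := by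
        rw [Real.exp_le_one_iff, neg_div]
        exact neg_nonpos.2 (by positivity)
      refine (mul_le_of_le_one_left (norm_nonneg _) hle).trans ?_
      refine (norm_exp_add_mul_sub_le hh hη).trans ?_
      have hyL : ∀ j, |y j| ≤ L ^ 2 := fun j => (hy j).trans (hℓ2 j)
      have h1 := hG y hyL
      have h2 := hG' y hyL
      rw [← hx] at h1 h2
      have h3 := abs_exp_sub_one_le_of_two_le hN x
      have h4 : 2 / N * (Real.exp (N * x) + Real.exp (-N * x)) ≤ 2 / N * (G y + G' y) := by gcongr
      have h5 : 0 ≤ ∑ j, Real.exp (-L ^ 2 / 4) * Real.exp (1 / 4 * y j ^ 2) :=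
        Finset.sum_nonneg fun j _ => by positivity
      have h6 : 6 / N * (G y + G' y) = 3 * (2 / N * (G y + G' y)) := by ring
      rw [hB]
      simp only
      rw [h6]
      linarith
    · rw [Set.indicator_of_notMem hy, zero_sub, norm_neg, norm_mul, Complex.norm_real,
        Real.norm_eq_abs, abs_of_pos hE0]
      refine mul_le_mul_of_nonneg_left ((hg1 y).trans ?_) hE0.le
      have := indicator_compl_box_le (by linarith) hℓ y hy
      have h1 : 0 ≤ 6 / N * (G y + G' y) := by have := hG0 y; have := hG0' y; positivity
      rw [hB]
      simp only
      linarith [abs_nonneg (f₃ y - κ / M * ∑ j, (y j ^ 3 + 3 * y j))]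
  have iexp : ∀ j : Fin n, Integrable (fun y : Fin n → ℝ =>
      Real.exp (-L ^ 2 / 4) * Real.exp (1 / 4 * y j ^ 2)) (stdPi n) := fun j =>
    (integrable_comp_eval (i := j) (μ := fun _ => stdG) (f := fun t => Real.exp (1 / 4 * t ^ 2))
      (integrable_exp_mul_sq_stdG (by norm_num))).const_mul _
  have iGG : Integrable (fun y => 6 / N * (G y + G' y)) (stdPi n) := (iG.add iG').const_mul _
  have iGη : Integrable (fun y => 6 / N * (G y + G' y) + 2 * η) (stdPi n) :=
    iGG.add (integrable_const _)
  have i3 : Integrable (fun y => 6 / N * (G y + G' y) + 2 * η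
      + |f₃ y - κ / M * ∑ j, (y j ^ 3 + 3 * y j)|) (stdPi n) := iGη.add if3
  have isum : Integrable (fun y : Fin n → ℝ =>
      ∑ j, Real.exp (-L ^ 2 / 4) * Real.exp (1 / 4 * y j ^ 2)) (stdPi n) :=
    integrable_finsetSum _ fun j _ => iexp j
  have iB : Integrable B (stdPi n) := i3.add isum
  have hexp : ∀ j : Fin n, ∫ y, Real.exp (-L ^ 2 / 4) * Real.exp (1 / 4 * y j ^ 2) ∂(stdPi n)
      ≤ 2 * Real.exp (-L ^ 2 / 4) := fun j => by
    rw [integral_const_mul]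
    have : ∫ y : Fin n → ℝ, Real.exp (1 / 4 * y j ^ 2) ∂(stdPi n)
        = ∫ t, Real.exp (1 / 4 * t ^ 2) ∂stdG :=
      integral_comp_eval (i := j) (μ := fun _ => stdG) (f := fun t => Real.exp (1 / 4 * t ^ 2))
        (by fun_prop)
    rw [this, integral_exp_mul_sq_stdG (by norm_num), mul_comm]
    gcongr
    rw [inv_le_comm₀ (by norm_num) (by norm_num)]
    apply Real.le_sqrt_of_sq_le
    norm_num
  have hIB : ∫ y, B y ∂(stdPi n) ≤ 60 / N + 2 * η + η₃ + 2 * n * Real.exp (-L ^ 2 / 4) := by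
    rw [hB, integral_add i3 isum, integral_add iGη if3, integral_add iGG (integrable_const _),
      integral_const_mul, integral_add iG iG', integral_finsetSum _ fun j _ => iexp j]
    have h1 : ∑ j : Fin n, ∫ y, Real.exp (-L ^ 2 / 4) * Real.exp (1 / 4 * y j ^ 2) ∂(stdPi n)
        ≤ ∑ j : Fin n, 2 * Real.exp (-L ^ 2 / 4) := Finset.sum_le_sum fun j _ => hexp j
    have h2 : 6 / N * (∫ y, G y ∂(stdPi n) + ∫ y, G' y ∂(stdPi n)) ≤ 6 / N * (5 + 5) := by gcongr
    have h3 : 6 / N * (5 + 5) = 60 / N := by ring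
    simp only [integral_const, probReal_univ, one_smul]
    simp only [Finset.sum_const, Finset.card_univ, Fintype.card_fin, nsmul_eq_mul] at h1
    linarith
  have iΦ : Integrable (K.indicator Φ) (stdPi n) := by
    have : Integrable (fun y => K.indicator Φ y - E * g y) (stdPi n) :=
      Integrable.mono' (iB.const_mul E)
        ((hΦm.indicator hKm).aestronglyMeasurable.sub (ig.const_mul _).aestronglyMeasurable)
        (ae_of_all _ hpt)
    have := this.add (ig.const_mul (E : ℂ))
    refine this.congr (ae_of_all _ fun y => ?_)
    simp
  have hmain := hG4 n κ M hM hMn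
  have e : (∫ y in K, Φ y ∂(stdPi n)) - (E * ((√2)⁻¹ * Real.exp (-12 * κ ^ 2)) : ℝ)
      = (∫ y, (K.indicator Φ y - E * g y) ∂(stdPi n))
        + E * ((∫ y, g y ∂(stdPi n)) - ((√2)⁻¹ * Real.exp (-12 * κ ^ 2) : ℝ)) := by
    rw [integral_sub iΦ (ig.const_mul _), integral_indicator hKm, integral_const_mul,
      Complex.ofReal_mul E]
    ring
  rw [e]
  refine (norm_add_le _ _).trans ?_
  have h1 : ‖∫ y, (K.indicator Φ y - E * g y) ∂(stdPi n)‖ ≤ E * ∫ y, B y ∂(stdPi n) := by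
    rw [← integral_const_mul]
    exact norm_integral_le_of_norm_le (iB.const_mul E) (ae_of_all _ hpt)
  have h2 : ‖(E : ℂ) * ((∫ y, g y ∂(stdPi n)) - ((√2)⁻¹ * Real.exp (-12 * κ ^ 2) : ℝ))‖
      ≤ E * (C * (1 + κ ^ 4) / M) := by
    rw [norm_mul, Complex.norm_real, Real.norm_eq_abs, abs_of_pos hE0]
    exact mul_le_mul_of_nonneg_left hmain hE0.le
  have h3 := mul_le_mul_of_nonneg_left hIB hE0.le
  calc _ ≤ E * (60 / N + 2 * η + η₃ + 2 * n * Real.exp (-L ^ 2 / 4))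
        + E * (C * (1 + κ ^ 4) / M) := add_le_add (h1.trans h3) h2
    _ = _ := by ring

/-- The data of the saddle point: `m` is the indicator of the allowed pairs, `x` counts the
forbidden neighbours, `d` is the degree sequence, and `L`, `M` are the two scales, with
`M = √n` and `L` a small power of `n`. -/
structure SaddleData {n : ℕ} (m : Fin n → Fin n → ℝ) (x d r : Fin n → ℝ) (lam L M : ℝ) : Prop where
  m_eq : ∀ j k, m j k = 0 ∨ m j k = 1
  m_symm : ∀ j k, m j k = m k j
  m_diag : ∀ j, m j j = 0
  m_sum : ∀ j, ∑ k, m j k = n - 1 - x j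
  x_nonneg : ∀ j, 0 ≤ x j
  x_le : ∀ j, x j ≤ L ^ 3 * M
  x_sum : ∑ j, x j ≤ 2 * L ^ 5 * n
  r_pos : ∀ j, 0 < r j
  saddle : ∀ j, ∑ k, m j k * lamJK r j k = d j
  d_sum : ∑ j, d j = lam * (n * (n - 1))
  d_le : ∀ j, |d j - lam * (n - 1)| ≤ L ^ 3 * M
  lam_lower : 1 ≤ L * (lam * (1 - lam))
  L_large : 1000 ≤ L
  L_le : L ^ 100 ≤ M
  M_sq : M ^ 2 = n

lemma mul_pow_le_pow {L c : ℝ} (hL : 1000 ≤ L) (hc : c ≤ 1000) {i j : ℕ} (hij : i + 1 ≤ j) :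
    c * L ^ i ≤ L ^ j :=
  calc c * L ^ i ≤ L * L ^ i := by gcongr; linarith
    _ = L ^ (i + 1) := by ring
    _ ≤ L ^ j := pow_le_pow_right₀ (by linarith) hij

lemma lamJK_comm {n : ℕ} (r : Fin n → ℝ) (j k : Fin n) : lamJK r j k = lamJK r k j := by
  simp only [lamJK, mul_comm]

lemma lamJK_pos {n : ℕ} {r : Fin n → ℝ} (hr : ∀ j, 0 < r j) (j k : Fin n) : 0 < lamJK r j k := by
  have := hr j; have := hr k
  unfold lamJK; positivity

lemma lamJK_lt_one {n : ℕ} {r : Fin n → ℝ} (hr : ∀ j, 0 < r j) (j k : Fin n) :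
    lamJK r j k < 1 := by
  have := hr j; have := hr k
  unfold lamJK
  rw [div_lt_one (by positivity)]
  linarith

lemma lamJK_sub {n : ℕ} {r : Fin n → ℝ} (hr : ∀ j, 0 < r j) (j l k : Fin n) :
    lamJK r j k - lamJK r l k = lamJK r j k * (1 - lamJK r l k) * (1 - r l / r j) := by
  have := hr j; have := hr k; have := hr l
  have : 0 < 1 + r j * r k := by positivity
  have : 0 < 1 + r l * r k := by positivity
  unfold lamJK
  field_simp
  ring

namespace SaddleData

variable {n : ℕ} {m : Fin n → Fin n → ℝ} {x d r : Fin n → ℝ} {lam L M : ℝ}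

lemma L_pos (h : SaddleData m x d r lam L M) : 0 < L := by linarith [h.L_large]

lemma pow_le (h : SaddleData m x d r lam L M) {i : ℕ} (hi : i ≤ 100) : L ^ i ≤ M :=
  (pow_le_pow_right₀ (by linarith [h.L_large]) hi).trans h.L_le

lemma M_pos (h : SaddleData m x d r lam L M) : 0 < M :=
  lt_of_lt_of_le (pow_pos h.L_pos 0) (h.pow_le (i := 0) (by norm_num))

lemma n_pos (h : SaddleData m x d r lam L M) : (0 : ℝ) < n := by
  rw [← h.M_sq]; exact pow_pos h.M_pos 2

lemma lam_pos (h : SaddleData m x d r lam L M) : 0 < lam := by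
  have := h.lam_lower
  have := h.L_pos
  by_contra hh
  push Not at hh
  nlinarith [mul_nonneg (neg_nonneg.2 hh) (by linarith : 0 ≤ 1 - lam)]

lemma lam_lt_one (h : SaddleData m x d r lam L M) : lam < 1 := by
  have := h.lam_lower
  have := h.L_pos
  by_contra hh
  push Not at hh
  nlinarith [mul_nonneg (by linarith : 0 ≤ lam) (by linarith : 0 ≤ lam - 1)]

lemma one_le_L_mul_lam (h : SaddleData m x d r lam L M) : 1 ≤ L * lam := by
  refine h.lam_lower.trans ?_
  have := h.lam_pos
  have := h.L_pos
  gcongr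
  nlinarith

lemma one_le_L_mul_one_sub_lam (h : SaddleData m x d r lam L M) : 1 ≤ L * (1 - lam) := by
  refine h.lam_lower.trans ?_
  have := h.lam_lt_one
  have := h.L_pos
  gcongr
  nlinarith

lemma m_nonneg (h : SaddleData m x d r lam L M) (j k : Fin n) : 0 ≤ m j k := by
  rcases h.m_eq j k with e | e <;> simp [e]

lemma m_le_one (h : SaddleData m x d r lam L M) (j k : Fin n) : m j k ≤ 1 := by
  rcases h.m_eq j k with e | e <;> simp [e]

lemma sum_one_sub_m (h : SaddleData m x d r lam L M) (j : Fin n) :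
    ∑ k, (1 - m j k) = 1 + x j := by
  rw [Finset.sum_sub_distrib, h.m_sum]
  simp only [Finset.sum_const, Finset.card_univ, Fintype.card_fin, nsmul_eq_mul, mul_one]
  ring

lemma one_sub_min_div_le (h : SaddleData m x d r lam L M) {l t : Fin n}
    (hl : ∀ j, r l ≤ r j) : 1 - r l / r t ≤ 16 * L ^ 5 / M := by
  have hM := h.M_pos
  have hL := h.L_pos
  have hLl := h.L_large
  have hn := h.M_sq
  have hn0 := h.n_pos
  have hlam := h.lam_pos
  have hlam1 := h.lam_lt_one
  have hp := lamJK_pos h.r_pos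
  have hp1 := lamJK_lt_one h.r_pos
  have hm0 := h.m_nonneg
  have hm1 := h.m_le_one
  have hM10 : L ^ 10 ≤ M := h.pow_le (by norm_num)
  have h3 : 1 ≤ L ^ 3 * M := by
    have : (1 : ℝ) ≤ L ^ 10 := one_le_pow₀ (by linarith)
    have : (1 : ℝ) ≤ L ^ 3 := one_le_pow₀ (by linarith)
    nlinarith
  have hbig : 16 * L * (L ^ 3 * M) ≤ n := by
    rw [← hn, sq, ← mul_assoc]
    gcongr
    calc 16 * L * L ^ 3 = 16 * L ^ 4 := by ring
      _ ≤ L ^ 10 := mul_pow_le_pow hLl (by norm_num) (by norm_num)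
      _ ≤ M := hM10
  have hmono : ∀ j k, lamJK r l k ≤ lamJK r j k := fun j k => by
    have h1 := lamJK_sub h.r_pos j l k
    have h2 : r l / r j ≤ 1 := (div_le_one (h.r_pos j)).2 (hl j)
    have h3 := mul_nonneg (mul_nonneg (hp j k).le (by linarith [hp1 l k] : 0 ≤ 1 - lamJK r l k))
      (by linarith : 0 ≤ 1 - r l / r j)
    linarith
  have hlk : ∀ k, 1 ≤ 2 * L * (1 - lamJK r l k) := fun k => by
    have h1 : lamJK r l k * (n - 1 - x k) ≤ d k := by
      rw [← h.saddle k, ← h.m_sum k, Finset.mul_sum]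
      refine Finset.sum_le_sum fun j _ => ?_
      rw [mul_comm, lamJK_comm r k j]
      exact mul_le_mul_of_nonneg_left (hmono j k) (hm0 k j)
    have h2 := (abs_le.1 (h.d_le k)).2
    have h4 := h.x_le k
    have h5 := hp1 l k
    have h6 := hp l k
    have h7 : (lamJK r l k - lam) * (n - 1) ≤ 2 * (L ^ 3 * M) := by
      nlinarith [h.x_nonneg k]
    by_contra hc
    push Not at hc
    have h8 := h.one_le_L_mul_one_sub_lam
    have h9 : 1 < 2 * (L * (lamJK r l k - lam)) := by nlinarith
    have h10 : (n - 1 : ℝ) ≤ 2 * (L * (2 * (L ^ 3 * M))) := by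
      have : L * ((lamJK r l k - lam) * (n - 1)) ≤ L * (2 * (L ^ 3 * M)) := by gcongr
      nlinarith
    nlinarith
  have hsum : ∑ k, m t k * m l k * (lamJK r t k - lamJK r l k) ≤ 4 * (L ^ 3 * M) := by
    have h1 : ∑ k, m t k * m l k * (lamJK r t k - lamJK r l k)
        ≤ ∑ k, (m t k * lamJK r t k - m l k * lamJK r l k + (1 - m t k)) := by
      refine Finset.sum_le_sum fun k _ => ?_
      have := hp t k; have := hp1 t k; have := hp l k; have := hp1 l k
      rcases h.m_eq t k with e | e <;> rcases h.m_eq l k with e' | e' <;> rw [e, e'] <;> linarith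
    rw [Finset.sum_add_distrib, Finset.sum_sub_distrib, h.saddle, h.saddle, h.sum_one_sub_m] at h1
    have := abs_le.1 (h.d_le t)
    have := abs_le.1 (h.d_le l)
    have := h.x_le t
    linarith
  have hlow : n ≤ 2 * L * ∑ k, m t k * m l k * lamJK r t k := by
    have h1 : ∑ k, (m t k * lamJK r t k - (1 - m l k)) ≤ ∑ k, m t k * m l k * lamJK r t k := by
      refine Finset.sum_le_sum fun k _ => ?_
      have := hp t k; have := hp1 t k
      rcases h.m_eq t k with e | e <;> rcases h.m_eq l k with e' | e' <;> rw [e, e'] <;> linarith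
    rw [Finset.sum_sub_distrib, h.saddle, h.sum_one_sub_m] at h1
    have h2 := abs_le.1 (h.d_le t)
    have h4 := h.x_le l
    have h5 : lam * (n - 1) - 3 * (L ^ 3 * M) ≤ ∑ k, m t k * m l k * lamJK r t k := by linarith
    have h6 := h.one_le_L_mul_lam
    have h7 : L * (lam * (n - 1) - 3 * (L ^ 3 * M)) ≤ L * ∑ k, m t k * m l k * lamJK r t k := by
      gcongr
    have h8 : (n : ℝ) - 1 ≤ L * lam * (n - 1) := le_mul_of_one_le_left (by nlinarith) h6
    nlinarith
  have hq0 : 0 ≤ 1 - r l / r t := by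
    linarith [(div_le_one (h.r_pos t)).2 (hl t)]
  have hkey : n * (1 - r l / r t) ≤ 16 * L ^ 5 * M := by
    have h1 : (1 - r l / r t) * ∑ k, m t k * m l k * lamJK r t k
        ≤ 2 * L * ∑ k, m t k * m l k * (lamJK r t k - lamJK r l k) := by
      rw [Finset.mul_sum, Finset.mul_sum]
      refine Finset.sum_le_sum fun k _ => ?_
      rw [lamJK_sub h.r_pos t l k]
      have h2 := hlk k
      have h3 : 0 ≤ (1 - r l / r t) * (m t k * m l k * lamJK r t k) :=
        mul_nonneg hq0 (mul_nonneg (mul_nonneg (hm0 _ _) (hm0 _ _)) (hp _ _).le)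
      calc _ ≤ (2 * L * (1 - lamJK r l k)) * ((1 - r l / r t) * (m t k * m l k * lamJK r t k)) :=
            le_mul_of_one_le_left h3 h2
        _ = _ := by ring
    calc n * (1 - r l / r t)
        ≤ (2 * L * ∑ k, m t k * m l k * lamJK r t k) * (1 - r l / r t) :=
          mul_le_mul_of_nonneg_right hlow hq0
      _ = 2 * L * ((1 - r l / r t) * ∑ k, m t k * m l k * lamJK r t k) := by ring
      _ ≤ 2 * L * (2 * L * (4 * (L ^ 3 * M))) := by
          exact mul_le_mul_of_nonneg_left
            (h1.trans (mul_le_mul_of_nonneg_left hsum (by positivity))) (by positivity)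
      _ = _ := by ring
  rw [le_div_iff₀ hM]
  rw [← hn] at hkey
  nlinarith

lemma abs_lamJK_sub_le (h : SaddleData m x d r lam L M) (j k : Fin n) :
    |lamJK r j k - lam| ≤ L ^ 6 / M := by
  have hM := h.M_pos
  have hL := h.L_pos
  have hLl := h.L_large
  have hn := h.M_sq
  have hn0 := h.n_pos
  have hp := lamJK_pos h.r_pos
  have hp1 := lamJK_lt_one h.r_pos
  have : Nonempty (Fin n) := ⟨j⟩
  obtain ⟨l, hl⟩ := Finite.exists_min r
  obtain ⟨t, ht⟩ := Finite.exists_max r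
  set ρ := 16 * L ^ 5 / M with hρ
  have hρ0 : 0 ≤ ρ := by positivity
  have hgap := h.one_sub_min_div_le (t := t) hl
  have hone : ∀ i i' k, lamJK r i k - lamJK r i' k ≤ ρ := fun i i' k => by
    rw [lamJK_sub h.r_pos]
    have h1 : r l / r t ≤ r i' / r i := by
      have := h.r_pos i; have := h.r_pos i'
      exact div_le_div₀ (h.r_pos i').le (hl i') (h.r_pos i) (ht i)
    have h2 := hp i k; have h3 := hp1 i k; have h4 := hp i' k; have h5 := hp1 i' k
    have h6 : 0 ≤ lamJK r i k * (1 - lamJK r i' k) := mul_nonneg h2.le (by linarith)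
    have h7 : lamJK r i k * (1 - lamJK r i' k) ≤ 1 := by nlinarith
    calc _ ≤ lamJK r i k * (1 - lamJK r i' k) * ρ := by gcongr; linarith
      _ ≤ 1 * ρ := by gcongr
      _ = ρ := one_mul _
  have htwo : ∀ i i' : Fin n, |lamJK r i i' - lamJK r j k| ≤ 2 * ρ := fun i i' => by
    have h1 := hone i j i'
    have h2 := hone j i i'
    have h3 := hone i' k j
    have h4 := hone k i' j
    rw [lamJK_comm r i' j, lamJK_comm r k j] at h3 h4
    rw [abs_le]; constructor <;> linarith
  have hsum : |∑ i, ∑ i', m i i' * (lamJK r i i' - lamJK r j k)| ≤ n * ((n - 1) * (2 * ρ)) := by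
    calc _ ≤ ∑ i, ∑ i', m i i' * (2 * ρ) := by
          refine (Finset.abs_sum_le_sum_abs _ _).trans (Finset.sum_le_sum fun i _ =>
            (Finset.abs_sum_le_sum_abs _ _).trans (Finset.sum_le_sum fun i' _ => ?_))
          rw [abs_mul, abs_of_nonneg (h.m_nonneg _ _)]
          exact mul_le_mul_of_nonneg_left (htwo i i') (h.m_nonneg _ _)
      _ ≤ ∑ i : Fin n, (n - 1) * (2 * ρ) := by
          refine Finset.sum_le_sum fun i _ => ?_
          rw [← Finset.sum_mul, h.m_sum]
          have := h.x_nonneg i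
          exact mul_le_mul_of_nonneg_right (by linarith) (by positivity)
      _ = _ := by simp
  have e : ∑ i, ∑ i', m i i' * (lamJK r i i' - lamJK r j k)
      = (lam - lamJK r j k) * (n * (n - 1)) + lamJK r j k * ∑ i, x i := by
    simp_rw [mul_sub, Finset.sum_sub_distrib, h.saddle, ← Finset.sum_mul, h.m_sum, h.d_sum,
      Finset.sum_sub_distrib]
    simp
    ring
  rw [e] at hsum
  have hx := h.x_sum
  have hx0 : 0 ≤ ∑ i, x i := Finset.sum_nonneg fun i _ => h.x_nonneg i
  have hn1 : (n : ℝ) ≤ 2 * (n - 1) := by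
    have : (1 : ℝ) ≤ L ^ 10 := one_le_pow₀ (by linarith)
    have := h.pow_le (i := 1) (by norm_num)
    nlinarith
  have h1 : |lam - lamJK r j k| * (n * (n - 1)) ≤ n * ((n - 1) * (2 * ρ)) + 2 * L ^ 5 * n := by
    have h2 : |(lam - lamJK r j k) * (n * (n - 1))| = |lam - lamJK r j k| * (n * (n - 1)) := by
      rw [abs_mul, abs_of_nonneg (by nlinarith : (0 : ℝ) ≤ n * (n - 1))]
    rw [← h2]
    have h3 : |lamJK r j k * ∑ i, x i| ≤ 2 * L ^ 5 * n := by
      rw [abs_of_nonneg (mul_nonneg (hp j k).le hx0)]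
      exact (mul_le_of_le_one_left hx0 (hp1 j k).le).trans hx
    have h4 := abs_le.1 hsum
    have h5 := abs_le.1 h3
    rw [abs_le]; constructor <;> linarith
  have h2 : |lam - lamJK r j k| * (n - 1) ≤ (n - 1) * (2 * ρ) + 2 * L ^ 5 :=
    le_of_mul_le_mul_left (by nlinarith) hn0
  have h3 : 2 * L ^ 5 ≤ (n - 1) * (L ^ 5 / M) := by
    have h4 : 4 ≤ M := by linarith [h.pow_le (i := 1) (by norm_num)]
    have h5 : 4 * M ≤ n := by nlinarith
    rw [mul_div_assoc', le_div_iff₀ hM]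
    nlinarith [pow_pos hL 5]
  have hn2 : (0 : ℝ) < n - 1 := by linarith
  have h6 : |lam - lamJK r j k| ≤ 2 * ρ + L ^ 5 / M :=
    le_of_mul_le_mul_left (by nlinarith) hn2
  rw [abs_sub_comm]
  refine h6.trans ?_
  have : 2 * ρ + L ^ 5 / M = 33 * L ^ 5 / M := by rw [hρ]; ring
  rw [this]
  gcongr
  exact mul_pow_le_pow hLl (by norm_num) (by norm_num)

lemma sum_m_mul_lamJK_sub (h : SaddleData m x d r lam L M) (j : Fin n) :
    ∑ k, m j k * (lamJK r j k - lam) = d j - lam * (n - 1) + lam * x j := by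
  simp_rw [mul_sub, Finset.sum_sub_distrib, h.saddle, ← Finset.sum_mul, h.m_sum]
  ring

lemma sum_dev (h : SaddleData m x d r lam L M) :
    ∑ j, (d j - lam * (n - 1) + lam * x j) = lam * ∑ j, x j := by
  rw [Finset.sum_add_distrib, Finset.sum_sub_distrib, h.d_sum, ← Finset.mul_sum univ x]
  simp only [Finset.sum_const, Finset.card_univ, Fintype.card_fin, nsmul_eq_mul]
  ring

lemma abs_dev_le (h : SaddleData m x d r lam L M) (j : Fin n) :
    |d j - lam * (n - 1) + lam * x j| ≤ L ^ 6 * M := by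
  have hM := h.M_pos
  have hL := h.L_pos
  rw [← h.sum_m_mul_lamJK_sub j]
  calc _ ≤ ∑ k : Fin n, L ^ 6 / M := by
        refine (Finset.abs_sum_le_sum_abs _ _).trans (Finset.sum_le_sum fun k _ => ?_)
        rw [abs_mul, abs_of_nonneg (h.m_nonneg j k)]
        exact (mul_le_of_le_one_left (abs_nonneg _) (h.m_le_one j k)).trans (h.abs_lamJK_sub_le j k)
    _ = L ^ 6 * M := by
        simp only [Finset.sum_const, Finset.card_univ, Fintype.card_fin, nsmul_eq_mul, ← h.M_sq]
        field_simp

lemma exists_abs_lamJK_sub_add_le (h : SaddleData m x d r lam L M) :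
    ∃ v : Fin n → ℝ, ∀ j k, |lamJK r j k - lam - (v j + v k)| ≤ L ^ 17 / n := by
  have hM := h.M_pos
  have hL := h.L_pos
  have hLl := h.L_large
  have hn := h.M_sq
  have hn0 := h.n_pos
  have hlam := h.lam_pos
  have hlam1 := h.lam_lt_one
  set q := lam * (1 - lam) with hq
  have hqL : 1 ≤ L * q := h.lam_lower
  have hq0 : 0 < q := mul_pos hlam (by linarith)
  have hq1 : q ≤ 1 := by rw [hq]; nlinarith
  set r₀ := √(lam / (1 - lam)) with hr₀
  have hr0 : 0 < r₀ := Real.sqrt_pos.2 (div_pos hlam (by linarith))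
  have hr2 : r₀ ^ 2 = lam / (1 - lam) := Real.sq_sqrt (div_nonneg hlam.le (by linarith))
  set u : Fin n → ℝ := fun j => r j / r₀ - 1 with hu
  set p : Fin n → Fin n → ℝ := fun j k => u j + u k + u j * u k with hp
  have hpr : ∀ j k, r j * r k = lam / (1 - lam) * (1 + p j k) := fun j k => by
    rw [← hr2]; simp only [hp, hu]; field_simp; ring
  have hap : ∀ j k, (lamJK r j k - lam) * (1 + lam * p j k) = q * p j k := fun j k => by
    have h1 : 0 < 1 + r j * r k := by have := h.r_pos j; have := h.r_pos k; positivity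
    have h2 : 1 - lam ≠ 0 := by linarith
    have h3 : (1 + r j * r k) * (1 - lam) = 1 + lam * p j k := by
      rw [hpr]; field_simp; ring
    have h4 : 1 + lam * p j k ≠ 0 := by rw [← h3]; exact mul_ne_zero h1.ne' h2
    have h5 : lamJK r j k = lam * (1 + p j k) / (1 + lam * p j k) := by
      rw [lamJK, ← h3, hpr]; field_simp
    rw [h5, sub_mul, div_mul_cancel₀ _ h4, hq]
    ring
  have ha : ∀ j k, |lamJK r j k - lam| ≤ L ^ 6 / M := h.abs_lamJK_sub_le
  have hsmall : L ^ 6 / M ≤ q / 2 := by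
    rw [div_le_iff₀ hM]
    have h1 : 2 * L ^ 7 ≤ M := (mul_pow_le_pow hLl (by norm_num) (by norm_num)).trans
      (h.pow_le (i := 8) (by norm_num))
    have h2 : q * (2 * L ^ 7) ≤ q * M := by gcongr
    have h3 : L ^ 6 * 1 ≤ L ^ 6 * (L * q) := by gcongr
    nlinarith
  have hpb : ∀ j k, |p j k| ≤ 2 * L ^ 7 / M := fun j k => by
    have h1 : p j k * (q - lam * (lamJK r j k - lam)) = lamJK r j k - lam := by
      linarith [hap j k]
    have h2 : q / 2 ≤ q - lam * (lamJK r j k - lam) := by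
      have := (abs_le.1 ((ha j k).trans hsmall))
      nlinarith
    have h3 : |p j k| * (q / 2) ≤ L ^ 6 / M := by
      refine le_trans ?_ (ha j k)
      rw [← h1, abs_mul]
      gcongr
      exact h2.trans (le_abs_self _)
    have h4 : |p j k| * 1 ≤ |p j k| * (L * q) := by gcongr
    calc |p j k| ≤ 2 * L * (|p j k| * (q / 2)) := by linarith
      _ ≤ 2 * L * (L ^ 6 / M) := by gcongr
      _ = _ := by ring
  have hub : ∀ j, |u j| ≤ 2 * L ^ 7 / M := fun j => by
    refine le_trans ?_ (hpb j j)
    have h1 : -1 ≤ u j := by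
      have : 0 ≤ r j / r₀ := (div_pos (h.r_pos j) hr0).le
      simp only [hu]; linarith
    have h2 : p j j = u j * (2 + u j) := by simp only [hp]; ring
    rw [h2, abs_mul]
    exact le_mul_of_one_le_right (abs_nonneg _) (by rw [abs_of_nonneg] <;> linarith)
  refine ⟨fun j => q * u j, fun j k => ?_⟩
  have e : lamJK r j k - lam - (q * u j + q * u k)
      = q * (u j * u k) - (lamJK r j k - lam) * (lam * p j k) := by
    have := hap j k
    simp only [hp] at this ⊢
    linarith
  rw [e]
  have h1 : |q * (u j * u k)| ≤ 1 * (2 * L ^ 7 / M * (2 * L ^ 7 / M)) := by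
    rw [abs_mul q, abs_mul (u j), abs_of_pos hq0]
    gcongr
    · exact hub j
    · exact hub k
  have h2 : |(lamJK r j k - lam) * (lam * p j k)| ≤ L ^ 6 / M * (1 * (2 * L ^ 7 / M)) := by
    rw [abs_mul, abs_mul, abs_of_pos hlam]
    gcongr
    · exact ha j k
    · exact hpb j k
  calc _ ≤ 1 * (2 * L ^ 7 / M * (2 * L ^ 7 / M)) + L ^ 6 / M * (1 * (2 * L ^ 7 / M)) :=
        (abs_sub _ _).trans (add_le_add h1 h2)
    _ = (4 * L ^ 14 + 2 * L ^ 13) / n := by rw [← hn]; field_simp; ring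
    _ ≤ L ^ 17 / n := by
        gcongr
        have h3 : 4 * L ^ 14 ≤ L ^ 15 := mul_pow_le_pow hLl (by norm_num) (by norm_num)
        have h4 : 2 * L ^ 13 ≤ L ^ 15 := mul_pow_le_pow hLl (by norm_num) (by norm_num)
        have h5 : 2 * L ^ 15 ≤ L ^ 17 := mul_pow_le_pow hLl (by norm_num) (by norm_num)
        linarith

lemma abs_lamJK_sub_dev_le (h : SaddleData m x d r lam L M) {δ : Fin n → ℝ}
    (hδ : ∀ j, δ j = d j - lam * (n - 1) + lam * x j) (j k : Fin n) :
    |lamJK r j k - lam - (δ j + δ k) / n| ≤ L ^ 18 / n := by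
  have hM := h.M_pos
  have hL := h.L_pos
  have hLl := h.L_large
  have hn := h.M_sq
  have hn0 := h.n_pos
  obtain ⟨v, hv⟩ := h.exists_abs_lamJK_sub_add_le
  have h9 : 2 * L ^ 9 ≤ L ^ 17 := mul_pow_le_pow hLl (by norm_num) (by norm_num)
  have h1 : ∀ i, |δ i - (n * v i + ∑ k, v k)| ≤ 2 * L ^ 17 := fun i => by
    have e : δ i - (n * v i + ∑ k, v k)
        = ∑ k, (lamJK r i k - lam - (v i + v k)) - ∑ k, (1 - m i k) * (lamJK r i k - lam) := by
      rw [hδ, ← h.sum_m_mul_lamJK_sub i, Finset.sum_sub_distrib, Finset.sum_add_distrib]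
      simp_rw [sub_mul, one_mul, Finset.sum_sub_distrib]
      simp
    rw [e]
    have b1 : |∑ k, (lamJK r i k - lam - (v i + v k))| ≤ L ^ 17 := by
      calc _ ≤ ∑ k : Fin n, L ^ 17 / n :=
            (Finset.abs_sum_le_sum_abs _ _).trans (Finset.sum_le_sum fun k _ => hv i k)
        _ = L ^ 17 := by simp; field_simp
    have b2 : |∑ k, (1 - m i k) * (lamJK r i k - lam)| ≤ L ^ 17 := by
      calc _ ≤ ∑ k : Fin n, (1 - m i k) * (L ^ 6 / M) := by
            refine (Finset.abs_sum_le_sum_abs _ _).trans (Finset.sum_le_sum fun k _ => ?_)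
            have := h.m_le_one i k
            rw [abs_mul, abs_of_nonneg (by linarith)]
            exact mul_le_mul_of_nonneg_left (h.abs_lamJK_sub_le i k) (by linarith)
        _ = (1 + x i) * (L ^ 6 / M) := by rw [← Finset.sum_mul, h.sum_one_sub_m]
        _ ≤ (L ^ 3 * M + L ^ 3 * M) * (L ^ 6 / M) := by
            gcongr
            · have : (1 : ℝ) ≤ L ^ 3 := one_le_pow₀ (by linarith)
              have : (1 : ℝ) ≤ M := by simpa using h.pow_le (i := 0) (by norm_num)
              nlinarith
            · exact h.x_le i
        _ = 2 * L ^ 9 := by field_simp; ring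
        _ ≤ L ^ 17 := h9
    refine (abs_sub _ _).trans ?_
    linarith
  have h2 : |∑ k, v k| ≤ 2 * L ^ 17 := by
    have e : 2 * n * ∑ k, v k = lam * ∑ k, x k - ∑ i, (δ i - (n * v i + ∑ k, v k)) := by
      rw [← h.sum_dev, Finset.sum_sub_distrib (f := δ),
        Finset.sum_add_distrib (f := fun i => n * v i),
        ← Finset.mul_sum, Finset.sum_congr rfl fun i _ => hδ i]
      simp only [Finset.sum_const, Finset.card_univ, Fintype.card_fin, nsmul_eq_mul]
      ring
    have b1 : |∑ i, (δ i - (n * v i + ∑ k, v k))| ≤ n * (2 * L ^ 17) := by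
      refine (Finset.abs_sum_le_sum_abs _ _).trans ((Finset.sum_le_sum fun k _ => h1 k).trans ?_)
      simp
    have b2 : |lam * ∑ k, x k| ≤ n * (2 * L ^ 17) := by
      have hx0 : 0 ≤ ∑ k, x k := Finset.sum_nonneg fun k _ => h.x_nonneg k
      rw [abs_of_nonneg (mul_nonneg h.lam_pos.le hx0)]
      have : L ^ 5 ≤ L ^ 17 := pow_le_pow_right₀ (by linarith) (by norm_num)
      calc lam * ∑ k, x k ≤ 1 * (2 * L ^ 5 * n) :=
            mul_le_mul h.lam_lt_one.le h.x_sum hx0 zero_le_one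
        _ ≤ _ := by nlinarith
    have b3 : 2 * n * |∑ k, v k| ≤ 2 * n * (2 * L ^ 17) := by
      calc 2 * n * |∑ k, v k| = |2 * n * ∑ k, v k| := by
            rw [abs_mul, abs_of_pos (by positivity : (0 : ℝ) < 2 * n)]
        _ ≤ n * (2 * L ^ 17) + n * (2 * L ^ 17) := by
            rw [e]; exact (abs_sub _ _).trans (add_le_add b2 b1)
        _ = _ := by ring
    exact le_of_mul_le_mul_left b3 (by positivity)
  have h3 : ∀ i, |v i - δ i / n| ≤ 4 * L ^ 17 / n := fun i => by
    rw [le_div_iff₀ hn0, ← abs_of_pos hn0, ← abs_mul, abs_of_pos hn0]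
    have e : (v i - δ i / n) * n = -((δ i - (n * v i + ∑ k, v k)) + ∑ k, v k) := by
      field_simp; ring
    rw [e, abs_neg]
    refine (abs_add_le _ _).trans ?_
    linarith [h1 i]
  have e : lamJK r j k - lam - (δ j + δ k) / n
      = (lamJK r j k - lam - (v j + v k)) + (v j - δ j / n) + (v k - δ k / n) := by ring
  rw [e]
  calc _ ≤ L ^ 17 / n + 4 * L ^ 17 / n + 4 * L ^ 17 / n :=
        (abs_add_three _ _ _).trans (add_le_add (add_le_add (hv j k) (h3 j)) (h3 k))
    _ = 9 * L ^ 17 / n := by ring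
    _ ≤ L ^ 18 / n := by
        gcongr
        exact mul_pow_le_pow hLl (by norm_num) (by norm_num)

lemma abs_sum_m_mul_sq_sub_le (h : SaddleData m x d r lam L M) {δ : Fin n → ℝ}
    (hδ : ∀ j, δ j = d j - lam * (n - 1) + lam * x j) :
    |∑ j, ∑ k, m j k * (lamJK r j k - lam) ^ 2 - 2 / n * ∑ j, δ j ^ 2| ≤ L ^ 24 * M := by
  have hM := h.M_pos
  have hL := h.L_pos
  have hn := h.M_sq
  have hn0 := h.n_pos
  set a : Fin n → Fin n → ℝ := fun j k => lamJK r j k - lam with ha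
  have hδa : ∀ j, ∑ k, m j k * a j k = δ j := fun j => by rw [hδ, ← h.sum_m_mul_lamJK_sub]
  have s1 : ∑ j, ∑ k, m j k * a j k * δ j = ∑ j, δ j ^ 2 := by
    simp_rw [← Finset.sum_mul, hδa, sq]
  have s2 : ∑ j, ∑ k, m j k * a j k * δ k = ∑ j, δ j ^ 2 := by
    rw [Finset.sum_comm, ← s1]
    refine Finset.sum_congr rfl fun j _ => Finset.sum_congr rfl fun k _ => ?_
    simp only [ha]
    rw [h.m_symm k j, lamJK_comm r k j]
  have e : ∑ j, ∑ k, m j k * a j k ^ 2 - 2 / n * ∑ j, δ j ^ 2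
      = ∑ j, ∑ k, m j k * a j k * (a j k - (δ j + δ k) / n) := by
    have : ∀ j k, m j k * a j k * (a j k - (δ j + δ k) / n)
        = m j k * a j k ^ 2 - (1 / n * (m j k * a j k * δ j) + 1 / n * (m j k * a j k * δ k)) :=
      fun j k => by ring
    simp_rw [this, Finset.sum_sub_distrib, Finset.sum_add_distrib, ← Finset.mul_sum, s1, s2]
    ring
  rw [e]
  calc _ ≤ ∑ j : Fin n, ∑ k : Fin n, 1 * (L ^ 6 / M) * (L ^ 18 / n) := by
        refine (Finset.abs_sum_le_sum_abs _ _).trans (Finset.sum_le_sum fun j _ =>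
          (Finset.abs_sum_le_sum_abs _ _).trans (Finset.sum_le_sum fun k _ => ?_))
        rw [abs_mul, abs_mul, abs_of_nonneg (h.m_nonneg j k)]
        gcongr
        · exact h.m_le_one j k
        · exact h.abs_lamJK_sub_le j k
        · exact h.abs_lamJK_sub_dev_le hδ j k
    _ = L ^ 24 * M := by
        simp only [Finset.sum_const, Finset.card_univ, Fintype.card_fin, nsmul_eq_mul, ← hn]
        field_simp

end SaddleData

/-- Half the variance of the indicator of the pair `{j, k}`. -/
def pairVar {n : ℕ} (r : Fin n → ℝ) (j k : Fin n) : ℝ := lamJK r j k * (1 - lamJK r j k) / 2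

/-- The coefficient of `θ j ^ 2` in the quadratic form at the saddle point. -/
def curv {n : ℕ} (m : Fin n → Fin n → ℝ) (r : Fin n → ℝ) (j : Fin n) : ℝ :=
  ∑ k, m j k * pairVar r j k

lemma abs_log_one_add_sub_le {e : ℝ} (he : |e| ≤ 1 / 2) :
    |Real.log (1 + e) - (e - e ^ 2 / 2)| ≤ 2 * |e| ^ 3 := by
  have h := Real.abs_log_sub_add_sum_range_le (x := -e) (by rw [abs_neg]; linarith) 2
  rw [abs_neg, sub_neg_eq_add] at h
  have e1 : ∑ i ∈ range 2, (-e) ^ (i + 1) / ((i : ℝ) + 1) + Real.log (1 + e)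
      = Real.log (1 + e) - (e - e ^ 2 / 2) := by
    simp [Finset.sum_range_succ]; ring
  rw [e1] at h
  refine h.trans ?_
  rw [div_le_iff₀ (by linarith)]
  have h3 := pow_nonneg (abs_nonneg e) 3
  norm_num
  nlinarith [mul_le_mul_of_nonneg_left he h3]

namespace SaddleData

variable {n : ℕ} {m : Fin n → Fin n → ℝ} {x d r : Fin n → ℝ} {lam L M : ℝ}

lemma curv_eq (h : SaddleData m x d r lam L M) {δ : Fin n → ℝ}
    (hδ : ∀ j, δ j = d j - lam * (n - 1) + lam * x j) (j : Fin n) :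
    curv m r j = lam * (1 - lam) / 2 * (n - 1 - x j) + (1 - 2 * lam) / 2 * δ j
      - 1 / 2 * ∑ k, m j k * (lamJK r j k - lam) ^ 2 := by
  rw [← h.m_sum j, hδ, ← h.sum_m_mul_lamJK_sub j, curv]
  simp_rw [Finset.mul_sum, ← Finset.sum_add_distrib, ← Finset.sum_sub_distrib]
  refine Finset.sum_congr rfl fun k _ => ?_
  rw [pairVar]
  ring

lemma sum_m_mul_sq_le (h : SaddleData m x d r lam L M) (j : Fin n) :
    ∑ k, m j k * (lamJK r j k - lam) ^ 2 ≤ L ^ 12 := by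
  have hM := h.M_pos
  calc _ ≤ ∑ k : Fin n, 1 * (L ^ 6 / M) ^ 2 := by
        refine Finset.sum_le_sum fun k _ => ?_
        rw [← sq_abs]
        gcongr
        · exact h.m_le_one j k
        · exact h.abs_lamJK_sub_le j k
    _ = L ^ 12 := by
        simp only [Finset.sum_const, Finset.card_univ, Fintype.card_fin, nsmul_eq_mul, ← h.M_sq]
        field_simp

lemma exists_curv_decomposition (h : SaddleData m x d r lam L M) {δ : Fin n → ℝ}
    (hδ : ∀ j, δ j = d j - lam * (n - 1) + lam * x j) :
    ∃ f g : Fin n → ℝ, (∀ j, curv m r j = lam * (1 - lam) / 2 * n * (1 + (f j + g j))) ∧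
      (∀ j, f j = (1 - 2 * lam) * δ j / (lam * (1 - lam) * n)) ∧
      (∀ j, |f j| ≤ L ^ 7 / M) ∧ (∀ j, |g j| ≤ L ^ 5 / M) ∧ ∑ j, |g j| ≤ L ^ 14 ∧
      ∑ j, g j = - 1 - (∑ j, x j) / n
        - (∑ j, ∑ k, m j k * (lamJK r j k - lam) ^ 2) / (lam * (1 - lam) * n) := by
  have hM := h.M_pos
  have hL := h.L_pos
  have hLl := h.L_large
  have hn := h.M_sq
  have hn0 := h.n_pos
  have hlam := h.lam_pos
  have hlam1 := h.lam_lt_one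
  set q := lam * (1 - lam) with hq
  have hqL : 1 ≤ L * q := h.lam_lower
  have hq0 : 0 < q := mul_pos hlam (by linarith)
  have hqinv : 1 / (q * n) ≤ L / n := by
    rw [div_le_div_iff₀ (by positivity) hn0]; nlinarith
  set s : Fin n → ℝ := fun j => ∑ k, m j k * (lamJK r j k - lam) ^ 2 with hs
  have hs0 : ∀ j, 0 ≤ s j := fun j =>
    Finset.sum_nonneg fun k _ => mul_nonneg (h.m_nonneg j k) (sq_nonneg _)
  have hs1 : ∀ j, s j ≤ L ^ 12 := h.sum_m_mul_sq_le
  have hg : ∀ j, |-(1 + x j) / n - s j / (q * n)| ≤ (1 + x j + L ^ 13) / n := fun j => by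
    have h1 : s j / (q * n) ≤ L ^ 13 / n := by
      calc s j / (q * n) = s j * (1 / (q * n)) := by ring
        _ ≤ L ^ 12 * (L / n) :=
          mul_le_mul (hs1 j) hqinv (by positivity) (by positivity)
        _ = _ := by ring
    have h2 : 0 ≤ s j / (q * n) := div_nonneg (hs0 j) (by positivity)
    have h3 : 0 ≤ (1 + x j) / n := div_nonneg (by linarith [h.x_nonneg j]) hn0.le
    have h4 : -(1 + x j) / n - s j / (q * n) = -((1 + x j) / n + s j / (q * n)) := by ring
    rw [h4, abs_neg, abs_of_nonneg (by positivity), add_div (1 + x j)]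
    linarith
  refine ⟨fun j => (1 - 2 * lam) * δ j / (q * n), fun j => -(1 + x j) / n - s j / (q * n),
    fun j => ?_, fun j => rfl, fun j => ?_, fun j => ?_, ?_, ?_⟩
  · rw [h.curv_eq hδ]
    simp only [hs]
    field_simp
    ring
  · have h1 : |1 - 2 * lam| ≤ 1 := by rw [abs_le]; constructor <;> linarith
    have h2 : |δ j| ≤ L ^ 6 * M := by rw [hδ]; exact h.abs_dev_le j
    rw [abs_div, abs_mul, abs_of_pos (by positivity : 0 < q * n)]
    calc |1 - 2 * lam| * |δ j| / (q * n) = |1 - 2 * lam| * |δ j| * (1 / (q * n)) := by ring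
      _ ≤ 1 * (L ^ 6 * M) * (L / n) := by gcongr
      _ = L ^ 7 / M := by rw [← hn]; field_simp
  · refine (hg j).trans ?_
    have h1 : (1 : ℝ) ≤ L ^ 3 := one_le_pow₀ (by linarith)
    have h2 : L ^ 10 ≤ M := h.pow_le (by norm_num)
    have h0 : 1 ≤ M := by simpa using h.pow_le (i := 0) (by norm_num)
    have h3 : L ^ 13 ≤ L ^ 3 * M := by
      calc L ^ 13 = L ^ 3 * L ^ 10 := by ring
        _ ≤ _ := by gcongr
    have h4 := h.x_le j
    calc (1 + x j + L ^ 13) / n ≤ (L ^ 3 * M + L ^ 3 * M + L ^ 3 * M) / n := by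
          gcongr; nlinarith
      _ = 3 * L ^ 3 / M := by rw [← hn]; field_simp; ring
      _ ≤ L ^ 5 / M := by
          gcongr; exact mul_pow_le_pow hLl (by norm_num) (by norm_num)
  · refine (Finset.sum_le_sum fun j _ => hg j).trans ?_
    rw [← Finset.sum_div, Finset.sum_add_distrib, Finset.sum_add_distrib, div_le_iff₀ hn0]
    simp only [Finset.sum_const, Finset.card_univ, Fintype.card_fin, nsmul_eq_mul, mul_one]
    have h1 := h.x_sum
    have h2 : 4 * L ^ 13 ≤ L ^ 14 := mul_pow_le_pow hLl (by norm_num) (by norm_num)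
    have h3 : 1 ≤ L ^ 13 := one_le_pow₀ (by linarith)
    have h4 : L ^ 5 ≤ L ^ 13 := pow_le_pow_right₀ (by linarith) (by norm_num)
    have h5 : n * (1 + 2 * L ^ 5 + L ^ 13) ≤ n * L ^ 14 := by gcongr; linarith
    linarith
  · rw [Finset.sum_sub_distrib, ← Finset.sum_div, ← Finset.sum_div, Finset.sum_neg_distrib,
      Finset.sum_add_distrib]
    simp only [Finset.sum_const, Finset.card_univ, Fintype.card_fin, nsmul_eq_mul, mul_one]
    field_simp
    ring

lemma abs_curv_div_sub_one_le (h : SaddleData m x d r lam L M) (j : Fin n) :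
    |curv m r j / (lam * (1 - lam) / 2 * n) - 1| ≤ L ^ 8 / M := by
  obtain ⟨f, g, h1, -, h3, h4, -, -⟩ := h.exists_curv_decomposition (fun _ => rfl)
  have hM := h.M_pos
  have hL := h.L_pos
  have hA : 0 < lam * (1 - lam) / 2 * n := by
    have := h.lam_pos; have := h.lam_lt_one; have := h.n_pos
    have : 0 < 1 - lam := by linarith
    positivity
  rw [h1, mul_div_cancel_left₀ _ hA.ne', add_sub_cancel_left]
  have h5 : 2 * L ^ 7 ≤ L ^ 8 := mul_pow_le_pow h.L_large (by norm_num) (by norm_num)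
  have h6 : L ^ 5 ≤ L ^ 7 := pow_le_pow_right₀ (by linarith [h.L_large]) (by norm_num)
  calc _ ≤ L ^ 7 / M + L ^ 5 / M := (abs_add_le _ _).trans (add_le_add (h3 j) (h4 j))
    _ = (L ^ 7 + L ^ 5) / M := by ring
    _ ≤ L ^ 8 / M := by gcongr; linarith

lemma abs_sum_log_curv_le (h : SaddleData m x d r lam L M) {δ : Fin n → ℝ}
    (hδ : ∀ j, δ j = d j - lam * (n - 1) + lam * x j) {A : ℝ} (hA : A = lam * (1 - lam) / 2) :
    |-(1 / 2) * ∑ j, Real.log (curv m r j / (A * n))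
      - (1 / 2 + lam * ((∑ j, x j) / 2) / ((1 - lam) * n) + (∑ j, δ j ^ 2) / (16 * A ^ 2 * n ^ 2))|
      ≤ L ^ 26 / M := by
  obtain ⟨f, g, h1, hf, h3, h4, h5, h6⟩ := h.exists_curv_decomposition hδ
  have hM := h.M_pos
  have hL := h.L_pos
  have hLl := h.L_large
  have hn := h.M_sq
  have hn0 := h.n_pos
  have hlam := h.lam_pos
  have hlam1 : 0 < 1 - lam := by linarith [h.lam_lt_one]
  have hA0 : 0 < A := by rw [hA]; positivity
  have hAn : 0 < A * n := by positivity
  have hAL : 1 / (2 * A * n) ≤ L / n := by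
    have := h.lam_lower
    rw [div_le_div_iff₀ (by positivity) hn0, hA]; nlinarith
  have hefg : ∀ j, curv m r j / (A * n) = 1 + (f j + g j) := fun j => by
    rw [h1, ← hA, mul_div_cancel_left₀ _ hAn.ne']
  have hfg : ∀ j, |f j + g j| ≤ L ^ 8 / M := fun j => by
    have := h.abs_curv_div_sub_one_le j
    rwa [← hA, hefg, add_sub_cancel_left] at this
  have hhalf : L ^ 8 / M ≤ 1 / 2 := by
    rw [div_le_iff₀ hM]
    have := (mul_pow_le_pow (c := 2) (i := 8) (j := 9) hLl (by norm_num) (by norm_num)).trans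
      (h.pow_le (by norm_num))
    linarith
  have hlog : |∑ j, Real.log (curv m r j / (A * n))
      - ∑ j, ((f j + g j) - (f j + g j) ^ 2 / 2)| ≤ 2 * L ^ 24 / M := by
    rw [← Finset.sum_sub_distrib]
    calc _ ≤ ∑ j : Fin n, 2 * (L ^ 8 / M) ^ 3 := by
          refine (Finset.abs_sum_le_sum_abs _ _).trans (Finset.sum_le_sum fun j _ => ?_)
          rw [hefg]
          refine (abs_log_one_add_sub_le ((hfg j).trans hhalf)).trans ?_
          have := hfg j
          gcongr
      _ = _ := by
          simp only [Finset.sum_const, Finset.card_univ, Fintype.card_fin, nsmul_eq_mul, ← hn]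
          field_simp
  have hsq : |∑ j, (f j + g j) ^ 2 - ∑ j, f j ^ 2| ≤ 3 * L ^ 21 / M := by
    rw [← Finset.sum_sub_distrib]
    calc _ ≤ ∑ j : Fin n, |g j| * (3 * L ^ 7 / M) := by
          refine (Finset.abs_sum_le_sum_abs _ _).trans (Finset.sum_le_sum fun j _ => ?_)
          have e : (f j + g j) ^ 2 - f j ^ 2 = g j * (2 * f j + g j) := by ring
          rw [e, abs_mul]
          refine mul_le_mul_of_nonneg_left ((abs_add_le _ _).trans ?_) (abs_nonneg _)
          rw [abs_mul, abs_two]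
          have a1 := h3 j
          have a2 := h4 j
          have a3 : L ^ 5 / M ≤ L ^ 7 / M := by
            gcongr
            · linarith
            · norm_num
          have a4 : 3 * L ^ 7 / M = 3 * (L ^ 7 / M) := by ring
          linarith
      _ ≤ L ^ 14 * (3 * L ^ 7 / M) := by
          rw [← Finset.sum_mul]; gcongr
      _ = _ := by ring
  have hff : ∑ j, f j ^ 2 = (1 - 8 * A) * (∑ j, δ j ^ 2) / (4 * A ^ 2 * n ^ 2) := by
    have e : ∀ j, f j ^ 2 = (1 - 8 * A) / (4 * A ^ 2 * n ^ 2) * δ j ^ 2 := fun j => by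
      rw [hf, hA]; field_simp; ring
    simp_rw [e, ← Finset.mul_sum]; ring
  have hf1 : ∑ j, f j = (1 - 2 * lam) * (lam * ∑ j, x j) / (2 * A * n) := by
    have e : ∀ j, f j = (1 - 2 * lam) / (2 * A * n) * δ j := fun j => by
      rw [hf, hA]; field_simp
    simp_rw [e, ← Finset.mul_sum, hδ, h.sum_dev]; ring
  have hg1 : |∑ j, g j - (-1 - (∑ j, x j) / n - (∑ j, δ j ^ 2) / (A * n ^ 2))| ≤ L ^ 25 / M := by
    have e : ∑ j, g j - (-1 - (∑ j, x j) / n - (∑ j, δ j ^ 2) / (A * n ^ 2))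
        = -(1 / (2 * A * n) * (∑ j, ∑ k, m j k * (lamJK r j k - lam) ^ 2
          - 2 / n * ∑ j, δ j ^ 2)) := by
      rw [h6, hA]; field_simp; ring
    rw [e, abs_neg, abs_mul, abs_of_pos (by positivity)]
    calc _ ≤ L / n * (L ^ 24 * M) := by
          gcongr; exact h.abs_sum_m_mul_sq_sub_le hδ
      _ = _ := by rw [← hn]; field_simp
  have e : -(1 / 2) * ∑ j, Real.log (curv m r j / (A * n))
      - (1 / 2 + lam * ((∑ j, x j) / 2) / ((1 - lam) * n) + (∑ j, δ j ^ 2) / (16 * A ^ 2 * n ^ 2))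
      = -(1 / 2) * (∑ j, Real.log (curv m r j / (A * n))
          - ∑ j, ((f j + g j) - (f j + g j) ^ 2 / 2))
        + (1 / 4) * (∑ j, (f j + g j) ^ 2 - ∑ j, f j ^ 2)
        - (1 / 2) * (∑ j, g j - (-1 - (∑ j, x j) / n - (∑ j, δ j ^ 2) / (A * n ^ 2))) := by
    have e1 : ∑ j, ((f j + g j) - (f j + g j) ^ 2 / 2)
        = ∑ j, f j + ∑ j, g j - (∑ j, (f j + g j) ^ 2) / 2 := by
      rw [Finset.sum_sub_distrib, Finset.sum_add_distrib, Finset.sum_div]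
    rw [e1, hff, hf1]
    have e2 : lam * ((∑ j, x j) / 2) / ((1 - lam) * n)
        = -(1 / 2) * ((1 - 2 * lam) * (lam * ∑ j, x j) / (2 * A * n) - (∑ j, x j) / n) := by
      rw [hA]; field_simp; ring
    rw [e2]
    field_simp
    ring
  rw [e]
  refine (abs_sub _ _).trans ((add_le_add_left (abs_add_le _ _) _).trans ?_)
  rw [abs_mul, abs_mul, abs_mul, abs_neg, abs_of_pos (by norm_num : (0 : ℝ) < 1 / 2),
    abs_of_pos (by norm_num : (0 : ℝ) < 1 / 4)]
  have b1 : 2 * L ^ 24 / M ≤ L ^ 25 / M := by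
    gcongr; exact mul_pow_le_pow hLl (by norm_num) (by norm_num)
  have b2 : 3 * L ^ 21 / M ≤ L ^ 25 / M := by
    gcongr; exact mul_pow_le_pow hLl (by norm_num) (by norm_num)
  have b3 : 2 * L ^ 25 / M ≤ L ^ 26 / M := by
    gcongr; exact mul_pow_le_pow hLl (by norm_num) (by norm_num)
  have b4 : 2 * L ^ 25 / M = 2 * (L ^ 25 / M) := by ring
  have b5 : 0 ≤ L ^ 25 / M := by positivity
  linarith

end SaddleData

/-- The truncation of `log (1 + u)` at order four. -/
def logPoly (u : ℂ) : ℂ := u - u ^ 2 / 2 + u ^ 3 / 3 - u ^ 4 / 4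

lemma norm_log_sub_logPoly_le {u : ℂ} (hu : ‖u‖ ≤ 1 / 2) :
    ‖Complex.log (1 + u) - logPoly u‖ ≤ ‖u‖ ^ 5 := by
  have h := Complex.norm_log_sub_logTaylor_le 4 (z := u) (by linarith)
  have e : Complex.logTaylor (4 + 1) u = logPoly u := by
    simp [Complex.logTaylor, logPoly, Finset.sum_range_succ]; ring
  rw [e] at h
  refine h.trans ?_
  have h2 : (1 - ‖u‖)⁻¹ ≤ 2 := by
    rw [inv_le_comm₀ (by linarith) (by norm_num)]; linarith
  have h5 : 0 ≤ ‖u‖ ^ 5 := by positivity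
  have := mul_le_mul_of_nonneg_left h2 h5
  norm_num
  linarith

/-- The factor in `logPoly u - logPoly v = (u - v) * logPolySlope u v`. -/
def logPolySlope (u v : ℂ) : ℂ :=
  1 - (u + v) / 2 + (u ^ 2 + u * v + v ^ 2) / 3 - (u ^ 3 + u ^ 2 * v + u * v ^ 2 + v ^ 3) / 4

lemma logPoly_sub_logPoly (u v : ℂ) : logPoly u - logPoly v = (u - v) * logPolySlope u v := by
  simp only [logPoly, logPolySlope]; ring

/-- The truncation of the cumulant generating function of a Bernoulli variable. -/
def cumulantPoly (p z : ℂ) : ℂ :=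
  p * z + p * (1 - p) / 2 * z ^ 2 + p * (1 - p) * (1 - 2 * p) / 6 * z ^ 3
    + p * (1 - p) * (1 - 6 * p + 6 * p ^ 2) / 24 * z ^ 4

lemma exists_logPoly_mul_eq : ∃ R : ℂ → ℂ → ℂ, Continuous (fun q : ℂ × ℂ => R q.1 q.2) ∧
    ∀ p z, logPoly (p * (z + z ^ 2 / 2 + z ^ 3 / 6 + z ^ 4 / 24))
      = cumulantPoly p z + z ^ 5 * R p z := by
  refine ⟨fun p z => -(p ^ 2 / 2) * (1 / 12 + (1 / 6 + z / 24) + z * (1 / 6 + z / 24) ^ 2)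
    + p ^ 3 / 3 * (3 * (1 / 6 + z / 24) + 3 * (1 / 2 + z / 6 + z ^ 2 / 24) ^ 2
      + z * (1 / 2 + z / 6 + z ^ 2 / 24) ^ 3)
    - p ^ 4 / 4 * ((1 / 2 + z / 6 + z ^ 2 / 24) * ((1 + z / 2 + z ^ 2 / 6 + z ^ 3 / 24) ^ 3
      + (1 + z / 2 + z ^ 2 / 6 + z ^ 3 / 24) ^ 2
      + (1 + z / 2 + z ^ 2 / 6 + z ^ 3 / 24) + 1)), by fun_prop, fun p z => ?_⟩
  simp only [logPoly, cumulantPoly]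
  ring

lemma exists_one_add_mul_exp_sub_one_eq : ∃ c : ℝ, 0 < c ∧ ∀ p x : ℝ, 0 ≤ p → p ≤ 1 →
    |x| ≤ 1 / 2 → ∃ h : ℂ, ‖h‖ ≤ c * |x| ^ 5 ∧
      1 + (p : ℂ) * (Complex.exp (Complex.I * x) - 1)
        = Complex.exp (cumulantPoly p (Complex.I * x) + h) := by
  obtain ⟨R, hR, hRe⟩ := exists_logPoly_mul_eq
  have hS : Continuous (fun q : ℂ × ℂ => logPolySlope q.1 q.2) := by
    simp only [logPolySlope]; fun_prop
  have hK : IsCompact (Metric.closedBall (0 : ℂ) 2 ×ˢ Metric.closedBall (0 : ℂ) 2) :=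
    (isCompact_closedBall _ _).prod (isCompact_closedBall _ _)
  obtain ⟨c₁, hc₁⟩ := hK.exists_bound_of_continuousOn hR.continuousOn
  obtain ⟨c₂, hc₂⟩ := hK.exists_bound_of_continuousOn hS.continuousOn
  refine ⟨1 + |c₁| + |c₂|, by positivity, fun p x hp hp1 hx => ?_⟩
  set z : ℂ := Complex.I * x with hz
  set u : ℂ := p * (Complex.exp z - 1) with hu
  set v : ℂ := p * (z + z ^ 2 / 2 + z ^ 3 / 6 + z ^ 4 / 24) with hv
  have hzn : ‖z‖ = |x| := by rw [hz]; simp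
  have hpn : ‖(p : ℂ)‖ = p := by rw [Complex.norm_real, Real.norm_of_nonneg hp]
  have hun : ‖u‖ ≤ |x| := by
    rw [hu, norm_mul, hpn]
    have h1 : ‖Complex.exp z - 1‖ ≤ |x| := Real.norm_exp_I_mul_ofReal_sub_one_le
    calc p * ‖Complex.exp z - 1‖ ≤ 1 * |x| := by gcongr
      _ = |x| := one_mul _
  have huv : ‖u - v‖ ≤ |x| ^ 5 := by
    have h1 := Complex.exp_bound (x := z) (by rw [hzn]; linarith) (n := 5) (by norm_num)
    have e : u - v = p * (Complex.exp z - ∑ i ∈ range 5, z ^ i / (i.factorial : ℂ)) := by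
      simp only [hu, hv, Finset.sum_range_succ, Finset.sum_range_zero, Nat.factorial]
      push_cast
      ring
    rw [e, norm_mul, hpn]
    have h5 : 0 ≤ |x| ^ 5 := by positivity
    calc _ ≤ 1 * (‖z‖ ^ 5 * (((5 : ℕ).succ : ℝ) * (((5 : ℕ).factorial : ℝ) * (5 : ℕ))⁻¹)) := by
          gcongr
      _ ≤ |x| ^ 5 := by
        rw [hzn]; norm_num [Nat.factorial]; linarith
  have hvn : ‖v‖ ≤ 2 := by
    have h1 : ‖v‖ ≤ ‖u‖ + ‖u - v‖ := by
      have := norm_sub_le u (u - v); rwa [sub_sub_cancel] at this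
    have h2 : |x| ^ 5 ≤ 1 := pow_le_one₀ (abs_nonneg x) (by linarith)
    linarith
  have h1u : 1 + u ≠ 0 := by
    intro h0
    have : ‖u‖ = 1 := by
      rw [show u = -1 by linear_combination h0]; simp
    linarith
  have hb₁ : ‖R p z‖ ≤ |c₁| := by
    refine (hc₁ (p, z) ⟨?_, ?_⟩).trans (le_abs_self _)
    · rw [mem_closedBall_zero_iff]; show ‖(p : ℂ)‖ ≤ 2; rw [hpn]; linarith
    · rw [mem_closedBall_zero_iff]; show ‖z‖ ≤ 2; rw [hzn]; linarith
  have hb₂ : ‖logPolySlope u v‖ ≤ |c₂| := by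
    refine (hc₂ (u, v) ⟨?_, ?_⟩).trans (le_abs_self _)
    · rw [mem_closedBall_zero_iff]; show ‖u‖ ≤ 2; linarith
    · rwa [mem_closedBall_zero_iff]
  refine ⟨Complex.log (1 + u) - cumulantPoly p z, ?_, ?_⟩
  · have e : Complex.log (1 + u) - cumulantPoly p z = (Complex.log (1 + u) - logPoly u)
        + (u - v) * logPolySlope u v + z ^ 5 * R p z := by
      rw [← logPoly_sub_logPoly, hv, hRe]; ring
    rw [e]
    calc _ ≤ ‖Complex.log (1 + u) - logPoly u‖ + ‖u - v‖ * ‖logPolySlope u v‖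
          + ‖z‖ ^ 5 * ‖R p z‖ := by
          refine (norm_add₃_le).trans ?_
          rw [norm_mul, norm_mul, norm_pow]
      _ ≤ |x| ^ 5 + |x| ^ 5 * |c₂| + |x| ^ 5 * |c₁| := by
          refine add_le_add (add_le_add ?_ ?_) ?_
          · refine (norm_log_sub_logPoly_le (hun.trans hx)).trans ?_
            gcongr
          · gcongr
          · rw [hzn]; gcongr
      _ = _ := by ring
  · rw [add_sub_cancel, Complex.exp_log h1u]

lemma volume_eq_withDensity_stdG :
    (volume : Measure ℝ)
      = stdG.withDensity fun y => ENNReal.ofReal (√(2 * Real.pi) * Real.exp (y ^ 2 / 2)) := by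
  have hm : Measurable fun y : ℝ => ENNReal.ofReal (√(2 * Real.pi) * Real.exp (y ^ 2 / 2)) := by
    fun_prop
  rw [stdG, gaussianReal_of_var_ne_zero _ one_ne_zero, ← withDensity_mul _
    (measurable_gaussianPDF 0 1) hm]
  have e : gaussianPDF 0 1 * (fun y : ℝ => ENNReal.ofReal (√(2 * Real.pi) * Real.exp (y ^ 2 / 2)))
      = 1 := by
    funext y
    have hpi : √(2 * Real.pi) ≠ 0 := by positivity
    rw [Pi.mul_apply, gaussianPDF, ← ENNReal.ofReal_mul (gaussianPDFReal_nonneg _ _ _),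
      gaussianPDFReal]
    have : (√(2 * Real.pi * ((1 : NNReal) : ℝ)))⁻¹
        * Real.exp (-(y - 0) ^ 2 / (2 * ((1 : NNReal) : ℝ)))
        * (√(2 * Real.pi) * Real.exp (y ^ 2 / 2)) = 1 := by
      rw [NNReal.coe_one, mul_one]
      calc _ = (√(2 * Real.pi))⁻¹ * √(2 * Real.pi)
            * (Real.exp (-(y - 0) ^ 2 / (2 * 1)) * Real.exp (y ^ 2 / 2)) := by ring
        _ = 1 := by
          rw [inv_mul_cancel₀ hpi, ← Real.exp_add]
          ring_nf
          exact Real.exp_zero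
    rw [this]; simp
  rw [e, withDensity_one]

lemma volume_eq_withDensity_stdPi (n : ℕ) :
    (volume : Measure (Fin n → ℝ)) = (stdPi n).withDensity fun y =>
      ∏ j, ENNReal.ofReal (√(2 * Real.pi) * Real.exp (y j ^ 2 / 2)) := by
  refine Measure.pi_eq fun s hs => ?_
  have hm : Measurable fun y : ℝ => ENNReal.ofReal (√(2 * Real.pi) * Real.exp (y ^ 2 / 2)) := by
    fun_prop
  rw [withDensity_apply _ (MeasurableSet.univ_pi hs),
    ← lintegral_indicator (MeasurableSet.univ_pi hs)]
  have e : (Set.pi Set.univ s).indicator (fun y : Fin n → ℝ =>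
      ∏ j, ENNReal.ofReal (√(2 * Real.pi) * Real.exp (y j ^ 2 / 2)))
      = fun y => ∏ j, (s j).indicator
        (fun y : ℝ => ENNReal.ofReal (√(2 * Real.pi) * Real.exp (y ^ 2 / 2))) (y j) := by
    funext y
    by_cases hy : y ∈ Set.pi Set.univ s
    · rw [Set.indicator_of_mem hy]
      refine Finset.prod_congr rfl fun j _ => ?_
      rw [Set.indicator_of_mem (hy j (Set.mem_univ j))]
    · rw [Set.indicator_of_notMem hy]
      simp only [Set.mem_pi, Set.mem_univ, true_imp_iff, not_forall] at hy
      obtain ⟨j, hj⟩ := hy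
      exact (Finset.prod_eq_zero (Finset.mem_univ j) (Set.indicator_of_notMem hj _)).symm
  have hmi := fun j => hm.indicator (hs j)
  rw [e, lintegral_prod_eq_prod_lintegral_of_indepFun univ _
    (iIndepFun_pi fun j => (hmi j).aemeasurable) fun j => (hmi j).comp (measurable_pi_apply j)]
  refine Finset.prod_congr rfl fun j _ => ?_
  rw [volume_eq_withDensity_stdG, withDensity_apply _ (hs j), ← lintegral_indicator (hs j)]
  exact (measurePreserving_eval (fun _ : Fin n => stdG) j).lintegral_comp (hmi j)

lemma setIntegral_box_eq {n : ℕ} {s : Fin n → ℝ} (hs : ∀ j, 0 < s j) {F : (Fin n → ℝ) → ℂ}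
    (hF : Measurable F) (ρ : ℝ) :
    ∫ θ in {θ : Fin n → ℝ | ∀ j, |θ j| ≤ ρ}, F θ
      = ((∏ j, (√(2 * Real.pi) * s j) : ℝ) : ℂ) *
        ∫ y in {y : Fin n → ℝ | ∀ j, |y j| ≤ ρ / s j},
          ((Real.exp ((∑ j, y j ^ 2) / 2) : ℝ) : ℂ) * F (fun j => s j * y j) ∂stdPi n := by
  set T := Matrix.toLin' (Matrix.diagonal s) with hT
  have hTy : ∀ y j, T y j = s j * y j := fun y j => by
    rw [hT, Matrix.toLin'_apply, Matrix.mulVec_diagonal]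
  have hdet : (Matrix.diagonal s).det = ∏ j, s j := Matrix.det_diagonal
  have hpos : 0 < ∏ j, s j := Finset.prod_pos fun j _ => hs j
  have hTm : Measurable T := (LinearMap.continuous_on_pi T).measurable
  have hbox : ∀ ℓ : Fin n → ℝ, MeasurableSet {θ : Fin n → ℝ | ∀ j, |θ j| ≤ ℓ j} := fun ℓ => by
    rw [Set.ofPred_forall]
    exact MeasurableSet.iInter fun j => measurableSet_le (by fun_prop) measurable_const
  have hpre : T ⁻¹' {θ : Fin n → ℝ | ∀ j, |θ j| ≤ ρ} = {y | ∀ j, |y j| ≤ ρ / s j} := by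
    ext y
    refine forall_congr' fun j => ?_
    rw [hTy, abs_mul, abs_of_pos (hs j), le_div_iff₀ (hs j), mul_comm]
  have hvol := Real.smul_map_diagonal_volume_pi (D := s) (by rw [hdet]; exact hpos.ne')
  rw [hdet, abs_of_pos hpos] at hvol
  rw [← hvol, Measure.restrict_smul, integral_smul_measure, ENNReal.toReal_ofReal hpos.le,
    setIntegral_map (hbox _) hF.aestronglyMeasurable hTm.aemeasurable, hpre,
    volume_eq_withDensity_stdPi, setIntegral_withDensity_eq_setIntegral_toReal_smul
      (by fun_prop) (ae_of_all _ fun y => ENNReal.prod_lt_top fun j _ => ENNReal.ofReal_lt_top)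
      _ (hbox _), Finset.prod_mul_distrib, Finset.prod_const, Complex.real_smul]
  rw [Complex.ofReal_mul, mul_comm ((_ : ℝ) : ℂ) ((∏ j, s j : ℝ) : ℂ), mul_assoc]
  congr 1
  rw [← integral_const_mul]
  refine integral_congr_ae (ae_of_all _ fun y => ?_)
  have e : (∏ j, ENNReal.ofReal (√(2 * Real.pi) * Real.exp (y j ^ 2 / 2))).toReal
      = √(2 * Real.pi) ^ #(univ : Finset (Fin n)) * Real.exp ((∑ j, y j ^ 2) / 2) := by
    rw [ENNReal.toReal_prod, Finset.sum_div, Real.exp_sum, ← Finset.prod_const,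
      ← Finset.prod_mul_distrib]
    exact Finset.prod_congr rfl fun j _ => ENNReal.toReal_ofReal (by positivity)
  simp only [e, Complex.real_smul, Complex.ofReal_mul, mul_assoc, show T y = fun j => s j * y j from
    funext (hTy y)]

lemma sum_sum_lt_eq {n : ℕ} {f : Fin n → Fin n → ℂ} (hs : ∀ j k, f j k = f k j)
    (hd : ∀ j, f j j = 0) :
    ∑ j, ∑ k, (if j < k then f j k else 0) = 1 / 2 * ∑ j, ∑ k, f j k := by
  have h1 : ∑ j, ∑ k, f j k = ∑ j, ∑ k, (if j < k then f j k else 0)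
      + ∑ j, ∑ k, (if k < j then f j k else 0) := by
    rw [← Finset.sum_add_distrib]
    refine Finset.sum_congr rfl fun j _ => ?_
    rw [← Finset.sum_add_distrib]
    refine Finset.sum_congr rfl fun k _ => ?_
    rcases lt_trichotomy j k with h | h | h
    · rw [if_pos h, if_neg h.le.not_gt, add_zero]
    · subst h; rw [if_neg (lt_irrefl _), hd, add_zero]
    · rw [if_neg h.le.not_gt, if_pos h, zero_add]
  have h2 : ∑ j, ∑ k, (if k < j then f j k else 0) = ∑ j, ∑ k, (if j < k then f j k else 0) := by
    rw [Finset.sum_comm]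
    refine Finset.sum_congr rfl fun j _ => Finset.sum_congr rfl fun k _ => ?_
    rw [hs]
  rw [h1, h2]; ring

/-- One sixth of the third cumulant of a Bernoulli variable. -/
def thirdCoef (p : ℝ) : ℝ := p * (1 - p) * (1 - 2 * p) / 6

/-- One twenty-fourth of the fourth cumulant of a Bernoulli variable. -/
def fourthCoef (p : ℝ) : ℝ := p * (1 - p) * (1 - 6 * p + 6 * p ^ 2) / 24

lemma cumulantPoly_I_mul (p x : ℝ) : cumulantPoly p (Complex.I * x)
    = ((-(p * (1 - p) / 2) * x ^ 2 + fourthCoef p * x ^ 4 : ℝ) : ℂ)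
      + ((p * x - thirdCoef p * x ^ 3 : ℝ) : ℂ) * Complex.I := by
  simp only [cumulantPoly, thirdCoef, fourthCoef]
  push_cast
  have h2 : Complex.I ^ 2 = -1 := Complex.I_sq
  have h3 : Complex.I ^ 3 = -Complex.I := by rw [pow_succ, h2]; ring
  have h4 : Complex.I ^ 4 = 1 := Complex.I_pow_four
  simp only [mul_pow, h2, h3, h4]
  ring

lemma half_sum_sum_mul_add {n : ℕ} {w : Fin n → Fin n → ℝ} (hw : ∀ j k, w j k = w k j)
    (θ : Fin n → ℝ) :
    1 / 2 * ∑ j, ∑ k, w j k * (θ j + θ k) = ∑ j, (∑ k, w j k) * θ j := by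
  have h : ∑ j, ∑ k, w j k * θ k = ∑ j, ∑ k, w j k * θ j := by
    rw [Finset.sum_comm]
    exact Finset.sum_congr rfl fun j _ => Finset.sum_congr rfl fun k _ => by rw [hw]
  simp_rw [mul_add, Finset.sum_add_distrib, h, Finset.sum_mul]
  ring

lemma half_sum_sum_mul_add_sq {n : ℕ} {w : Fin n → Fin n → ℝ} (hw : ∀ j k, w j k = w k j)
    (θ : Fin n → ℝ) :
    1 / 2 * ∑ j, ∑ k, w j k * (θ j + θ k) ^ 2
      = ∑ j, (∑ k, w j k) * θ j ^ 2 + ∑ j, ∑ k, w j k * (θ j * θ k) := by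
  have h : ∑ j, ∑ k, w j k * θ k ^ 2 = ∑ j, ∑ k, w j k * θ j ^ 2 := by
    rw [Finset.sum_comm]
    exact Finset.sum_congr rfl fun j _ => Finset.sum_congr rfl fun k _ => by rw [hw]
  have e : ∀ j k, w j k * (θ j + θ k) ^ 2
      = w j k * θ j ^ 2 + w j k * θ k ^ 2 + 2 * (w j k * (θ j * θ k)) := fun j k => by ring
  simp_rw [e, Finset.sum_add_distrib, h, Finset.sum_mul, ← Finset.mul_sum]
  ring

lemma half_sum_sum_mul_add_cube {n : ℕ} {w : Fin n → Fin n → ℝ} (hw : ∀ j k, w j k = w k j)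
    (θ : Fin n → ℝ) :
    1 / 2 * ∑ j, ∑ k, w j k * (θ j + θ k) ^ 3
      = ∑ j, (∑ k, w j k) * θ j ^ 3 + 3 * ∑ j, ∑ k, w j k * (θ j ^ 2 * θ k) := by
  have h : ∑ j, ∑ k, w j k * θ k ^ 3 = ∑ j, ∑ k, w j k * θ j ^ 3 := by
    rw [Finset.sum_comm]
    exact Finset.sum_congr rfl fun j _ => Finset.sum_congr rfl fun k _ => by rw [hw]
  have h' : ∑ j, ∑ k, w j k * (θ j * θ k ^ 2) = ∑ j, ∑ k, w j k * (θ j ^ 2 * θ k) := by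
    rw [Finset.sum_comm]
    exact Finset.sum_congr rfl fun j _ => Finset.sum_congr rfl fun k _ => by rw [hw]; ring
  have e : ∀ j k, w j k * (θ j + θ k) ^ 3 = w j k * θ j ^ 3 + w j k * θ k ^ 3
      + 3 * (w j k * (θ j ^ 2 * θ k)) + 3 * (w j k * (θ j * θ k ^ 2)) := fun j k => by ring
  simp_rw [e, Finset.sum_add_distrib, h, Finset.sum_mul, ← Finset.mul_sum, h']
  ring

/-- The integrand at the saddle point, with the admissible pairs encoded by the weights `m`. -/
def pairIntegrand {n : ℕ} (m : Fin n → Fin n → ℝ) (d r θ : Fin n → ℝ) : ℂ :=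
  (∏ j : Fin n, ∏ k : Fin n,
    if j < k ∧ m j k = 1 then
      1 + (lamJK r j k : ℂ) * (Complex.exp (Complex.I * ((θ j : ℂ) + (θ k : ℂ))) - 1)
    else 1)
  * Complex.exp (-Complex.I * ((∑ j, d j * θ j : ℝ) : ℂ))

namespace SaddleData

lemma exists_pairIntegrand_eq_exp : ∃ c : ℝ, 0 < c ∧
    ∀ {n : ℕ} {m : Fin n → Fin n → ℝ} {x d r : Fin n → ℝ} {lam L M : ℝ},
    SaddleData m x d r lam L M → ∀ (ρ : ℝ), ρ ≤ 1 / 4 → ∀ θ : Fin n → ℝ, (∀ j, |θ j| ≤ ρ) →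
    ∃ H : ℂ, ‖H‖ ≤ c * n ^ 2 * ρ ^ 5 ∧
      pairIntegrand m d r θ = Complex.exp
        (((-(∑ j, curv m r j * θ j ^ 2 + ∑ j, ∑ k, m j k * pairVar r j k * (θ j * θ k))
            + 1 / 2 * ∑ j, ∑ k, m j k * fourthCoef (lamJK r j k) * (θ j + θ k) ^ 4 : ℝ) : ℂ)
          - ((∑ j, (∑ k, m j k * thirdCoef (lamJK r j k)) * θ j ^ 3
            + 3 * ∑ j, ∑ k, m j k * thirdCoef (lamJK r j k) * (θ j ^ 2 * θ k) : ℝ) : ℂ)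
            * Complex.I + H) := by
  obtain ⟨c, hc, hT⟩ := exists_one_add_mul_exp_sub_one_eq
  refine ⟨32 * c, by positivity, fun {n m x d r lam L M} h ρ hρ θ hθ => ?_⟩
  have habs : ∀ j k, |θ j + θ k| ≤ 2 * ρ := fun j k =>
    (abs_add_le _ _).trans (by linarith [hθ j, hθ k])
  have hex := fun j k => hT (lamJK r j k) (θ j + θ k) (lamJK_pos h.r_pos j k).le
    (lamJK_lt_one h.r_pos j k).le ((habs j k).trans (by linarith))
  choose H hH hHe using hex
  set f : Fin n → Fin n → ℂ := fun j k =>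
    m j k * cumulantPoly (lamJK r j k) (Complex.I * ((θ j + θ k : ℝ) : ℂ)) with hf
  have hfs : ∀ j k, f j k = f k j := fun j k => by
    simp only [hf]; rw [h.m_symm j k, lamJK_comm r j k, add_comm (θ j)]
  have hfd : ∀ j, f j j = 0 := fun j => by simp only [hf]; rw [h.m_diag]; simp
  have hfac : ∀ j k, (if j < k ∧ m j k = 1 then
      1 + (lamJK r j k : ℂ) * (Complex.exp (Complex.I * ((θ j : ℂ) + (θ k : ℂ))) - 1) else 1)
      = Complex.exp ((if j < k then f j k else 0)
        + (if j < k then (m j k : ℂ) * H j k else 0)) := by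
    intro j k
    by_cases hjk : j < k
    · rcases h.m_eq j k with h0 | h1
      · simp [hjk, h0, hf]
      · simp only [hjk, h1, hf, and_self, if_true, Complex.ofReal_one, one_mul]
        rw [← hHe, Complex.ofReal_add]
    · simp [hjk]
  have hmain : ∑ j, ∑ k, (if j < k then f j k else 0)
      = ((-(∑ j, curv m r j * θ j ^ 2 + ∑ j, ∑ k, m j k * pairVar r j k * (θ j * θ k))
            + 1 / 2 * ∑ j, ∑ k, m j k * fourthCoef (lamJK r j k) * (θ j + θ k) ^ 4 : ℝ) : ℂ)
        + ((∑ j, d j * θ j - (∑ j, (∑ k, m j k * thirdCoef (lamJK r j k)) * θ j ^ 3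
            + 3 * ∑ j, ∑ k, m j k * thirdCoef (lamJK r j k) * (θ j ^ 2 * θ k)) : ℝ) : ℂ)
            * Complex.I := by
    rw [sum_sum_lt_eq hfs hfd]
    have e1 := half_sum_sum_mul_add (w := fun j k => m j k * lamJK r j k)
      (fun j k => by rw [h.m_symm, lamJK_comm]) θ
    have e2 := half_sum_sum_mul_add_sq (w := fun j k => m j k * pairVar r j k)
      (fun j k => by rw [h.m_symm, pairVar, pairVar, lamJK_comm]) θ
    have e3 := half_sum_sum_mul_add_cube (w := fun j k => m j k * thirdCoef (lamJK r j k))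
      (fun j k => by rw [h.m_symm, lamJK_comm]) θ
    simp only [h.saddle] at e1
    simp only [curv]
    rw [← e1, ← e2, ← e3]
    have e : ∀ j k, f j k
        = ((-(m j k * pairVar r j k * (θ j + θ k) ^ 2)
            + m j k * fourthCoef (lamJK r j k) * (θ j + θ k) ^ 4 : ℝ) : ℂ)
          + ((m j k * lamJK r j k * (θ j + θ k)
            - m j k * thirdCoef (lamJK r j k) * (θ j + θ k) ^ 3 : ℝ) : ℂ) * Complex.I := by
      intro j k
      simp only [hf, cumulantPoly_I_mul, pairVar]
      push_cast
      ring
    simp_rw [e, Finset.sum_add_distrib, ← Finset.sum_mul]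
    rw [mul_add, ← mul_assoc]
    congr 1
    · have : ∑ j, ∑ k, (-(m j k * pairVar r j k * (θ j + θ k) ^ 2)
            + m j k * fourthCoef (lamJK r j k) * (θ j + θ k) ^ 4)
          = -∑ j, ∑ k, m j k * pairVar r j k * (θ j + θ k) ^ 2
            + ∑ j, ∑ k, m j k * fourthCoef (lamJK r j k) * (θ j + θ k) ^ 4 := by
        simp only [Finset.sum_add_distrib, Finset.sum_neg_distrib]
      simp only [← Complex.ofReal_sum]
      rw [this]
      push_cast
      ring
    · congr 1
      simp only [← Complex.ofReal_sum, Finset.sum_sub_distrib]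
      push_cast
      ring
  refine ⟨∑ j, ∑ k, (if j < k then (m j k : ℂ) * H j k else 0), ?_, ?_⟩
  · calc _ ≤ ∑ j : Fin n, ∑ k : Fin n, c * (2 * ρ) ^ 5 := by
          refine norm_sum_le_of_le _ fun j _ => norm_sum_le_of_le _ fun k _ => ?_
          have h5 : |θ j + θ k| ^ 5 ≤ (2 * ρ) ^ 5 := pow_le_pow_left₀ (abs_nonneg _) (habs j k) 5
          have h0 : 0 ≤ c * |θ j + θ k| ^ 5 := by positivity
          split_ifs
          · rw [norm_mul, Complex.norm_real, Real.norm_of_nonneg (h.m_nonneg j k)]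
            calc m j k * ‖H j k‖ ≤ 1 * (c * |θ j + θ k| ^ 5) :=
                  mul_le_mul (h.m_le_one j k) (hH j k) (norm_nonneg _) zero_le_one
              _ ≤ c * (2 * ρ) ^ 5 := by rw [one_mul]; gcongr
          · rw [norm_zero]
            exact h0.trans (by gcongr)
      _ = 32 * c * n ^ 2 * ρ ^ 5 := by
        simp only [Finset.sum_const, Finset.card_univ, Fintype.card_fin, nsmul_eq_mul]; ring
  · rw [pairIntegrand]
    simp_rw [hfac, ← Complex.exp_sum, Finset.sum_add_distrib]
    rw [hmain, ← Complex.exp_add]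
    congr 1
    push_cast
    ring

end SaddleData

lemma abs_thirdCoef_sub_le {p q : ℝ} (hp : 0 ≤ p) (hp1 : p ≤ 1) (hq : 0 ≤ q) (hq1 : q ≤ 1) :
    |thirdCoef p - thirdCoef q| ≤ |p - q| := by
  have e : thirdCoef p - thirdCoef q
      = (p - q) * ((1 - 3 * (p + q) + 2 * (p ^ 2 + p * q + q ^ 2)) / 6) := by
    simp only [thirdCoef]; ring
  rw [e, abs_mul]
  refine mul_le_of_le_one_right (abs_nonneg _) ?_
  rw [abs_le]
  have := mul_nonneg hp hq
  constructor <;> nlinarith [mul_le_one₀ hp1 hq hq1, mul_le_one₀ hp1 hp hp1, mul_le_one₀ hq1 hq hq1]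

lemma abs_fourthCoef_sub_le {p q : ℝ} (hp : 0 ≤ p) (hp1 : p ≤ 1) (hq : 0 ≤ q) (hq1 : q ≤ 1) :
    |fourthCoef p - fourthCoef q| ≤ |p - q| := by
  have e : fourthCoef p - fourthCoef q = (p - q) *
      ((1 - (p + q)) * ((1 - 6 * (p * (1 - p)) - 6 * (q * (1 - q))) / 24)) := by
    simp only [fourthCoef]; ring
  have h1 : 0 ≤ p * (1 - p) := mul_nonneg hp (by linarith)
  have h2 : 0 ≤ q * (1 - q) := mul_nonneg hq (by linarith)
  have h3 : p * (1 - p) ≤ 1 / 4 := by nlinarith [sq_nonneg (p - 1 / 2)]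
  have h4 : q * (1 - q) ≤ 1 / 4 := by nlinarith [sq_nonneg (q - 1 / 2)]
  rw [e, abs_mul]
  refine mul_le_of_le_one_right (abs_nonneg _) ?_
  rw [abs_mul]
  refine mul_le_one₀ ?_ (abs_nonneg _) ?_ <;> rw [abs_le] <;> constructor <;> linarith

lemma abs_thirdCoef_le_one {p : ℝ} (hp : 0 ≤ p) (hp1 : p ≤ 1) : |thirdCoef p| ≤ 1 := by
  have h := abs_thirdCoef_sub_le hp hp1 le_rfl zero_le_one
  have e : thirdCoef 0 = 0 := by simp [thirdCoef]
  rw [e, sub_zero, sub_zero, abs_of_nonneg hp] at h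
  exact h.trans hp1

lemma abs_fourthCoef_le_one {p : ℝ} (hp : 0 ≤ p) (hp1 : p ≤ 1) : |fourthCoef p| ≤ 1 := by
  have h := abs_fourthCoef_sub_le hp hp1 le_rfl zero_le_one
  have e : fourthCoef 0 = 0 := by simp [fourthCoef]
  rw [e, sub_zero, sub_zero, abs_of_nonneg hp] at h
  exact h.trans hp1

lemma abs_mul_sub_one_le {a b p q : ℝ} (ha : |a - 1| ≤ p) (hb : |b - 1| ≤ q) (hp : p ≤ 1) :
    |a * b - 1| ≤ p + 2 * q := by
  have h2 : |a| ≤ 2 := by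
    rw [abs_le] at ha ⊢; constructor <;> linarith
  calc |a * b - 1| = |(a - 1) + a * (b - 1)| := by ring_nf
    _ ≤ |a - 1| + |a| * |b - 1| := (abs_add_le _ _).trans (by rw [abs_mul])
    _ ≤ p + 2 * q := by gcongr

lemma abs_mul_sub_le {w w₀ u δ η : ℝ} (hw : |w - w₀| ≤ δ) (hw₀ : |w₀| ≤ 1) (hδ : δ ≤ 1)
    (hu : |u - 1| ≤ η) : |w * u - w₀| ≤ δ + 2 * η := by
  have h2 : |w| ≤ 2 := by
    rw [abs_le] at hw hw₀ ⊢; constructor <;> linarith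
  calc |w * u - w₀| = |(w - w₀) + w * (u - 1)| := by ring_nf
    _ ≤ |w - w₀| + |w| * |u - 1| := (abs_add_le _ _).trans (by rw [abs_mul])
    _ ≤ δ + 2 * η := by gcongr

lemma mul_one_sub_le_quarter (p : ℝ) : p * (1 - p) ≤ 1 / 4 := by
  nlinarith [sq_nonneg (p - 1 / 2)]

/-- The rescaling which normalises the diagonal part of the quadratic form: the `j`-th
coordinate is multiplied by `σ * ρ j`. -/
structure IsScaling {n : ℕ} (m : Fin n → Fin n → ℝ) (r : Fin n → ℝ) (lam L M σ : ℝ)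
    (ρ : Fin n → ℝ) : Prop where
  sigma_pos : 0 < σ
  sigma_sq : lam * (1 - lam) * n * σ ^ 2 = 1
  rho_pos : ∀ j, 0 < ρ j
  abs_rho_sub_le : ∀ j, |ρ j - 1| ≤ L ^ 9 / M
  curv_mul : ∀ j, 2 * curv m r j * (σ * ρ j) ^ 2 = 1

namespace SaddleData

variable {n : ℕ} {m : Fin n → Fin n → ℝ} {x d r : Fin n → ℝ} {lam L M σ : ℝ} {ρ : Fin n → ℝ}

lemma lam_mul_pos (h : SaddleData m x d r lam L M) : 0 < lam * (1 - lam) :=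
  mul_pos h.lam_pos (by linarith [h.lam_lt_one])

lemma pow_div_le (h : SaddleData m x d r lam L M) {i : ℕ} (hi : i + 1 ≤ 100) :
    1000 * (L ^ i / M) ≤ 1 := by
  rw [← mul_div_assoc, div_le_one h.M_pos]
  exact (mul_pow_le_pow h.L_large le_rfl hi).trans (h.L_le)

lemma exists_isScaling (h : SaddleData m x d r lam L M) : ∃ σ ρ, IsScaling m r lam L M σ ρ := by
  have hn := h.n_pos
  have hA := h.lam_mul_pos
  have hM := h.M_pos
  have hL := h.L_pos
  have hLl := h.L_large
  have hq0 : 0 < lam * (1 - lam) * n := by positivity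
  have hsm : L ^ 8 / M ≤ 1 / 2 := by linarith [h.pow_div_le (i := 8) (by norm_num)]
  have he := h.abs_curv_div_sub_one_le
  have hc : ∀ j, 1 / 2 ≤ curv m r j / (lam * (1 - lam) / 2 * n) := fun j => by
    linarith [(abs_le.1 (he j)).1]
  have hcp : ∀ j, 0 < curv m r j := fun j => by
    have h1 : 0 < curv m r j / (lam * (1 - lam) / 2 * n) := by linarith [hc j]
    exact (div_pos_iff_of_pos_right (by positivity)).1 h1
  refine ⟨(√(lam * (1 - lam) * n))⁻¹,
    fun j => √(lam * (1 - lam) * n) * (√(2 * curv m r j))⁻¹, by positivity, ?_, ?_, ?_, ?_⟩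
  · rw [inv_pow, Real.sq_sqrt hq0.le, mul_inv_cancel₀ hq0.ne']
  · intro j
    have := hcp j
    positivity
  · intro j
    have hcj := hcp j
    set t := √(lam * (1 - lam) * n) * (√(2 * curv m r j))⁻¹ with ht
    set q := curv m r j / (lam * (1 - lam) / 2 * n) with hq
    have ht0 : 0 < t := by positivity
    have htq : t ^ 2 * q = 1 := by
      rw [ht, mul_pow, inv_pow, Real.sq_sqrt hq0.le, Real.sq_sqrt (by positivity), hq]
      have hA' : lam * (1 - lam) ≠ 0 := hA.ne'
      field_simp
      exact div_self hA'
    have hq2 : 1 / 2 ≤ q := hc j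
    have e : (t - 1) * (t + 1) * q = 1 - q := by linear_combination htq
    have h1 : |t - 1| * ((t + 1) * q) = |q - 1| := by
      rw [abs_sub_comm q 1, ← e, mul_assoc, abs_mul,
        abs_of_pos (show 0 < (t + 1) * q by positivity)]
    have h2 : 1 / 2 ≤ (t + 1) * q := by nlinarith
    have h3 : |t - 1| * (1 / 2) ≤ L ^ 8 / M :=
      (mul_le_mul_of_nonneg_left h2 (abs_nonneg _)).trans (h1.le.trans (he j))
    have h4 : 2 * (L ^ 8 / M) ≤ L ^ 9 / M := by
      rw [← mul_div_assoc]
      exact div_le_div_of_nonneg_right (mul_pow_le_pow hLl (by norm_num) le_rfl) hM.le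
    linarith
  · intro j
    have hcj := hcp j
    rw [← mul_assoc, inv_mul_cancel₀ (by positivity), one_mul, inv_pow,
      Real.sq_sqrt (by positivity), mul_inv_cancel₀ (by positivity)]

end SaddleData

namespace IsScaling

variable {n : ℕ} {m : Fin n → Fin n → ℝ} {x d r : Fin n → ℝ} {lam L M σ : ℝ} {ρ : Fin n → ℝ}

lemma abs_rho_mul_sub_le (hs : IsScaling m r lam L M σ ρ) (h : SaddleData m x d r lam L M)
    (j k : Fin n) : |ρ j * ρ k - 1| ≤ 3 * (L ^ 9 / M) := by
  have := abs_mul_sub_one_le (hs.abs_rho_sub_le j) (hs.abs_rho_sub_le k)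
    (by linarith [h.pow_div_le (i := 9) (by norm_num),
      div_nonneg (pow_nonneg h.L_pos.le 9) h.M_pos.le])
  linarith

lemma abs_rho_sq_mul_sub_le (hs : IsScaling m r lam L M σ ρ) (h : SaddleData m x d r lam L M)
    (j k : Fin n) : |ρ j ^ 2 * ρ k - 1| ≤ 7 * (L ^ 9 / M) := by
  have h0 := div_nonneg (pow_nonneg h.L_pos.le 9) h.M_pos.le
  have := abs_mul_sub_one_le (hs.abs_rho_sub_le j) (hs.abs_rho_mul_sub_le h j k)
    (by linarith [h.pow_div_le (i := 9) (by norm_num)])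
  rw [show ρ j ^ 2 * ρ k = ρ j * (ρ j * ρ k) by ring]
  linarith

lemma sigma_sq_mul_le (hs : IsScaling m r lam L M σ ρ) (h : SaddleData m x d r lam L M) :
    n * σ ^ 2 ≤ L := by
  have h0 : 0 ≤ n * σ ^ 2 := by positivity
  have h1 := hs.sigma_sq
  have h2 := mul_le_mul_of_nonneg_right h.lam_lower h0
  calc n * σ ^ 2 ≤ L * (lam * (1 - lam)) * (n * σ ^ 2) := by linarith
    _ = L * (lam * (1 - lam) * n * σ ^ 2) := by ring
    _ = L := by rw [h1, mul_one]

lemma sigma_mul_le (hs : IsScaling m r lam L M σ ρ) (h : SaddleData m x d r lam L M) :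
    σ ≤ L / M := by
  have hM := h.M_pos
  rw [le_div_iff₀ hM]
  refine le_of_sq_le_sq ?_ h.L_pos.le
  have h1 := hs.sigma_sq_mul_le h
  rw [← h.M_sq] at h1
  nlinarith [h.L_large]

lemma scale_le (hs : IsScaling m r lam L M σ ρ) (h : SaddleData m x d r lam L M) (j : Fin n) :
    σ * ρ j ≤ L / M := by
  have hM := h.M_pos
  have hσ := hs.sigma_pos
  have hρ := hs.rho_pos j
  rw [le_div_iff₀ hM]
  refine le_of_sq_le_sq ?_ h.L_pos.le
  have h1 := hs.sigma_sq_mul_le h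
  rw [← h.M_sq] at h1
  have h2 : ρ j ≤ 2 := by
    linarith [(abs_le.1 (hs.abs_rho_sub_le j)).2, h.pow_div_le (i := 9) (by norm_num),
      div_nonneg (pow_nonneg h.L_pos.le 9) h.M_pos.le]
  have h3 : ρ j ^ 2 ≤ 4 := by nlinarith
  calc (σ * ρ j * M) ^ 2 = M ^ 2 * σ ^ 2 * ρ j ^ 2 := by ring
    _ ≤ L * 4 := mul_le_mul h1 h3 (sq_nonneg _) h.L_pos.le
    _ ≤ L ^ 2 := by nlinarith [h.L_large]

lemma le_scale (hs : IsScaling m r lam L M σ ρ) (h : SaddleData m x d r lam L M) (j : Fin n) :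
    1 / M ≤ σ * ρ j := by
  have hM := h.M_pos
  have hσ := hs.sigma_pos
  have hρ := hs.rho_pos j
  rw [div_le_iff₀ hM]
  refine le_of_sq_le_sq ?_ (by positivity)
  have h1 := hs.sigma_sq
  rw [← h.M_sq] at h1
  have h0 : 0 ≤ M ^ 2 * σ ^ 2 := by positivity
  have h2 : 1 / 2 ≤ ρ j := by
    linarith [(abs_le.1 (hs.abs_rho_sub_le j)).1, h.pow_div_le (i := 9) (by norm_num),
      div_nonneg (pow_nonneg h.L_pos.le 9) h.M_pos.le]
  have h3 : 1 / 4 ≤ ρ j ^ 2 := by nlinarith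
  have h4 := mul_le_mul_of_nonneg_right (mul_one_sub_le_quarter lam) h0
  calc (1 : ℝ) ^ 2 ≤ (M ^ 2 * σ ^ 2) * (1 / 4) := by linarith
    _ ≤ (M ^ 2 * σ ^ 2) * ρ j ^ 2 := by gcongr
    _ = _ := by ring

lemma sum_sum_sq_le (hs : IsScaling m r lam L M σ ρ) (h : SaddleData m x d r lam L M) :
    ∑ j, ∑ k, (2 * (m j k * pairVar r j k) * ((σ * ρ j) * (σ * ρ k)) - 1 / n) ^ 2
      ≤ L ^ 21 / n := by
  have hM := h.M_pos
  have hL := h.L_pos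
  have hLl := h.L_large
  have hn := h.n_pos
  have hA := h.lam_mul_pos
  have h1lam := h.lam_lt_one
  have key : ∀ j k, (2 * (m j k * pairVar r j k) * ((σ * ρ j) * (σ * ρ k)) - 1 / n) ^ 2
      ≤ (1 - m j k) / n ^ 2 + L ^ 20 / n ^ 3 := by
    intro j k
    rcases h.m_eq j k with h0 | h1
    · rw [h0]
      have : 0 ≤ L ^ 20 / (n : ℝ) ^ 3 := by positivity
      have e : (2 * (0 * pairVar r j k) * ((σ * ρ j) * (σ * ρ k)) - 1 / (n : ℝ)) ^ 2
          = (1 - 0) / (n : ℝ) ^ 2 := by ring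
      linarith
    · set p := lamJK r j k with hp
      set v := p * (1 - p) / (lam * (1 - lam)) with hv
      have hp0 : 0 < p := lamJK_pos h.r_pos j k
      have hp1 : p < 1 := lamJK_lt_one h.r_pos j k
      have hpl : |p - lam| ≤ L ^ 6 / M := h.abs_lamJK_sub_le j k
      have hσ : σ ^ 2 = 1 / (lam * (1 - lam) * n) := by
        rw [eq_div_iff (by positivity)]; linarith [hs.sigma_sq]
      have e : 2 * (m j k * pairVar r j k) * ((σ * ρ j) * (σ * ρ k)) - 1 / n
          = (v * (ρ j * ρ k) - 1) / n := by
        rw [h1, pairVar, ← hp, hv]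
        calc _ = p * (1 - p) * σ ^ 2 * (ρ j * ρ k) - 1 / n := by ring
          _ = _ := by rw [hσ]; field_simp
      have hv1 : |v - 1| ≤ L ^ 7 / M := by
        have e2 : v - 1 = (p - lam) * (1 - p - lam) / (lam * (1 - lam)) := by
          rw [hv, div_sub_one hA.ne']; ring
        have h3 : |1 - p - lam| ≤ 1 := by
          rw [abs_le]; constructor <;> linarith [h.lam_pos]
        rw [e2, abs_div, abs_mul, abs_of_pos hA, div_le_iff₀ hA]
        calc |p - lam| * |1 - p - lam| ≤ L ^ 6 / M * 1 := by gcongr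
          _ ≤ L ^ 6 / M * (L * (lam * (1 - lam))) := by gcongr; exact h.lam_lower
          _ = _ := by ring
      have h4 := abs_mul_sub_one_le hv1 (hs.abs_rho_mul_sub_le h j k)
        (by linarith [h.pow_div_le (i := 7) (by norm_num), div_nonneg (pow_nonneg hL.le 7) hM.le])
      have h5 : L ^ 7 / M + 2 * (3 * (L ^ 9 / M)) ≤ L ^ 10 / M := by
        have e3 : L ^ 7 / M + 2 * (3 * (L ^ 9 / M)) = (L ^ 7 + 6 * L ^ 9) / M := by ring
        rw [e3]
        refine div_le_div_of_nonneg_right ?_ hM.le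
        have := mul_pow_le_pow (c := 7) hLl (by norm_num) (show 9 + 1 ≤ 10 by norm_num)
        have h79 : L ^ 7 ≤ L ^ 9 := pow_le_pow_right₀ (by linarith) (by norm_num)
        linarith
      rw [e, h1, sub_self, zero_div, zero_add, div_pow, ← sq_abs]
      calc |v * (ρ j * ρ k) - 1| ^ 2 / (n : ℝ) ^ 2 ≤ (L ^ 10 / M) ^ 2 / n ^ 2 := by
            gcongr; exact h4.trans h5
        _ = L ^ 20 / n ^ 3 := by
            rw [div_pow, h.M_sq]; field_simp
  calc _ ≤ ∑ j, ∑ k, ((1 - m j k) / (n : ℝ) ^ 2 + L ^ 20 / n ^ 3) :=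
        Finset.sum_le_sum fun j _ => Finset.sum_le_sum fun k _ => key j k
    _ = ((n : ℝ) + ∑ j, x j) / n ^ 2 + L ^ 20 / n := by
        simp_rw [Finset.sum_add_distrib, ← Finset.sum_div, h.sum_one_sub_m, Finset.sum_add_distrib]
        simp only [Finset.sum_const, Finset.card_univ, Fintype.card_fin, nsmul_eq_mul]
        field_simp
    _ ≤ ((n : ℝ) + 2 * L ^ 5 * n) / n ^ 2 + L ^ 20 / n := by
        gcongr; exact h.x_sum
    _ = (1 + 2 * L ^ 5 + L ^ 20) / n := by field_simp
    _ ≤ L ^ 21 / n := by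
        refine div_le_div_of_nonneg_right ?_ hn.le
        have h1 : 1 ≤ L ^ 20 := one_le_pow₀ (by linarith)
        have h2 : L ^ 5 ≤ L ^ 20 := pow_le_pow_right₀ (by linarith) (by norm_num)
        have := mul_pow_le_pow (c := 4) hLl (by norm_num) (show 20 + 1 ≤ 21 by norm_num)
        linarith

lemma abs_weight_mul_sub_le (h : SaddleData m x d r lam L M) {j k : Fin n} {w w₀ u : ℝ}
    (hw : |w - w₀| ≤ L ^ 6 / M) (hw₀ : |w₀| ≤ 1) (hu : |u - 1| ≤ 7 * (L ^ 9 / M)) :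
    |m j k * w * u - w₀| ≤ L ^ 10 / M + (1 - m j k) := by
  have hM := h.M_pos
  have hL := h.L_pos
  have hLl := h.L_large
  rcases h.m_eq j k with h0 | h1
  · rw [h0, zero_mul, zero_mul, zero_sub, abs_neg]
    have : 0 ≤ L ^ 10 / M := by positivity
    linarith
  · rw [h1, one_mul, sub_self, add_zero]
    refine (abs_mul_sub_le hw hw₀ ?_ hu).trans ?_
    · linarith [h.pow_div_le (i := 6) (by norm_num), div_nonneg (pow_nonneg hL.le 6) hM.le]
    · have e3 : L ^ 6 / M + 2 * (7 * (L ^ 9 / M)) = (L ^ 6 + 14 * L ^ 9) / M := by ring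
      rw [e3]
      refine div_le_div_of_nonneg_right ?_ hM.le
      have := mul_pow_le_pow (c := 15) hLl (by norm_num) (show 9 + 1 ≤ 10 by norm_num)
      have h79 : L ^ 6 ≤ L ^ 9 := pow_le_pow_right₀ (by linarith) (by norm_num)
      linarith

lemma sum_weight_error_le (h : SaddleData m x d r lam L M) (j : Fin n) :
    ∑ k, (L ^ 10 / M + (1 - m j k)) ≤ L ^ 11 * M := by
  have hM := h.M_pos
  have hL := h.L_pos
  have hLl := h.L_large
  rw [Finset.sum_add_distrib, h.sum_one_sub_m]
  simp only [Finset.sum_const, Finset.card_univ, Fintype.card_fin, nsmul_eq_mul]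
  rw [← h.M_sq]
  have e : M ^ 2 * (L ^ 10 / M) = L ^ 10 * M := by field_simp
  have h1 : 1 ≤ M := (one_le_pow₀ (n := 1) (by linarith)).trans (h.pow_le (i := 1) (by norm_num))
  have h2 := mul_pow_le_pow (c := 3) hLl (by norm_num) (show 10 + 1 ≤ 11 by norm_num)
  have h3 : L ^ 3 ≤ L ^ 10 := pow_le_pow_right₀ (by linarith) (by norm_num)
  have h4 : 1 ≤ L ^ 10 := one_le_pow₀ (by linarith)
  have h5 := h.x_le j
  rw [e]
  nlinarith

lemma abs_sum_third_sub_le (hs : IsScaling m r lam L M σ ρ) (h : SaddleData m x d r lam L M)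
    (j : Fin n) (u : Fin n → ℝ) (hu : ∀ k, |u k - 1| ≤ 7 * (L ^ 9 / M)) :
    |∑ k, m j k * thirdCoef (lamJK r j k) * (σ ^ 3 * u k) - n * thirdCoef lam * σ ^ 3|
      ≤ L ^ 14 / n := by
  have hM := h.M_pos
  have hL := h.L_pos
  have hσ := hs.sigma_pos
  have e : ∑ k, m j k * thirdCoef (lamJK r j k) * (σ ^ 3 * u k) - n * thirdCoef lam * σ ^ 3
      = σ ^ 3 * ∑ k, (m j k * thirdCoef (lamJK r j k) * u k - thirdCoef lam) := by
    rw [Finset.sum_sub_distrib, mul_sub, Finset.mul_sum]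
    simp only [Finset.sum_const, Finset.card_univ, Fintype.card_fin, nsmul_eq_mul]
    congr 1
    · exact Finset.sum_congr rfl fun k _ => by ring
    · ring
  rw [e, abs_mul, abs_of_pos (by positivity)]
  have hlam := h.lam_pos.le
  have hlam1 := h.lam_lt_one.le
  calc _ ≤ (L / M) ^ 3 * (L ^ 11 * M) := by
        refine mul_le_mul (pow_le_pow_left₀ hσ.le (hs.sigma_mul_le h) 3) ?_ (abs_nonneg _)
          (by positivity)
        refine (Finset.abs_sum_le_sum_abs _ _).trans ((Finset.sum_le_sum fun k _ => ?_).trans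
          (sum_weight_error_le h j))
        refine abs_weight_mul_sub_le h ?_ (abs_thirdCoef_le_one hlam hlam1) (hu k)
        exact (abs_thirdCoef_sub_le (lamJK_pos h.r_pos j k).le (lamJK_lt_one h.r_pos j k).le
          hlam hlam1).trans (h.abs_lamJK_sub_le j k)
    _ = L ^ 14 / n := by rw [← h.M_sq]; field_simp

lemma abs_pow_four_sub_le {a b K δ : ℝ} (ha : |a| ≤ K) (hb : |b| ≤ K) (hab : |a - b| ≤ δ) :
    |a ^ 4 - b ^ 4| ≤ 4 * K ^ 3 * δ := by
  have hK : 0 ≤ K := (abs_nonneg a).trans ha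
  have hδ : 0 ≤ δ := (abs_nonneg _).trans hab
  have e : a ^ 4 - b ^ 4 = (a - b) * ((a + b) * (a ^ 2 + b ^ 2)) := by ring
  have h1 : |a + b| ≤ 2 * K := (abs_add_le a b).trans (by linarith)
  have h2 : |a ^ 2 + b ^ 2| ≤ 2 * K ^ 2 := by
    rw [abs_of_nonneg (by positivity), ← sq_abs a, ← sq_abs b]
    have := pow_le_pow_left₀ (abs_nonneg a) ha 2
    have := pow_le_pow_left₀ (abs_nonneg b) hb 2
    linarith
  rw [e, abs_mul, abs_mul]
  calc |a - b| * (|a + b| * |a ^ 2 + b ^ 2|) ≤ δ * (2 * K * (2 * K ^ 2)) := by gcongr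
    _ = 4 * K ^ 3 * δ := by ring

lemma abs_fourth_entry_sub_le (hs : IsScaling m r lam L M σ ρ) (h : SaddleData m x d r lam L M)
    {y : Fin n → ℝ} (hy : ∀ j, |y j| ≤ L ^ 2) (j k : Fin n) :
    |m j k * fourthCoef (lamJK r j k) * (ρ j * y j + ρ k * y k) ^ 4
      - fourthCoef lam * (y j + y k) ^ 4| ≤ L ^ 20 / M + L ^ 9 * (1 - m j k) := by
  have hM := h.M_pos
  have hL := h.L_pos
  have hLl := h.L_large
  have hlam := h.lam_pos.le
  have hlam1 := h.lam_lt_one.le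
  have hC0 := abs_fourthCoef_le_one hlam hlam1
  have hsum : |y j + y k| ≤ 4 * L ^ 2 := (abs_add_le _ _).trans (by
    linarith [hy j, hy k, sq_nonneg L])
  have hpow : (y j + y k) ^ 4 ≤ L ^ 9 := by
    calc (y j + y k) ^ 4 = |y j + y k| ^ 4 := (Even.pow_abs (by decide) _).symm
      _ ≤ (4 * L ^ 2) ^ 4 := pow_le_pow_left₀ (abs_nonneg _) hsum 4
      _ = 256 * L ^ 8 := by ring
      _ ≤ L ^ 9 := mul_pow_le_pow hLl (by norm_num) le_rfl
  have hpow0 : 0 ≤ (y j + y k) ^ 4 := Even.pow_nonneg (by decide) _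
  rcases h.m_eq j k with h0 | h1
  · rw [h0, zero_mul, zero_mul, zero_sub, abs_neg, abs_mul, abs_of_nonneg hpow0]
    have h5 : 0 ≤ L ^ 20 / M := by positivity
    calc _ ≤ 1 * L ^ 9 := mul_le_mul hC0 hpow hpow0 zero_le_one
      _ ≤ _ := by linarith
  · rw [h1, one_mul, sub_self, mul_zero, add_zero]
    have hd : ∀ i, |ρ i * y i - y i| ≤ L ^ 11 / M := fun i => by
      rw [← sub_one_mul, abs_mul]
      calc _ ≤ L ^ 9 / M * L ^ 2 :=
            mul_le_mul (hs.abs_rho_sub_le i) (hy i) (abs_nonneg _) (by positivity)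
        _ = L ^ 11 / M := by ring
    have hd1 : L ^ 11 / M ≤ L ^ 2 := by
      have h6 : 1 ≤ L ^ 2 := one_le_pow₀ (by linarith)
      linarith [h.pow_div_le (i := 11) (by norm_num), div_nonneg (pow_nonneg hL.le 11) hM.le]
    have hρy : ∀ i, |ρ i * y i| ≤ 2 * L ^ 2 := fun i => by
      have := abs_sub_abs_le_abs_sub (ρ i * y i) (y i)
      linarith [hd i, hy i]
    have ha : |ρ j * y j + ρ k * y k| ≤ 4 * L ^ 2 := (abs_add_le _ _).trans (by
      linarith [hρy j, hρy k])
    have hab : |ρ j * y j + ρ k * y k - (y j + y k)| ≤ 2 * (L ^ 11 / M) := by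
      rw [show ρ j * y j + ρ k * y k - (y j + y k) = (ρ j * y j - y j) + (ρ k * y k - y k) by ring]
      exact (abs_add_le _ _).trans (by linarith [hd j, hd k])
    have hq := abs_pow_four_sub_le ha hsum hab
    have hp0 := (lamJK_pos h.r_pos j k).le
    have hp1 := (lamJK_lt_one h.r_pos j k).le
    have hC := (abs_fourthCoef_sub_le hp0 hp1 hlam hlam1).trans (h.abs_lamJK_sub_le j k)
    have hC1 := abs_fourthCoef_le_one hp0 hp1
    calc _ = |fourthCoef (lamJK r j k) * ((ρ j * y j + ρ k * y k) ^ 4 - (y j + y k) ^ 4)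
          + (fourthCoef (lamJK r j k) - fourthCoef lam) * (y j + y k) ^ 4| := by ring_nf
      _ ≤ |fourthCoef (lamJK r j k)| * |(ρ j * y j + ρ k * y k) ^ 4 - (y j + y k) ^ 4|
          + |fourthCoef (lamJK r j k) - fourthCoef lam| * (y j + y k) ^ 4 := by
          refine (abs_add_le _ _).trans ?_
          rw [abs_mul, abs_mul, abs_of_nonneg hpow0]
      _ ≤ 1 * (4 * (4 * L ^ 2) ^ 3 * (2 * (L ^ 11 / M))) + L ^ 6 / M * L ^ 9 := by gcongr
      _ = (512 * L ^ 17 + L ^ 15) / M := by ring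
      _ ≤ L ^ 20 / M := by
          refine div_le_div_of_nonneg_right ?_ hM.le
          have h2 := mul_pow_le_pow (c := 513) hLl (by norm_num) (show 17 + 1 ≤ 20 by norm_num)
          have h3 : L ^ 15 ≤ L ^ 17 := pow_le_pow_right₀ (by linarith) (by norm_num)
          linarith

lemma half_sum_sum_add_pow_four {n : ℕ} (y : Fin n → ℝ) :
    1 / 2 * ∑ j, ∑ k, (y j + y k) ^ 4
      = n * ∑ j, y j ^ 4 + 4 * (∑ j, y j) * ∑ j, y j ^ 3 + 3 * (∑ j, y j ^ 2) ^ 2 := by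
  have e : ∀ j k, (y j + y k) ^ 4 = y j ^ 4 + 4 * (y j ^ 3 * y k) + 6 * (y j ^ 2 * y k ^ 2)
      + 4 * (y j * y k ^ 3) + y k ^ 4 := fun j k => by ring
  simp_rw [e, Finset.sum_add_distrib, ← Finset.mul_sum, ← Finset.sum_mul]
  simp only [Finset.sum_const, Finset.card_univ, Fintype.card_fin, nsmul_eq_mul, ← Finset.mul_sum]
  ring

lemma abs_fourth_sum_sub_le (hs : IsScaling m r lam L M σ ρ) (h : SaddleData m x d r lam L M)
    {y : Fin n → ℝ} (hy : ∀ j, |y j| ≤ L ^ 2) :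
    |1 / 2 * ∑ j, ∑ k, m j k * fourthCoef (lamJK r j k)
        * ((σ * ρ j) * y j + (σ * ρ k) * y k) ^ 4
      - fourthCoef lam / (lam * (1 - lam)) ^ 2 * ((∑ j, y j ^ 4) / n
        + 4 * (∑ j, y j) * (∑ j, y j ^ 3) / n ^ 2 + 3 * (∑ j, y j ^ 2) ^ 2 / n ^ 2)|
      ≤ L ^ 25 / M := by
  have hM := h.M_pos
  have hL := h.L_pos
  have hLl := h.L_large
  have hn := h.n_pos
  have hA := h.lam_mul_pos
  have hσ0 := hs.sigma_pos
  have hσ : σ ^ 4 = 1 / ((lam * (1 - lam)) ^ 2 * n ^ 2) := by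
    rw [eq_div_iff (by positivity)]
    calc _ = (lam * (1 - lam) * n * σ ^ 2) ^ 2 := by ring
      _ = 1 := by rw [hs.sigma_sq, one_pow]
  have e1 : fourthCoef lam / (lam * (1 - lam)) ^ 2 * ((∑ j, y j ^ 4) / n
        + 4 * (∑ j, y j) * (∑ j, y j ^ 3) / n ^ 2 + 3 * (∑ j, y j ^ 2) ^ 2 / n ^ 2)
      = 1 / 2 * σ ^ 4 * ∑ j, ∑ k, fourthCoef lam * (y j + y k) ^ 4 := by
    simp_rw [← Finset.mul_sum]
    rw [show 1 / 2 * σ ^ 4 * (fourthCoef lam * ∑ j, ∑ k, (y j + y k) ^ 4)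
      = σ ^ 4 * fourthCoef lam * (1 / 2 * ∑ j, ∑ k, (y j + y k) ^ 4) by ring,
      half_sum_sum_add_pow_four, hσ]
    have := hA.ne'
    generalize fourthCoef lam = C
    generalize lam * (1 - lam) = B at *
    field_simp
  have e2 : 1 / 2 * ∑ j, ∑ k, m j k * fourthCoef (lamJK r j k)
        * ((σ * ρ j) * y j + (σ * ρ k) * y k) ^ 4
      = 1 / 2 * σ ^ 4 * ∑ j, ∑ k, m j k * fourthCoef (lamJK r j k)
        * (ρ j * y j + ρ k * y k) ^ 4 := by
    rw [mul_assoc, Finset.mul_sum _ _ (σ ^ 4)]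
    simp_rw [Finset.mul_sum _ _ (σ ^ 4)]
    congr 1
    exact Finset.sum_congr rfl fun j _ => Finset.sum_congr rfl fun k _ => by ring
  rw [e1, e2, ← mul_sub, ← Finset.sum_sub_distrib, abs_mul, abs_of_pos (by positivity)]
  simp_rw [← Finset.sum_sub_distrib]
  have hσ4 : σ ^ 4 ≤ (L / M) ^ 4 := pow_le_pow_left₀ hσ0.le (hs.sigma_mul_le h) 4
  have hsum : ∑ j, ∑ k, (L ^ 20 / M + L ^ 9 * (1 - m j k)) ≤ L ^ 21 * M ^ 3 := by
    simp_rw [Finset.sum_add_distrib, ← Finset.mul_sum, h.sum_one_sub_m, Finset.sum_add_distrib]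
    simp only [Finset.sum_const, Finset.card_univ, Fintype.card_fin, nsmul_eq_mul]
    have hx := h.x_sum
    have h1 : 1 ≤ M := (one_le_pow₀ (n := 1) (by linarith)).trans (h.pow_le (i := 1) (by norm_num))
    have h2 := mul_pow_le_pow (c := 4) hLl (by norm_num) (show 20 + 1 ≤ 21 by norm_num)
    have h3 : L ^ 14 ≤ L ^ 20 := pow_le_pow_right₀ (by linarith) (by norm_num)
    have h4 : L ^ 9 ≤ L ^ 20 := pow_le_pow_right₀ (by linarith) (by norm_num)
    have hM23 : M ^ 2 ≤ M ^ 3 := pow_le_pow_right₀ h1 (by norm_num)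
    calc (n : ℝ) * (n * (L ^ 20 / M)) + L ^ 9 * (n * 1 + ∑ j, x j)
        ≤ (n : ℝ) * (n * (L ^ 20 / M)) + L ^ 9 * (n * 1 + 2 * L ^ 5 * n) := by gcongr
      _ = L ^ 20 * M ^ 3 + (L ^ 9 + 2 * L ^ 14) * M ^ 2 := by
          rw [← h.M_sq]; field_simp
      _ ≤ L ^ 20 * M ^ 3 + (L ^ 9 + 2 * L ^ 14) * M ^ 3 := by gcongr
      _ = (L ^ 20 + L ^ 9 + 2 * L ^ 14) * M ^ 3 := by ring
      _ ≤ L ^ 21 * M ^ 3 := by gcongr; linarith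
  calc _ ≤ 1 / 2 * (L / M) ^ 4 * (L ^ 21 * M ^ 3) := by
        refine mul_le_mul (by linarith) ?_ (abs_nonneg _) (by positivity)
        refine (Finset.abs_sum_le_sum_abs _ _).trans ((Finset.sum_le_sum fun j _ => ?_).trans hsum)
        exact (Finset.abs_sum_le_sum_abs _ _).trans
          (Finset.sum_le_sum fun k _ => hs.abs_fourth_entry_sub_le h hy j k)
    _ = 1 / 2 * (L ^ 25 / M) := by field_simp
    _ ≤ L ^ 25 / M := by
        have : 0 ≤ L ^ 25 / M := by positivity
        linarith

end IsScaling

open Polynomial in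
lemma integrable_pow_mul_pow {n : ℕ} (a b : ℕ) (j k : Fin n) :
    Integrable (fun y : Fin n → ℝ => y j ^ a * y k ^ b) (stdPi n) := by
  have h := integrable_prod_eval (n := n)
    (fun i => (if i = j then X ^ a else 1) * (if i = k then X ^ b else 1))
  refine h.congr (ae_of_all _ fun y => ?_)
  simp only [eval_mul, Finset.prod_mul_distrib]
  congr 1
  · rw [Finset.prod_eq_single j] <;> simp +contextual
  · rw [Finset.prod_eq_single k] <;> simp +contextual

lemma integrable_abs_cubic_sub {n : ℕ} (P : Fin n → ℝ) (B : Fin n → Fin n → ℝ) (τ : ℝ) :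
    Integrable (fun y : Fin n → ℝ => |(∑ j, P j * y j ^ 3 + 3 * ∑ j, ∑ k, B j k * (y j ^ 2 * y k))
      - τ * ∑ j, (y j ^ 3 + 3 * y j)|) (stdPi n) := by
  have h21 : ∀ j k, Integrable (fun y : Fin n → ℝ => y j ^ 2 * y k) (stdPi n) := fun j k => by
    simpa using integrable_pow_mul_pow 2 1 j k
  have h3 : ∀ j, Integrable (fun y : Fin n → ℝ => y j ^ 3) (stdPi n) := fun j => by
    simpa using integrable_pow_mul_pow 3 0 j j
  have h1 : ∀ j, Integrable (fun y : Fin n → ℝ => y j) (stdPi n) := fun j => by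
    simpa using integrable_pow_mul_pow 1 0 j j
  have i1 : Integrable (fun y : Fin n → ℝ => ∑ j, P j * y j ^ 3) (stdPi n) :=
    integrable_finsetSum _ fun j _ => (h3 j).const_mul _
  have i2 : Integrable (fun y : Fin n → ℝ => 3 * ∑ j, ∑ k, B j k * (y j ^ 2 * y k)) (stdPi n) :=
    (integrable_finsetSum _ fun j _ => integrable_finsetSum _ fun k _ =>
      (h21 j k).const_mul _).const_mul _
  have i3 : Integrable (fun y : Fin n → ℝ => τ * ∑ j, (y j ^ 3 + 3 * y j)) (stdPi n) :=
    (integrable_finsetSum _ fun j _ => (h3 j).add ((h1 j).const_mul _)).const_mul _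
  exact ((i1.add i2).sub i3).abs

namespace IsScaling

variable {n : ℕ} {m : Fin n → Fin n → ℝ} {x d r : Fin n → ℝ} {lam L M σ : ℝ} {ρ : Fin n → ℝ}

lemma integral_abs_third_sub_le (hs : IsScaling m r lam L M σ ρ) (h : SaddleData m x d r lam L M) :
    ∫ y, |(∑ j, (∑ k, m j k * thirdCoef (lamJK r j k)) * (σ * ρ j) ^ 3 * y j ^ 3
        + 3 * ∑ j, ∑ k, m j k * thirdCoef (lamJK r j k) * ((σ * ρ j) ^ 2 * (σ * ρ k))
          * (y j ^ 2 * y k))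
        - n * thirdCoef lam * σ ^ 3 * ∑ j, (y j ^ 3 + 3 * y j)| ∂(stdPi n) ≤ L ^ 15 / M := by
  have hM := h.M_pos
  have hL := h.L_pos
  have hLl := h.L_large
  have hn := h.n_pos
  refine (integral_abs_cubic_sub_le (fun j => (∑ k, m j k * thirdCoef (lamJK r j k))
    * (σ * ρ j) ^ 3) (fun j k => m j k * thirdCoef (lamJK r j k) * ((σ * ρ j) ^ 2 * (σ * ρ k)))
    (n * thirdCoef lam * σ ^ 3) (fun j => by simp [h.m_diag])).trans ?_
  set τ := n * thirdCoef lam * σ ^ 3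
  have sum_le : ∀ c : Fin n → ℝ, (∀ j, |c j| ≤ L ^ 14 / n) →
      ∑ j, c j ^ 2 ≤ (L ^ 14 / M) ^ 2 := fun c hc => by
    calc ∑ j, c j ^ 2 ≤ ∑ _j : Fin n, (L ^ 14 / n) ^ 2 := by
          refine Finset.sum_le_sum fun j _ => ?_
          rw [← sq_abs]
          exact pow_le_pow_left₀ (abs_nonneg _) (hc j) 2
      _ = (L ^ 14 / M) ^ 2 := by
          simp only [Finset.sum_const, Finset.card_univ, Fintype.card_fin, nsmul_eq_mul]
          rw [div_pow _ M, h.M_sq]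
          field_simp
  have b1 := sum_le (fun j => (∑ k, m j k * thirdCoef (lamJK r j k)) * (σ * ρ j) ^ 3 - τ)
    fun j => by
      convert hs.abs_sum_third_sub_le h j (fun _ => ρ j ^ 2 * ρ j)
        (fun _ => hs.abs_rho_sq_mul_sub_le h j j) using 3
      rw [Finset.sum_mul]
      exact Finset.sum_congr rfl fun k _ => by ring
  have b2 := sum_le (fun k => ∑ j, m j k * thirdCoef (lamJK r j k) * ((σ * ρ j) ^ 2 * (σ * ρ k))
    - τ) fun k => by
      convert hs.abs_sum_third_sub_le h k (fun j => ρ j ^ 2 * ρ k)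
        (fun j => hs.abs_rho_sq_mul_sub_le h j k) using 3
      exact Finset.sum_congr rfl fun j _ => by rw [h.m_symm, lamJK_comm]; ring
  have b3 : ∑ j, ∑ k, (m j k * thirdCoef (lamJK r j k) * ((σ * ρ j) ^ 2 * (σ * ρ k))) ^ 2
      ≤ (L ^ 14 / M) ^ 2 := by
    calc _ ≤ ∑ _j : Fin n, ∑ _k : Fin n, ((L / M) ^ 3) ^ 2 := by
          refine Finset.sum_le_sum fun j _ => Finset.sum_le_sum fun k _ => ?_
          have hj := hs.scale_le h j
          have hk := hs.scale_le h k
          have hj0 := mul_pos hs.sigma_pos (hs.rho_pos j)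
          have hk0 := mul_pos hs.sigma_pos (hs.rho_pos k)
          rw [← sq_abs]
          refine pow_le_pow_left₀ (abs_nonneg _) ?_ 2
          rw [abs_mul, abs_mul, abs_of_nonneg (h.m_nonneg j k),
            abs_of_pos (show 0 < (σ * ρ j) ^ 2 * (σ * ρ k) by positivity)]
          calc _ ≤ 1 * 1 * ((L / M) ^ 2 * (L / M)) := by
                have := h.m_le_one j k
                have := abs_thirdCoef_le_one (lamJK_pos h.r_pos j k).le
                  (lamJK_lt_one h.r_pos j k).le
                gcongr
            _ = _ := by ring
      _ = (L ^ 3 / M) ^ 2 := by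
          simp only [Finset.sum_const, Finset.card_univ, Fintype.card_fin, nsmul_eq_mul]
          rw [← h.M_sq]; field_simp
      _ ≤ _ := by
          gcongr
          · linarith
          · norm_num
  have h14 : 0 ≤ L ^ 14 / M := by positivity
  have c1 : √(15 * ∑ j, ((∑ k, m j k * thirdCoef (lamJK r j k)) * (σ * ρ j) ^ 3 - τ) ^ 2)
      ≤ 4 * (L ^ 14 / M) := by
    rw [Real.sqrt_le_iff]; exact ⟨by positivity, by nlinarith⟩
  have c2 : √(∑ k, (∑ j, m j k * thirdCoef (lamJK r j k) * ((σ * ρ j) ^ 2 * (σ * ρ k)) - τ) ^ 2)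
      ≤ L ^ 14 / M := by
    rw [Real.sqrt_le_iff]; exact ⟨by positivity, b2⟩
  have c3 : √(2 * ∑ j, ∑ k, (m j k * thirdCoef (lamJK r j k) * ((σ * ρ j) ^ 2 * (σ * ρ k))) ^ 2)
      ≤ 2 * (L ^ 14 / M) := by
    rw [Real.sqrt_le_iff]; exact ⟨by positivity, by nlinarith⟩
  calc _ ≤ 13 * (L ^ 14 / M) := by linarith
    _ = 13 * L ^ 14 / M := by ring
    _ ≤ L ^ 15 / M := div_le_div_of_nonneg_right (mul_pow_le_pow hLl (by norm_num) le_rfl) hM.le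

end IsScaling

lemma measurable_pairIntegrand {n : ℕ} (m : Fin n → Fin n → ℝ) (d r : Fin n → ℝ) :
    Measurable (pairIntegrand m d r) := by
  refine Continuous.measurable ?_
  unfold pairIntegrand
  refine Continuous.mul (continuous_finsetProd _ fun j _ => continuous_finsetProd _ fun k _ => ?_)
    (by fun_prop)
  split_ifs
  · fun_prop
  · fun_prop

namespace IsScaling

variable {n : ℕ} {m : Fin n → Fin n → ℝ} {x d r : Fin n → ℝ} {lam L M σ : ℝ} {ρ : Fin n → ℝ}

lemma quadratic_eq (hs : IsScaling m r lam L M σ ρ) (y : Fin n → ℝ) :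
    (∑ j, y j ^ 2) / 2 - (∑ j, curv m r j * ((σ * ρ j) * y j) ^ 2
        + ∑ j, ∑ k, m j k * pairVar r j k * (((σ * ρ j) * y j) * ((σ * ρ k) * y k)))
      = -(1 / 2) * ∑ j, ∑ k, (2 * (m j k * pairVar r j k) * ((σ * ρ j) * (σ * ρ k)) - 1 / n)
          * (y j * y k) - (∑ j, y j) ^ 2 / (2 * n) := by
  have e1 : ∑ j, curv m r j * ((σ * ρ j) * y j) ^ 2 = (∑ j, y j ^ 2) / 2 := by
    rw [Finset.sum_div]
    refine Finset.sum_congr rfl fun j _ => ?_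
    linear_combination (y j ^ 2 / 2) * hs.curv_mul j
  have e2 : (∑ j, y j) ^ 2 = ∑ j, ∑ k, y j * y k := by
    rw [sq, Finset.sum_mul_sum]
  have e3 : ∑ j, ∑ k, (2 * (m j k * pairVar r j k) * ((σ * ρ j) * (σ * ρ k)) - 1 / (n : ℝ))
      * (y j * y k)
      = 2 * ∑ j, ∑ k, m j k * pairVar r j k * (((σ * ρ j) * y j) * ((σ * ρ k) * y k))
        - 1 / n * ∑ j, ∑ k, y j * y k := by
    simp only [Finset.mul_sum, ← Finset.sum_sub_distrib]
    exact Finset.sum_congr rfl fun j _ => Finset.sum_congr rfl fun k _ => by ring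
  rw [e1, e2, e3]
  ring

lemma cubic_eq (y : Fin n → ℝ) :
    ∑ j, (∑ k, m j k * thirdCoef (lamJK r j k)) * ((σ * ρ j) * y j) ^ 3
      + 3 * ∑ j, ∑ k, m j k * thirdCoef (lamJK r j k)
        * (((σ * ρ j) * y j) ^ 2 * ((σ * ρ k) * y k))
    = ∑ j, (∑ k, m j k * thirdCoef (lamJK r j k)) * (σ * ρ j) ^ 3 * y j ^ 3
      + 3 * ∑ j, ∑ k, m j k * thirdCoef (lamJK r j k) * ((σ * ρ j) ^ 2 * (σ * ρ k))
          * (y j ^ 2 * y k) := by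
  congr 1
  · exact Finset.sum_congr rfl fun j _ => by ring
  · congr 1
    exact Finset.sum_congr rfl fun j _ => Finset.sum_congr rfl fun k _ => by ring

lemma trace_eq (h : SaddleData m x d r lam L M) :
    ∑ j, (2 * (m j j * pairVar r j j) * ((σ * ρ j) * (σ * ρ j)) - 1 / (n : ℝ)) = -1 := by
  have hn := h.n_pos
  simp_rw [h.m_diag, zero_mul, mul_zero, zero_mul, zero_sub]
  simp only [Finset.sum_const, Finset.card_univ, Fintype.card_fin, nsmul_eq_mul]
  field_simp

lemma cube_sq_eq (hs : IsScaling m r lam L M σ ρ) (h : SaddleData m x d r lam L M) :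
    (n * thirdCoef lam * σ ^ 3 * M) ^ 2
      = (1 - 4 * (lam * (1 - lam))) / (36 * (lam * (1 - lam))) := by
  have hA := h.lam_mul_pos
  rw [eq_div_iff (by positivity)]
  have h1 := hs.sigma_sq
  have h2 := h.M_sq
  have e : (n * thirdCoef lam * σ ^ 3 * M) ^ 2 * (36 * (lam * (1 - lam)))
      = (1 - 4 * (lam * (1 - lam))) * (lam * (1 - lam) * n * σ ^ 2) ^ 3 * (M ^ 2 / n) := by
    have := h.n_pos
    simp only [thirdCoef]; field_simp; ring
  rw [e, h1, h2, div_self h.n_pos.ne']; ring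

lemma fourthCoef_div_eq (h : SaddleData m x d r lam L M) :
    fourthCoef lam / (lam * (1 - lam)) ^ 2
      = (1 - 6 * (lam * (1 - lam))) / (24 * (lam * (1 - lam))) := by
  have hA := h.lam_mul_pos
  rw [div_eq_div_iff (by positivity) (by positivity)]
  simp only [fourthCoef]; ring

end IsScaling

lemma SaddleData.exists_norm_setIntegral_pairIntegrand_sub_le :
    ∃ K : ℝ, 0 < K ∧ ∀ {n : ℕ} {m : Fin n → Fin n → ℝ} {x d r : Fin n → ℝ} {lam L M σ : ℝ}
      {ρ : Fin n → ℝ}, SaddleData m x d r lam L M → IsScaling m r lam L M σ ρ → K ≤ L →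
      n ≤ Real.exp L →
      ‖(∫ θ in {θ : Fin n → ℝ | ∀ j, |θ j| ≤ L ^ 2 / M}, pairIntegrand m d r θ)
        - ((∏ j, (√(2 * Real.pi) * (σ * ρ j))) * (Real.exp (1 / 2
            + 6 * ((1 - 6 * (lam * (1 - lam))) / (24 * (lam * (1 - lam)))))
            * ((√2)⁻¹ * Real.exp (-12 * ((1 - 4 * (lam * (1 - lam)))
              / (36 * (lam * (1 - lam))))))) : ℝ)‖
      ≤ (∏ j, (√(2 * Real.pi) * (σ * ρ j))) * (Real.exp (1 / 2
            + 6 * ((1 - 6 * (lam * (1 - lam))) / (24 * (lam * (1 - lam)))))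
            * (L ^ 28 / M)) := by
  obtain ⟨C, hC, hG⟩ := exists_norm_setIntegral_exp_sub_le
  obtain ⟨c, hc, hT⟩ := SaddleData.exists_pairIntegrand_eq_exp
  refine ⟨C + c, by positivity, ?_⟩
  intro n m x d r lam L M σ ρ h hs hK hnL
  have hM := h.M_pos
  have hL := h.L_pos
  have hLl := h.L_large
  have hn := h.n_pos
  have hA := h.lam_mul_pos
  have hsp : ∀ j, 0 < σ * ρ j := fun j => mul_pos hs.sigma_pos (hs.rho_pos j)
  have hPpos : 0 < ∏ j, (√(2 * Real.pi) * (σ * ρ j)) :=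
    Finset.prod_pos fun j _ => mul_pos (by positivity) (hsp j)
  have h1L : 1 ≤ L := by linarith
  have hM1 : 1 ≤ M := (one_le_pow₀ (n := 1) h1L).trans (h.pow_le (i := 1) (by norm_num))
  have hbox : L ^ 2 / M ≤ 1 / 4 := by linarith [h.pow_div_le (i := 2) (by norm_num)]
  have hn2 : (n : ℝ) ^ 2 = M ^ 4 := by rw [← h.M_sq]; ring
  have hℓL : ∀ j, L ≤ L ^ 2 / M / (σ * ρ j) := fun j => by
    rw [le_div_iff₀ (hsp j)]
    calc L * (σ * ρ j) ≤ L * (L / M) := by gcongr; exact hs.scale_le h j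
      _ = L ^ 2 / M := by ring
  have hℓU : ∀ j, L ^ 2 / M / (σ * ρ j) ≤ L ^ 2 := fun j => by
    rw [div_le_iff₀ (hsp j)]
    calc L ^ 2 / M = L ^ 2 * (1 / M) := by ring
      _ ≤ L ^ 2 * (σ * ρ j) := by gcongr; exact hs.le_scale h j
  set q := lam * (1 - lam) with hq
  set κ := n * thirdCoef lam * σ ^ 3 * M with hκ
  set ω := fourthCoef lam / q ^ 2 with hω
  have hκ2 : κ ^ 2 = (1 - 4 * q) / (36 * q) := hs.cube_sq_eq h
  have hωq : ω = (1 - 6 * q) / (24 * q) := IsScaling.fourthCoef_div_eq h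
  have hκM : κ / M = n * thirdCoef lam * σ ^ 3 := by rw [hκ]; field_simp
  have hqi : 1 / q ≤ L := by rw [div_le_iff₀ hA]; exact h.lam_lower
  have hκL : κ ^ 2 ≤ L := by
    rw [hκ2]
    calc (1 - 4 * q) / (36 * q) ≤ 1 / q := by
          rw [div_le_div_iff₀ (by positivity) hA]; nlinarith
      _ ≤ L := hqi
  have hωL : |ω| ≤ L := by
    refine le_trans ?_ hqi
    rw [hωq, abs_div, abs_of_pos (show 0 < 24 * q by positivity),
      div_le_div_iff₀ (by positivity) hA]
    have : |1 - 6 * q| ≤ 1 + 6 * q := by rw [abs_le]; constructor <;> linarith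
    have hq4 : q ≤ 1 / 4 := mul_one_sub_le_quarter lam
    nlinarith
  choose H hH using fun (θ : {θ : Fin n → ℝ // ∀ j, |θ j| ≤ L ^ 2 / M}) =>
    hT h (L ^ 2 / M) hbox θ.1 θ.2
  set Q : (Fin n → ℝ) → ℝ := fun y =>
    1 / 2 * ∑ j, ∑ k, m j k * fourthCoef (lamJK r j k) * ((σ * ρ j) * y j + (σ * ρ k) * y k) ^ 4
      - ω * ((∑ j, y j ^ 4) / n + 4 * (∑ j, y j) * (∑ j, y j ^ 3) / n ^ 2
            + 3 * (∑ j, y j ^ 2) ^ 2 / n ^ 2) with hQ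
  have hmem : ∀ y : Fin n → ℝ, (∀ j, |y j| ≤ L ^ 2 / M / (σ * ρ j)) →
      ∀ j, |(σ * ρ j) * y j| ≤ L ^ 2 / M := fun y hy j => by
    rw [abs_mul, abs_of_pos (hsp j), mul_comm, ← le_div_iff₀ (hsp j)]
    exact hy j
  have key := hG n (fun j k => 2 * (m j k * pairVar r j k) * ((σ * ρ j) * (σ * ρ k)) - 1 / n)
    (fun j => L ^ 2 / M / (σ * ρ j)) L M (M / L ^ 20) ω κ (L ^ 26 / M) (L ^ 15 / M)
    (fun y => ∑ j, (∑ k, m j k * thirdCoef (lamJK r j k)) * (σ * ρ j) ^ 3 * y j ^ 3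
      + 3 * ∑ j, ∑ k, m j k * thirdCoef (lamJK r j k) * ((σ * ρ j) ^ 2 * (σ * ρ k))
          * (y j ^ 2 * y k))
    (fun y => ((Real.exp ((∑ j, y j ^ 2) / 2) : ℝ) : ℂ)
      * pairIntegrand m d r (fun j => (σ * ρ j) * y j))
    (fun y => (if hy : ∀ j, |(σ * ρ j) * y j| ≤ L ^ 2 / M then H ⟨_, hy⟩ else 0)
      + ((Q y : ℝ) : ℂ))
    (fun j k => by
      rw [h.m_symm j k, mul_comm (σ * ρ j)]
      simp only [pairVar, lamJK_comm r j k])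
    (IsScaling.trace_eq h) (by linarith) hM1 h.M_sq
    (by
      rw [le_div_iff₀ (by positivity)]
      exact (mul_pow_le_pow hLl (by norm_num) (show 20 + 1 ≤ 21 by norm_num)).trans
        (h.pow_le (by norm_num)))
    (by
      calc _ ≤ 64 * (M / L ^ 20) ^ 2 * (L ^ 21 / n) := by
            gcongr; exact hs.sum_sum_sq_le h
        _ = 64 / L ^ 19 := by rw [← h.M_sq]; field_simp
        _ ≤ 1 := by
            rw [div_le_one (by positivity)]
            calc (64 : ℝ) = 64 * L ^ 0 := by ring
              _ ≤ L ^ 19 := mul_pow_le_pow hLl (by norm_num) (by norm_num))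
    (by
      rw [← h.M_sq, ← sq_abs]
      refine pow_le_pow_left₀ (abs_nonneg _) ?_ 2
      rw [abs_mul, abs_mul, abs_of_pos (show 0 < 100 * (M / L ^ 20) by positivity),
        abs_of_pos (show 0 < L ^ 8 by positivity)]
      calc 100 * (M / L ^ 20) * |ω| * L ^ 8 ≤ 100 * (M / L ^ 20) * L * L ^ 8 := by gcongr
        _ = 100 * L ^ 9 * M / L ^ 20 := by ring
        _ ≤ L ^ 20 * M / L ^ 20 := by
            gcongr; exact mul_pow_le_pow hLl (by norm_num) (by norm_num)
        _ = M := by field_simp)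
    hℓL hℓU
    (by rw [hκM]; exact integrable_abs_cubic_sub _ _ _)
    (by rw [hκM]; exact hs.integral_abs_third_sub_le h)
    (by linarith [h.pow_div_le (i := 26) (by norm_num),
      div_nonneg (pow_nonneg hL.le 26) hM.le])
    (by
      refine Measurable.mul (by fun_prop) ((measurable_pairIntegrand m d r).comp ?_)
      fun_prop)
    (fun y hy => by
      have hθ := hmem y hy
      obtain ⟨hH1, hH2⟩ := hH ⟨_, hθ⟩
      have hQy : |Q y| ≤ L ^ 25 / M :=
        hs.abs_fourth_sum_sub_le h fun j => (hy j).trans (hℓU j)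
      rw [dif_pos hθ]
      constructor
      · refine (norm_add_le _ _).trans ?_
        rw [Complex.norm_real, Real.norm_eq_abs]
        calc _ ≤ c * n ^ 2 * (L ^ 2 / M) ^ 5 + L ^ 25 / M := add_le_add hH1 hQy
          _ = (c * L ^ 10 + L ^ 25) / M := by rw [hn2]; field_simp
          _ ≤ L ^ 26 / M := by
              refine div_le_div_of_nonneg_right ?_ hM.le
              have h1 : c * L ^ 10 ≤ L ^ 25 := by
                calc c * L ^ 10 ≤ L * L ^ 10 := by gcongr; linarith
                  _ = L ^ 11 := by ring
                  _ ≤ L ^ 25 := pow_le_pow_right₀ h1L (by norm_num)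
              have := mul_pow_le_pow (c := 2) hLl (by norm_num) (show 25 + 1 ≤ 26 by norm_num)
              linarith
      · rw [hH2, Complex.ofReal_exp, ← Complex.exp_add, IsScaling.cubic_eq,
          ← hs.quadratic_eq y]
        congr 1
        rw [hQ]
        push_cast
        ring)
  rw [setIntegral_box_eq hsp (measurable_pairIntegrand m d r), ← hωq, ← hκ2,
    Complex.ofReal_mul (∏ j, _), ← mul_sub, norm_mul, Complex.norm_real, Real.norm_eq_abs,
    abs_of_pos hPpos]
  refine mul_le_mul_of_nonneg_left (key.trans ?_) hPpos.le
  refine mul_le_mul_of_nonneg_left ?_ (Real.exp_pos _).le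
  have hexp : 2 * (n : ℝ) * Real.exp (-L ^ 2 / 4) ≤ 2 / M := by
    have hMe : M ≤ n := by rw [← h.M_sq]; nlinarith
    rw [le_div_iff₀ hM]
    have h3 : (n : ℝ) * n ≤ Real.exp (L ^ 2 / 4) := by
      calc (n : ℝ) * n ≤ Real.exp L * Real.exp L := by gcongr
        _ = Real.exp (2 * L) := by rw [← Real.exp_add]; ring_nf
        _ ≤ Real.exp (L ^ 2 / 4) := Real.exp_le_exp.2 (by nlinarith)
    calc 2 * (n : ℝ) * Real.exp (-L ^ 2 / 4) * M
        ≤ 2 * (n : ℝ) * Real.exp (-L ^ 2 / 4) * n := by gcongr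
      _ = 2 * (n * n) * Real.exp (-L ^ 2 / 4) := by ring
      _ ≤ 2 * Real.exp (L ^ 2 / 4) * Real.exp (-L ^ 2 / 4) := by gcongr
      _ = 2 := by rw [mul_assoc, ← Real.exp_add]; ring_nf; simp
  have hκ4 : κ ^ 4 ≤ L ^ 2 := by
    calc κ ^ 4 = (κ ^ 2) ^ 2 := by ring
      _ ≤ L ^ 2 := pow_le_pow_left₀ (sq_nonneg _) hκL 2
  calc _ ≤ C * (1 + L ^ 2) / M + 60 / (M / L ^ 20) + 2 * (L ^ 26 / M) + L ^ 15 / M + 2 / M := by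
        gcongr
    _ = (C * (1 + L ^ 2) + 60 * L ^ 20 + 2 * L ^ 26 + L ^ 15 + 2) / M := by field_simp
    _ ≤ L ^ 28 / M := by
        refine div_le_div_of_nonneg_right ?_ hM.le
        have e2 : L ^ 2 ≤ L ^ 26 := pow_le_pow_right₀ h1L (by norm_num)
        have e20 : L ^ 20 ≤ L ^ 26 := pow_le_pow_right₀ h1L (by norm_num)
        have e15 : L ^ 15 ≤ L ^ 26 := pow_le_pow_right₀ h1L (by norm_num)
        have e0 : 1 ≤ L ^ 26 := one_le_pow₀ h1L
        have e1 : C * (1 + L ^ 2) ≤ L ^ 26 := by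
          calc C * (1 + L ^ 2) ≤ L * (L ^ 2 + L ^ 2) := by
                gcongr
                · linarith
                · exact one_le_pow₀ h1L
            _ = 2 * L ^ 3 := by ring
            _ ≤ L ^ 26 := mul_pow_le_pow hLl (by norm_num) (by norm_num)
        have := mul_pow_le_pow (c := 70) hLl (by norm_num) (show 26 + 1 ≤ 28 by norm_num)
        linarith

lemma abs_log_one_add_le {t : ℝ} (ht : |t| ≤ 1 / 2) : |Real.log (1 + t)| ≤ 2 * |t| := by
  obtain ⟨h1, h2⟩ := abs_le.1 ht
  have hpos : 0 < 1 + t := by linarith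
  rw [abs_le]
  constructor
  · refine le_trans ?_ (Real.one_sub_inv_le_log_of_pos hpos)
    have e : 1 - (1 + t)⁻¹ = t / (1 + t) := by field_simp; ring
    rw [e, le_div_iff₀ hpos]
    cases abs_cases t <;> nlinarith
  · linarith [Real.log_le_sub_one_of_pos hpos, le_abs_self t, abs_nonneg t]

lemma exists_eq_mul_exp_of_norm_sub_le {z : ℂ} {c e : ℝ} (hz : (starRingEnd ℂ) z = z) (hc : 0 < c)
    (he : e ≤ 1 / 2) (h : ‖z - (c : ℂ)‖ ≤ c * e) :
    ∃ u : ℝ, |u| ≤ 2 * e ∧ z = ((c * Real.exp u : ℝ) : ℂ) := by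
  have hre := Complex.conj_eq_iff_re.1 hz
  rw [← hre, ← Complex.ofReal_sub, Complex.norm_real, Real.norm_eq_abs] at h
  have ht : |z.re / c - 1| ≤ e := by
    rw [div_sub_one hc.ne', abs_div, abs_of_pos hc, div_le_iff₀ hc]
    linarith
  refine ⟨Real.log (1 + (z.re / c - 1)), (abs_log_one_add_le (ht.trans he)).trans (by linarith), ?_⟩
  rw [Real.exp_log (by linarith [(abs_le.1 (ht.trans he)).1]), add_sub_cancel,
    mul_div_cancel₀ _ hc.ne', hre]

lemma conj_pairIntegrand {n : ℕ} (m : Fin n → Fin n → ℝ) (d r θ : Fin n → ℝ) :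
    (starRingEnd ℂ) (pairIntegrand m d r θ) = pairIntegrand m d r (-θ) := by
  unfold pairIntegrand
  rw [map_mul, map_prod, ← Complex.exp_conj]
  congr 1
  · refine Finset.prod_congr rfl fun j _ => ?_
    rw [map_prod]
    refine Finset.prod_congr rfl fun k _ => ?_
    split_ifs
    · simp only [map_add, map_one, map_mul, map_sub, Complex.conj_ofReal, ← Complex.exp_conj,
        Complex.conj_I, Pi.neg_apply, Complex.ofReal_neg]
      ring_nf
    · exact map_one _
  · simp only [map_mul, map_neg, Complex.conj_ofReal, Complex.conj_I, Pi.neg_apply, mul_neg,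
      Finset.sum_neg_distrib, Complex.ofReal_neg, neg_neg, neg_mul]

lemma conj_setIntegral_pairIntegrand {n : ℕ} (m : Fin n → Fin n → ℝ) (d r : Fin n → ℝ) (R : ℝ) :
    (starRingEnd ℂ) (∫ θ in {θ : Fin n → ℝ | ∀ j, |θ j| ≤ R}, pairIntegrand m d r θ)
      = ∫ θ in {θ : Fin n → ℝ | ∀ j, |θ j| ≤ R}, pairIntegrand m d r θ := by
  rw [← integral_conj]
  simp_rw [conj_pairIntegrand]
  have h := (Measure.measurePreserving_neg (volume : Measure (Fin n → ℝ))).setIntegral_preimage_emb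
    (MeasurableEquiv.neg (Fin n → ℝ)).measurableEmbedding (pairIntegrand m d r)
    {θ | ∀ j, |θ j| ≤ R}
  simpa using h

lemma IsScaling.curv_pos {n : ℕ} {m : Fin n → Fin n → ℝ} {r ρ : Fin n → ℝ}
    {lam L M σ : ℝ} (hs : IsScaling m r lam L M σ ρ) (j : Fin n) : 0 < curv m r j := by
  have := mul_pos hs.sigma_pos (hs.rho_pos j)
  by_contra hh
  push Not at hh
  nlinarith [hs.curv_mul j, pow_pos this 2]

lemma IsScaling.prod_eq {n : ℕ} {m : Fin n → Fin n → ℝ} {r ρ : Fin n → ℝ} {lam L M σ A : ℝ}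
    (hs : IsScaling m r lam L M σ ρ) (hA : 0 < A) (hn : (0 : ℝ) < n) :
    ∏ j, (√(2 * Real.pi) * (σ * ρ j)) = (Real.pi / (A * n)) ^ ((n : ℝ) / 2)
      * Real.exp (-(1 / 2) * ∑ j, Real.log (curv m r j / (A * n))) := by
  have hπ := Real.pi_pos
  have e : ∀ j, √(2 * Real.pi) * (σ * ρ j) = Real.exp (Real.log (Real.pi / (A * n)) / 2
      - 1 / 2 * Real.log (curv m r j / (A * n))) := fun j => by
    have hc := hs.curv_pos j
    have hsp := mul_pos hs.sigma_pos (hs.rho_pos j)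
    have e1 : √(2 * Real.pi) * (σ * ρ j) = √(Real.pi / curv m r j) := by
      rw [eq_comm, Real.sqrt_eq_iff_mul_self_eq (by positivity) (by positivity),
        div_eq_iff hc.ne', eq_comm]
      calc √(2 * Real.pi) * (σ * ρ j) * (√(2 * Real.pi) * (σ * ρ j)) * curv m r j
          = √(2 * Real.pi) ^ 2 * (σ * ρ j) ^ 2 * curv m r j := by ring
        _ = Real.pi * (2 * curv m r j * (σ * ρ j) ^ 2) := by
            rw [Real.sq_sqrt (by positivity)]; ring
        _ = Real.pi := by rw [hs.curv_mul, mul_one]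
    have e2 : Real.log (Real.pi / (A * n)) / 2 - 1 / 2 * Real.log (curv m r j / (A * n))
        = Real.log (Real.pi / curv m r j) / 2 := by
      rw [Real.log_div hπ.ne' (by positivity), Real.log_div hc.ne' (by positivity),
        Real.log_div hπ.ne' hc.ne']
      ring
    rw [e1, e2, ← Real.log_sqrt (by positivity), Real.exp_log (by positivity)]
  simp_rw [e]
  rw [← Real.exp_sum, Real.rpow_def_of_pos (by positivity), ← Real.exp_add, Finset.sum_sub_distrib,
    ← Finset.mul_sum]
  simp only [Finset.sum_const, Finset.card_univ, Fintype.card_fin, nsmul_eq_mul]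
  congr 1
  ring

lemma SaddleData.exists_setIntegral_pairIntegrand_eq :
    ∃ K : ℝ, ∀ {n : ℕ} {m : Fin n → Fin n → ℝ} {x d r δ : Fin n → ℝ} {lam L M A : ℝ},
      SaddleData m x d r lam L M → K ≤ L → n ≤ Real.exp L →
      (∀ j, δ j = d j - lam * (n - 1) + lam * x j) → A = lam * (1 - lam) / 2 →
      Real.exp (1 / (6 * A)) * (L ^ 30 / M) ≤ 1 →
      ∃ u : ℝ, |u| ≤ Real.exp (1 / (6 * A)) * (L ^ 30 / M) ∧
        ∫ θ in {θ : Fin n → ℝ | ∀ j, |θ j| ≤ L ^ 2 / M}, pairIntegrand m d r θ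
          = (((2 : ℝ) ^ (-(1 : ℝ) / 2) * (Real.pi / (A * n)) ^ ((n : ℝ) / 2)
            * Real.exp (-(1 - 20 * A) / (24 * A) + lam * ((∑ j, x j) / 2) / ((1 - lam) * n)
              + (∑ j, δ j ^ 2) / (16 * A ^ 2 * n ^ 2) + u) : ℝ) : ℂ) := by
  obtain ⟨K, hK, hI⟩ := SaddleData.exists_norm_setIntegral_pairIntegrand_sub_le
  refine ⟨K, ?_⟩
  intro n m x d r δ lam L M A h hKL hnL hδ hA hsmall
  obtain ⟨σ, ρ, hs⟩ := h.exists_isScaling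
  have hM := h.M_pos
  have hL := h.L_pos
  have hLl := h.L_large
  have hn := h.n_pos
  have hq := h.lam_mul_pos
  have hA0 : 0 < A := by rw [hA]; positivity
  have hlog := h.abs_sum_log_curv_le hδ hA
  have key := hI h hs hKL hnL
  have hqA : lam * (1 - lam) = 2 * A := by rw [hA]; ring
  rw [hs.prod_eq hA0 hn, hqA] at key
  set Λ := -(1 / 2) * ∑ j, Real.log (curv m r j / (A * n)) with hΛ
  set B := (Real.pi / (A * n)) ^ ((n : ℝ) / 2) with hB
  set a₁ := 1 / 2 + 6 * ((1 - 6 * (2 * A)) / (24 * (2 * A))) with ha₁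
  set a₂ := -12 * ((1 - 4 * (2 * A)) / (36 * (2 * A))) with ha₂
  set E := Real.exp (1 / (6 * A)) with hE
  have hE0 : 0 < E := Real.exp_pos _
  have hBpos : 0 < B := Real.rpow_pos_of_pos (by positivity) _
  have ha₂E : Real.exp (-a₂) ≤ E * 4 := by
    have h4 : Real.exp (-a₂) ≤ E := by
      refine Real.exp_le_exp.2 ?_
      have e : -a₂ = 1 / (6 * A) - 4 / 3 := by rw [ha₂]; field_simp; ring
      linarith
    linarith
  have hs2 : √2 ≤ 2 := by rw [Real.sqrt_le_iff]; norm_num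
  have h30 : 0 ≤ E * (L ^ 30 / M) := by positivity
  have e28 : √2 * Real.exp (-a₂) * (L ^ 28 / M) ≤ 1 / 4 * (E * (L ^ 30 / M)) := by
    calc √2 * Real.exp (-a₂) * (L ^ 28 / M) ≤ 2 * (E * 4) * (L ^ 28 / M) := by gcongr
      _ = 1 / 4 * (E * ((32 * L ^ 28) / M)) := by ring
      _ ≤ 1 / 4 * (E * (L ^ 30 / M)) := by
          gcongr; exact mul_pow_le_pow hLl (by norm_num) (by norm_num)
  have e26 : L ^ 26 / M ≤ 1 / 2 * (E * (L ^ 30 / M)) := by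
    have h1 : 1 ≤ E := Real.one_le_exp (by positivity)
    calc L ^ 26 / M = 1 / 2 * (1 * ((2 * L ^ 26) / M)) := by ring
      _ ≤ 1 / 2 * (E * (L ^ 30 / M)) := by
          gcongr; exact mul_pow_le_pow hLl (by norm_num) (by norm_num)
  obtain ⟨v, hv, hv2⟩ := exists_eq_mul_exp_of_norm_sub_le (e := √2 * Real.exp (-a₂) * (L ^ 28 / M))
    (conj_setIntegral_pairIntegrand m d r (L ^ 2 / M)) (by positivity) (by linarith)
    (key.trans (le_of_eq (by
      have e2 : √2 ≠ 0 := by positivity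
      rw [Real.exp_neg]
      field_simp)))
  refine ⟨Λ - (1 / 2 + lam * ((∑ j, x j) / 2) / ((1 - lam) * n)
    + (∑ j, δ j ^ 2) / (16 * A ^ 2 * n ^ 2)) + v, (abs_add_le _ _).trans (by linarith), ?_⟩
  rw [hv2]
  congr 1
  have e2 : (2 : ℝ) ^ (-(1 : ℝ) / 2) = (√2)⁻¹ := by
    rw [Real.sqrt_eq_rpow, ← Real.rpow_neg (by norm_num)]
    norm_num
  have e3 : a₁ + a₂ = -(1 - 20 * A) / (24 * A) - 1 / 2 := by
    rw [ha₁, ha₂]; field_simp; ring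
  rw [e2]
  calc _ = (√2)⁻¹ * B * (Real.exp Λ * Real.exp a₁ * Real.exp a₂ * Real.exp v) := by ring
    _ = _ := by
        rw [← Real.exp_add, ← Real.exp_add, ← Real.exp_add, add_assoc Λ, e3]
        congr 2
        ring

/-- The indicator of the pairs which are not edges of `X`. -/
def nonEdge {n : ℕ} (X : SimpleGraph (Fin n)) (j k : Fin n) : ℝ :=
  if j ≠ k ∧ ¬ X.Adj j k then 1 else 0

lemma nonEdge_eq_one_iff {n : ℕ} {X : SimpleGraph (Fin n)} {j k : Fin n} :
    nonEdge X j k = 1 ↔ j ≠ k ∧ ¬ X.Adj j k := by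
  unfold nonEdge
  split_ifs with h <;> simp [h]

lemma sum_adj_eq_xDeg {n : ℕ} (X : SimpleGraph (Fin n)) (j : Fin n) :
    ∑ k, (if X.Adj j k then (1 : ℝ) else 0) = xDeg X j := by
  rw [Finset.sum_boole, xDeg, Nat.card_eq_fintype_card, SimpleGraph.card_neighborSet_eq_degree,
    ← SimpleGraph.card_neighborFinset_eq_degree, SimpleGraph.neighborFinset_eq_filter]

lemma sum_nonEdge {n : ℕ} (X : SimpleGraph (Fin n)) (j : Fin n) :
    ∑ k, nonEdge X j k = n - 1 - xDeg X j := by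
  have e : ∀ k, nonEdge X j k
      = 1 - (if j = k then 1 else 0) - (if X.Adj j k then (1 : ℝ) else 0) := fun k => by
    by_cases h : j = k
    · subst h; simp [nonEdge]
    · by_cases h' : X.Adj j k <;> simp [nonEdge, h, h']
  simp_rw [e, Finset.sum_sub_distrib, sum_adj_eq_xDeg]
  simp

lemma sum_xDeg {n : ℕ} (X : SimpleGraph (Fin n)) : ∑ j, (xDeg X j : ℝ) = 2 * xEdges X := by
  have h := X.sum_degrees_eq_twice_card_edges
  have h1 : xEdges X = #X.edgeFinset := by
    rw [xEdges, Nat.card_eq_fintype_card, SimpleGraph.edgeFinset_card]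
  have h2 : ∀ j, xDeg X j = X.degree j := fun j => by
    rw [xDeg, Nat.card_eq_fintype_card, SimpleGraph.card_neighborSet_eq_degree]
  simp_rw [h1, h2]
  exact_mod_cast h

lemma fInt_eq_pairIntegrand {n : ℕ} (d : Fin n → ℕ) (X : SimpleGraph (Fin n)) (r θ : Fin n → ℝ) :
    fInt d X r θ = pairIntegrand (nonEdge X) (fun j => (d j : ℝ)) r θ := by
  unfold fInt pairIntegrand
  congr 1
  refine Finset.prod_congr rfl fun j _ => Finset.prod_congr rfl fun k _ => ?_
  refine if_congr ?_ rfl rfl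
  rw [nonEdge_eq_one_iff]
  exact ⟨fun h => ⟨h.1, h.1.ne, h.2⟩, fun h => ⟨h.1, h.2.2⟩⟩

lemma lamb_mul {n : ℕ} (hn : 2 ≤ n) (d : Fin n → ℕ) : lamb d * ((n : ℝ) - 1) = dBar d := by
  have : (2 : ℝ) ≤ n := by exact_mod_cast hn
  exact div_mul_cancel₀ _ (by linarith)

lemma saddleData_of_graph {n : ℕ} (hn : 2 ≤ n) {d : Fin n → ℕ} {X : SimpleGraph (Fin n)}
    {r : Fin n → ℝ} {L M : ℝ} (hd : ∀ j, |(d j : ℝ) - dBar d| ≤ L ^ 3 * M)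
    (hx : ∀ j, (xDeg X j : ℝ) ≤ L ^ 3 * M) (hX : (xEdges X : ℝ) ≤ L ^ 5 * n)
    (hr : ∀ j, 0 < r j)
    (hsum : ∀ j, ∑ k, (if j ≠ k ∧ ¬ X.Adj j k then lamJK r j k else 0) = (d j : ℝ))
    (hlam : 1 ≤ L * (lamb d * (1 - lamb d))) (hL : 1000 ≤ L) (hLM : L ^ 100 ≤ M)
    (hM : M ^ 2 = n) :
    SaddleData (nonEdge X) (fun j => (xDeg X j : ℝ)) (fun j => (d j : ℝ)) r (lamb d) L M where
  m_eq j k := by unfold nonEdge; split_ifs <;> simp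
  m_symm j k := by simp only [nonEdge, X.adj_comm j k, ne_comm (a := j)]
  m_diag j := by simp [nonEdge]
  m_sum := sum_nonEdge X
  x_nonneg j := Nat.cast_nonneg _
  x_le := hx
  x_sum := by rw [sum_xDeg]; linarith
  r_pos := hr
  saddle j := by
    rw [← hsum j]
    refine Finset.sum_congr rfl fun k _ => ?_
    unfold nonEdge
    split_ifs <;> simp
  d_sum := by
    have h2 : (2 : ℝ) ≤ n := by exact_mod_cast hn
    rw [show lamb d * (n * ((n : ℝ) - 1)) = n * (lamb d * ((n : ℝ) - 1)) by ring, lamb_mul hn, dBar]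
    field_simp
  d_le j := by rw [lamb_mul hn]; exact hd j
  lam_lower := hlam
  L_large := hL
  L_le := hLM
  M_sq := hM

lemma one_div_mul_one_sub_le {p t : ℝ} (ht : 0 < t) (hp : 1 ≤ t * p) (hp1 : 1 ≤ t * (1 - p)) :
    0 < p * (1 - p) ∧ 1 / (p * (1 - p)) ≤ t + 2 := by
  have h0 : 0 < p := (mul_pos_iff_of_pos_left ht).1 (by linarith)
  have h1 : 0 < 1 - p := (mul_pos_iff_of_pos_left ht).1 (by linarith)
  refine ⟨mul_pos h0 h1, ?_⟩
  rw [div_le_iff₀ (mul_pos h0 h1)]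
  rcases le_total p (1 / 2) with h | h
  · nlinarith
  · nlinarith

lemma le_mul_lamb {n : ℕ} (hn : 2 ≤ n) {d : Fin n → ℕ} {t : ℝ} (ht : 0 < t)
    (h : (n : ℝ) / t ≤ min (dBar d) ((n : ℝ) - dBar d - 1)) :
    1 ≤ t * lamb d ∧ 1 ≤ t * (1 - lamb d) := by
  have h2 : (2 : ℝ) ≤ n := by exact_mod_cast hn
  have hp : (0 : ℝ) < n - 1 := by linarith
  obtain ⟨ha, hb⟩ := le_min_iff.1 h
  rw [div_le_iff₀ ht] at ha hb
  have hl := lamb_mul hn d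
  constructor
  · refine le_of_mul_le_mul_right ?_ hp
    calc 1 * ((n : ℝ) - 1) ≤ dBar d * t := by linarith
      _ = t * lamb d * (n - 1) := by rw [← hl]; ring
  · refine le_of_mul_le_mul_right ?_ hp
    calc 1 * ((n : ℝ) - 1) ≤ (n - dBar d - 1) * t := by linarith
      _ = t * (1 - lamb d) * (n - 1) := by rw [← hl]; ring

lemma exists_setIntegral_fInt_eq :
    ∃ K : ℝ, ∀ {n : ℕ} {d : Fin n → ℕ} {X : SimpleGraph (Fin n)} {r : Fin n → ℝ} {L M t : ℝ},
      2 ≤ n → (∀ j, |(d j : ℝ) - dBar d| ≤ L ^ 3 * M) → (∀ j, (xDeg X j : ℝ) ≤ L ^ 3 * M) →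
      (xEdges X : ℝ) ≤ L ^ 5 * n → (∀ j, 0 < r j) →
      (∀ j, ∑ k, (if j ≠ k ∧ ¬ X.Adj j k then lamJK r j k else 0) = (d j : ℝ)) →
      0 < t → (n : ℝ) / t ≤ min (dBar d) ((n : ℝ) - dBar d - 1) →
      t + 2 ≤ L → 1000 ≤ L → K ≤ L → L ^ 100 ≤ M → M ^ 2 = n → n ≤ Real.exp L →
      Real.exp ((t + 2) / 3) * (L ^ 30 / M) ≤ 1 →
      ∃ u : ℝ, |u| ≤ Real.exp ((t + 2) / 3) * (L ^ 30 / M) ∧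
        ∫ θ in {θ : Fin n → ℝ | ∀ j, |θ j| ≤ L ^ 2 / M}, fInt d X r θ
          = (((2 : ℝ) ^ (-(1 : ℝ) / 2) * (Real.pi / (aPar d * n)) ^ ((n : ℝ) / 2)
            * Real.exp (-(1 - 20 * aPar d) / (24 * aPar d)
              + lamb d * (xEdges X : ℝ) / ((1 - lamb d) * n)
              + (∑ j, deltaPar d X j ^ 2) / (16 * aPar d ^ 2 * n ^ 2) + u) : ℝ) : ℂ) := by
  obtain ⟨K, hK⟩ := SaddleData.exists_setIntegral_pairIntegrand_eq
  refine ⟨K, ?_⟩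
  intro n d X r L M t hn hd hx hX hr hsum ht htn htL hL hKL hLM hM hnL hsmall
  obtain ⟨h1, h2⟩ := le_mul_lamb hn ht htn
  obtain ⟨hq, hq2⟩ := one_div_mul_one_sub_le ht h1 h2
  have hlam : 1 ≤ L * (lamb d * (1 - lamb d)) := by
    rw [div_le_iff₀ hq] at hq2
    exact hq2.trans (mul_le_mul_of_nonneg_right htL hq.le)
  have h := saddleData_of_graph hn hd hx hX hr hsum hlam hL hLM hM
  have hE : Real.exp (1 / (6 * aPar d)) ≤ Real.exp ((t + 2) / 3) := by
    refine Real.exp_le_exp.2 ?_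
    have e : 1 / (6 * aPar d) = 1 / (lamb d * (1 - lamb d)) / 3 := by
      rw [aPar, div_div]; congr 1; ring
    rw [e]
    exact div_le_div_of_nonneg_right hq2 (by norm_num)
  have hLM0 : 0 ≤ L ^ 30 / M := div_nonneg (by positivity) h.M_pos.le
  have hEL := mul_le_mul_of_nonneg_right hE hLM0
  obtain ⟨u, hu, hI⟩ := hK (δ := deltaPar d X) (A := aPar d) h hKL hnL
    (fun j => by rw [deltaPar, lamb_mul hn]) rfl (hEL.trans hsmall)
  refine ⟨u, hu.trans hEL, ?_⟩
  simp_rw [fInt_eq_pairIntegrand]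
  rw [hI, sum_xDeg, mul_div_cancel_left₀ _ (two_ne_zero)]

lemma eventually_scales {ε b : ℝ} (hε : 0 < ε) (hb : 0 < b) (a K : ℝ) :
    ∀ᶠ n : ℕ in atTop, 2 ≤ n ∧ 0 < Real.log n ∧ K ≤ (n : ℝ) ^ (ε / 2) ∧
      Real.log n ≤ (n : ℝ) ^ (ε / 2) ∧ 3 * a * Real.log n + 2 ≤ (n : ℝ) ^ (ε / 2) ∧
      Real.exp (2 / 3) * (n : ℝ) ^ (-b) ≤ 1 := by
  have hcast := tendsto_natCast_atTop_atTop (R := ℝ)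
  have hL : Tendsto (fun n : ℕ => (n : ℝ) ^ (ε / 2)) atTop atTop :=
    (tendsto_rpow_atTop (by positivity)).comp hcast
  have hb0 : Tendsto (fun n : ℕ => Real.exp (2 / 3) * (n : ℝ) ^ (-b)) atTop (𝓝 0) := by
    simpa using ((tendsto_rpow_neg_atTop hb).comp hcast).const_mul (Real.exp (2 / 3))
  have hlog := ((isLittleO_log_rpow_atTop (show 0 < ε / 2 by positivity)).comp_tendsto hcast).def
    (show 0 < 1 / (2 * (1 + 3 * |a|)) by positivity)
  filter_upwards [eventually_ge_atTop 2, hL.eventually_ge_atTop (max K 4), hlog,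
    hb0.eventually (ge_mem_nhds zero_lt_one)] with n hn hK hlg hbn
  have hn2 : (2 : ℝ) ≤ n := by exact_mod_cast hn
  have hlog0 : 0 < Real.log n := Real.log_pos (by linarith)
  have hL0 : 0 < (n : ℝ) ^ (ε / 2) := Real.rpow_pos_of_pos (by linarith) _
  simp only [Function.comp_apply, Real.norm_eq_abs, abs_of_pos hlog0, abs_of_pos hL0] at hlg
  rw [one_div_mul_eq_div, le_div_iff₀ (by positivity)] at hlg
  have h4 := (le_max_right K 4).trans hK
  have ha := mul_le_mul_of_nonneg_right (le_abs_self a) hlog0.le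
  have ha0 := mul_nonneg (abs_nonneg a) hlog0.le
  exact ⟨hn, hlog0, (le_max_left K 4).trans hK, by linarith, by linarith, hbn⟩

end

/-- Lemma 3.1: the saddle-point estimate for the integral of `F` over a region
`S` with `ℛ ⊆ S ⊆ 4ℛ`.  Here `R₂ = Σ_j δ_j²`. -/
theorem stmt17 (a b : ℝ) (ha : 0 < a) (hb : 0 < b) (hab : a + b < 1/2) :
    ∃ ε : ℝ, 0 < ε ∧
      ∀ (d : (n : ℕ) → Fin n → ℕ) (X : (n : ℕ) → SimpleGraph (Fin n))
        (r : (n : ℕ) → Fin n → ℝ),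
        (∀ n, Even (∑ j, d n j)) →
        (∃ C : ℝ, ∀ (n : ℕ) (j : Fin n),
            |(d n j : ℝ) - dBar (d n)| ≤ C * (n : ℝ) ^ ((1:ℝ)/2 + ε)) →
        (∃ C : ℝ, ∀ (n : ℕ) (j : Fin n),
            (xDeg (X n) j : ℝ) ≤ C * (n : ℝ) ^ ((1:ℝ)/2 + ε)) →
        (∃ C : ℝ, ∀ n : ℕ, (xEdges (X n) : ℝ) ≤ C * (n : ℝ) ^ ((1:ℝ) + 2*ε)) →
        (∀ᶠ n : ℕ in atTop,
            (n : ℝ) / (3 * a * Real.log n) ≤ min (dBar (d n)) ((n : ℝ) - dBar (d n) - 1)) →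
        (∀ (n : ℕ) (j : Fin n), 0 < r n j) →
        (∀ (n : ℕ) (j : Fin n),
            ∑ k, (if j ≠ k ∧ ¬ (X n).Adj j k then lamJK (r n) j k else 0) = (d n j : ℝ)) →
        ∃ C : ℝ, ∀ᶠ n : ℕ in atTop,
          ∃ (S : Set (Fin n → ℝ)) (err : ℝ),
            box n 1 ε ⊆ S ∧ S ⊆ box n 4 ε ∧ |err| ≤ C * (n : ℝ) ^ (-b) ∧
            (∫ θ in S, fInt (d n) (X n) (r n) θ)
              = (((2 : ℝ) ^ (-(1:ℝ)/2)
                  * (Real.pi / (aPar (d n) * (n : ℝ))) ^ ((n : ℝ)/2)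
                  * Real.exp (
                      -(1 - 20 * aPar (d n)) / (24 * aPar (d n))
                    + lamb (d n) * (xEdges (X n) : ℝ) / ((1 - lamb (d n)) * (n : ℝ))
                    + (∑ j, deltaPar (d n) (X n) j ^ 2)
                        / (16 * aPar (d n)^2 * (n : ℝ)^2)
                    + err) : ℝ) : ℂ) := by
  obtain ⟨K, hK⟩ := exists_setIntegral_fInt_eq
  obtain ⟨ε, hε⟩ : ∃ ε : ℝ, ε = (1 / 2 - a - b) / 50 := ⟨_, rfl⟩
  have hε0 : 0 < ε := by linarith
  refine ⟨ε, hε0, ?_⟩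
  rintro d X r - ⟨C₁, hd⟩ ⟨C₂, hx⟩ ⟨C₃, hX⟩ hmin hr hsum
  refine ⟨Real.exp (2 / 3), ?_⟩
  filter_upwards [hmin, eventually_scales hε0 hb a (|C₁| + |C₂| + |C₃| + |K| + 1000)]
    with n hmin ⟨hn, hlog, hKL, hlogL, htL, hsmall⟩
  have hn2 : (2 : ℝ) ≤ n := by exact_mod_cast hn
  have hn0 : (0 : ℝ) < n := by linarith
  set L := (n : ℝ) ^ (ε / 2) with hL
  set M := (n : ℝ) ^ ((1 : ℝ) / 2) with hM
  have hL0 : 0 < L := Real.rpow_pos_of_pos hn0 _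
  have hM0 : 0 < M := Real.rpow_pos_of_pos hn0 _
  have hLpow : ∀ k : ℕ, L ^ k = (n : ℝ) ^ (ε / 2 * k) := fun k => by
    rw [hL, ← Real.rpow_natCast, ← Real.rpow_mul hn0.le]
  have hMsq : M ^ 2 = n := by
    rw [hM, ← Real.rpow_natCast, ← Real.rpow_mul hn0.le]; norm_num
  have eLM : (n : ℝ) ^ ((1 : ℝ) / 2 + ε) = L ^ 2 * M := by
    rw [hLpow, hM, ← Real.rpow_add hn0]; congr 1; push_cast; ring
  have eX : (n : ℝ) ^ ((1 : ℝ) + 2 * ε) = L ^ 4 * n := by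
    rw [hLpow]
    nth_rewrite 3 [← Real.rpow_one (n : ℝ)]
    rw [← Real.rpow_add hn0]; congr 1; push_cast; ring
  have eBox : (n : ℝ) ^ (-(1 : ℝ) / 2 + ε) = L ^ 2 / M := by
    rw [hLpow, hM, ← Real.rpow_sub hn0]; congr 1; push_cast; ring
  have hbound : Real.exp ((3 * a * Real.log n + 2) / 3) * (L ^ 30 / M)
      ≤ Real.exp (2 / 3) * (n : ℝ) ^ (-b) := by
    have e : Real.exp ((3 * a * Real.log n + 2) / 3) = Real.exp (2 / 3) * (n : ℝ) ^ a := by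
      rw [Real.rpow_def_of_pos hn0, ← Real.exp_add]; congr 1; ring
    rw [e, mul_assoc]
    refine mul_le_mul_of_nonneg_left ?_ (Real.exp_pos _).le
    rw [hLpow, hM, ← Real.rpow_sub hn0, ← Real.rpow_add hn0]
    refine Real.rpow_le_rpow_of_exponent_le (by linarith) ?_
    push_cast; linarith
  have hC₁ := le_abs_self C₁
  have hC₂ := le_abs_self C₂
  have hC₃ := le_abs_self C₃
  have hK' := le_abs_self K
  have n₁ := abs_nonneg C₁
  have n₂ := abs_nonneg C₂
  have n₃ := abs_nonneg C₃
  have n₄ := abs_nonneg K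
  obtain ⟨u, hu, hI⟩ := hK (d := d n) (X := X n) (r := r n) (L := L) (M := M)
    (t := 3 * a * Real.log n) hn
    (fun j => (hd n j).trans (by
      rw [eLM]
      calc C₁ * (L ^ 2 * M) ≤ L * (L ^ 2 * M) := by gcongr; linarith
        _ = L ^ 3 * M := by ring))
    (fun j => (hx n j).trans (by
      rw [eLM]
      calc C₂ * (L ^ 2 * M) ≤ L * (L ^ 2 * M) := by gcongr; linarith
        _ = L ^ 3 * M := by ring))
    ((hX n).trans (by
      rw [eX]
      calc C₃ * (L ^ 4 * n) ≤ L * (L ^ 4 * n) := by gcongr; linarith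
        _ = L ^ 5 * n := by ring))
    (hr n) (hsum n) (by positivity) hmin htL (by linarith) (by linarith)
    (by
      rw [hLpow]
      exact Real.rpow_le_rpow_of_exponent_le (by linarith) (by push_cast; linarith))
    hMsq
    (by
      calc (n : ℝ) = Real.exp (Real.log n) := (Real.exp_log hn0).symm
        _ ≤ Real.exp L := Real.exp_le_exp.2 hlogL)
    (hbound.trans hsmall)
  refine ⟨box n 1 ε, u, subset_rfl, fun θ hθ j => (hθ j).trans ?_, hu.trans hbound, ?_⟩
  · gcongr; norm_num
  · have hbox : box n 1 ε = {θ : Fin n → ℝ | ∀ j, |θ j| ≤ L ^ 2 / M} := by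
      ext θ
      change (∀ j, |θ j| ≤ 1 * (n : ℝ) ^ (-(1 : ℝ) / 2 + ε)) ↔ _
      rw [one_mul, eBox]
      rfl
    rw [hbox, hI]
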